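/- Let H be a function that is holomorphic and uniformly bounded on the half-plane Re(s) ≥ 1/4, and set D(s) := ζ_{ℚ(ζ_3)}(2s) · ζ(4s)^{−1} · ζ_{ℚ(ζ_3)}(4s)^{−2} · H(s). Then for each σ ≥ 1/4 and each T ≥ 2, ∫_0^T |D(σ + it)| dt ≪ T log T, where the implied constant may depend on σ and H but not on T. -/

import Mathlib

/-!
STATEMENT 15: Let H be holomorphic and uniformly bounded on Re s ≥ 1/4 and set
D(s) = ζ_{ℚ(ζ₃)}(2s) · ζ(4s)⁻¹ · ζ_{ℚ(ζ₃)}(4s)⁻² · H(s).  Then for σ ≥ 1/4 and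
T ≥ 2 one has ∫_0^T |D(σ+it)| dt ≪ T log T, uniformly in T.

Here ζ is the Riemann zeta function and ζ_{ℚ(ζ₃)} is the Dedekind zeta function
of the third cyclotomic field, represented by any function Z₃ : ℂ → ℂ that is
differentiable away from s = 1 and agrees with the Dedekind zeta Dirichlet
series on Re s > 1.
-/

open Complex

/-- The Dedekind zeta Dirichlet series of a number field, `Σ_{I ≠ 0} N(I)^{-s}`. -/
noncomputable def dedekindZetaSeries (K : Type*) [Field K] [NumberField K] (s : ℂ) : ℂ :=
  ∑' I : Ideal (NumberField.RingOfIntegers K), (Ideal.absNorm I : ℂ) ^ (-s)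

section Plancherel
open MeasureTheory

lemma gaussianKernel_lintegral {b : ℝ} (hb : 0 < b) (v : ℝ) :
    ∫⁻ u : ℝ, ENNReal.ofReal (√(Real.pi / b) * Real.exp (-(1 / (4 * b)) * (u - v) ^ 2))
      = ENNReal.ofReal (2 * Real.pi) := by
  have hb' : 0 < 1 / (4 * b) := by positivity
  have hInt : Integrable (fun u : ℝ => Real.exp (-(1 / (4 * b)) * (u - v) ^ 2)) :=
    (integrable_exp_neg_mul_sq hb').comp_sub_right v
  rw [← ofReal_integral_eq_lintegral_ofReal (hInt.const_mul _) (ae_of_all _ fun u => by positivity),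
    integral_const_mul,
    integral_sub_right_eq_self (fun u : ℝ => Real.exp (-(1 / (4 * b)) * u ^ 2)) v,
    integral_gaussian, ← Real.sqrt_mul (by positivity)]
  congr 1
  rw [show Real.pi / b * (Real.pi / (1 / (4 * b))) = (2 * Real.pi) ^ 2 by field_simp; norm_num]
  exact Real.sqrt_sq (by positivity)

lemma integral_gaussian_mul_cexp {b : ℝ} (hb : 0 < b) (x : ℝ) :
    ‖∫ t : ℝ, (Real.exp (-b * t ^ 2) : ℂ) * cexp (I * t * x)‖
      ≤ √(Real.pi / b) * Real.exp (-(1 / (4 * b)) * x ^ 2) := by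
  have h := fourierIntegral_gaussian (b := (b : ℂ)) (by simpa using hb) (x : ℂ)
  have h2 : (∫ t : ℝ, (Real.exp (-b * t ^ 2) : ℂ) * cexp (I * t * x))
      = (↑Real.pi / (b : ℂ)) ^ (1 / 2 : ℂ) * cexp (-(x : ℂ) ^ 2 / (4 * b)) := by
    rw [← h]
    refine integral_congr_ae (ae_of_all _ fun t => ?_)
    simp only
    rw [mul_comm, mul_right_comm I]
    push_cast
    rfl
  rw [h2, norm_mul]
  have e1 : ‖(↑Real.pi / (b : ℂ)) ^ (1 / 2 : ℂ)‖ = √(Real.pi / b) := by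
    rw [Real.sqrt_eq_rpow, show (↑Real.pi / (b : ℂ)) = ((Real.pi / b : ℝ) : ℂ) by push_cast; rfl,
      Complex.norm_cpow_eq_rpow_re_of_pos (by positivity)]
    norm_num
  have e2 : ‖cexp (-(x : ℂ) ^ 2 / (4 * b))‖ = Real.exp (-(1 / (4 * b)) * x ^ 2) := by
    rw [show (-(x : ℂ) ^ 2 / (4 * b)) = ((-(1 / (4 * b)) * x ^ 2 : ℝ) : ℂ) by push_cast; ring,
      Complex.norm_exp, Complex.ofReal_re]
  rw [e1, e2]

/-- An upper-bound form of Plancherel's theorem for integrable functions, on a bounded range of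
frequencies. -/
lemma intervalIntegral_norm_sq_fourier_le {h : ℝ → ℂ} (hi : Integrable h) {B : ℝ} (hB : 0 ≤ B)
    (h2 : ∫⁻ u, ‖h u‖ₑ ^ 2 ≤ ENNReal.ofReal B) {R : ℝ} (hR : 0 < R) :
    ∫ t in (-R)..R, ‖∫ u : ℝ, h u * cexp (I * t * u)‖ ^ 2 ≤ 20 * B := by
  set b : ℝ := 1 / R ^ 2 with hbdef
  have hb : 0 < b := by positivity
  set H : ℝ → ℂ := fun t => ∫ u : ℝ, h u * cexp (I * t * u) with hH
  have hbound : ∀ t, ‖H t‖ ≤ ∫ u, ‖h u‖ := by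
    intro t
    refine (norm_integral_le_integral_norm _).trans (le_of_eq ?_)
    refine integral_congr_ae (ae_of_all _ fun u => ?_)
    simp only [norm_mul]
    rw [show I * (t : ℂ) * u = ((t * u : ℝ) : ℂ) * I by push_cast; ring, norm_exp_ofReal_mul_I,
      mul_one]
  have hcont : Continuous H := by
    refine continuous_of_dominated (bound := fun u => ‖h u‖) ?_ ?_ hi.norm ?_
    · intro t
      exact hi.aestronglyMeasurable.mul (by fun_prop)
    · intro t
      refine ae_of_all _ fun u => ?_
      rw [norm_mul, show I * (t : ℂ) * u = ((t * u : ℝ) : ℂ) * I by push_cast; ring,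
        norm_exp_ofReal_mul_I, mul_one]
    · exact ae_of_all _ fun u => by fun_prop
  have hw : Integrable (fun t : ℝ => Real.exp (-b * t ^ 2)) := integrable_exp_neg_mul_sq hb
  -- the weighted integral as a double integral
  let P : ℝ → ℝ × ℝ → ℂ := fun t p =>
    ((Real.exp (-b * t ^ 2) : ℂ) * (h p.1 * (starRingEnd ℂ) (h p.2))) *
      cexp (I * t * (p.1 - p.2 : ℝ))
  have hconj : Integrable (fun v => (starRingEnd ℂ) (h v)) := by
    have := hi.norm
    refine (integrable_norm_iff ?_).1 ?_
    · exact Complex.continuous_conj.comp_aestronglyMeasurable hi.aestronglyMeasurable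
    · simpa using this
  have hPint : Integrable (Function.uncurry P) (volume.prod (volume.prod volume)) := by
    have h1 : Integrable (fun z : ℝ × (ℝ × ℝ) =>
        (Real.exp (-b * z.1 ^ 2) : ℂ) * (h z.2.1 * (starRingEnd ℂ) (h z.2.2)))
        (volume.prod (volume.prod volume)) :=
      (hw.ofReal (𝕜 := ℂ)).mul_prod (hi.mul_prod hconj)
    refine h1.mul_bdd (c := 1) ?_ ?_
    · exact Continuous.aestronglyMeasurable (by fun_prop)
    · refine ae_of_all _ fun z => le_of_eq ?_
      rw [show I * (z.1 : ℂ) * ((z.2.1 - z.2.2 : ℝ) : ℂ) = ((z.1 * (z.2.1 - z.2.2) : ℝ) : ℂ) * I by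
        push_cast; ring, norm_exp_ofReal_mul_I]
  have key1 : ∀ t : ℝ, ∫ p, P t p ∂(volume.prod volume) =
      ((Real.exp (-b * t ^ 2) * ‖H t‖ ^ 2 : ℝ) : ℂ) := by
    intro t
    have e1 : ∀ p : ℝ × ℝ, P t p = (Real.exp (-b * t ^ 2) : ℂ) *
        ((h p.1 * cexp (I * t * p.1)) * (starRingEnd ℂ) (h p.2 * cexp (I * t * p.2))) := by
      intro p
      simp only [P]
      rw [map_mul, ← Complex.exp_conj]
      simp only [map_mul, Complex.conj_I, Complex.conj_ofReal]
      rw [show I * (t : ℂ) * ((p.1 - p.2 : ℝ) : ℂ) = I * t * p.1 + (-I * t * p.2) by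
        push_cast; ring, Complex.exp_add]
      ring
    simp_rw [e1]
    rw [integral_const_mul, integral_prod_mul (fun u => h u * cexp (I * t * u))
      (fun v => (starRingEnd ℂ) (h v * cexp (I * t * v))), integral_conj]
    push_cast
    rw [Complex.mul_conj]
    congr 1
    rw [Complex.normSq_eq_norm_sq]
    push_cast
    rfl
  have key2 : ((∫ t, Real.exp (-b * t ^ 2) * ‖H t‖ ^ 2 : ℝ) : ℂ) =
      ∫ p : ℝ × ℝ, (h p.1 * (starRingEnd ℂ) (h p.2)) *
        (∫ t : ℝ, (Real.exp (-b * t ^ 2) : ℂ) * cexp (I * t * (p.1 - p.2 : ℝ))) := by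
    rw [← integral_complex_ofReal]
    simp_rw [← key1]
    rw [integral_integral_swap hPint]
    refine integral_congr_ae (ae_of_all _ fun p => ?_)
    simp only [P]
    rw [← integral_const_mul]
    refine integral_congr_ae (ae_of_all _ fun t => ?_)
    simp only
    ring
  set g : ℝ → ℝ := fun x => √(Real.pi / b) * Real.exp (-(1 / (4 * b)) * x ^ 2) with hg
  have hgm : Measurable g := by fun_prop
  have hg0 : ∀ x, 0 ≤ g x := fun x => by positivity
  have hhm : AEMeasurable (fun u => ‖h u‖ₑ) := hi.aestronglyMeasurable.enorm
  have key3 : ENNReal.ofReal (∫ t, Real.exp (-b * t ^ 2) * ‖H t‖ ^ 2) ≤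
      ENNReal.ofReal (2 * Real.pi) * ENNReal.ofReal B := by
    have hnn : 0 ≤ ∫ t, Real.exp (-b * t ^ 2) * ‖H t‖ ^ 2 := integral_nonneg fun t => by positivity
    have : ENNReal.ofReal (∫ t, Real.exp (-b * t ^ 2) * ‖H t‖ ^ 2) =
        ‖((∫ t, Real.exp (-b * t ^ 2) * ‖H t‖ ^ 2 : ℝ) : ℂ)‖ₑ := by
      rw [← ofReal_norm, Complex.norm_real, Real.norm_of_nonneg hnn]
    rw [this, key2]
    refine (enorm_integral_le_lintegral_enorm _).trans ?_
    have hpt : ∀ p : ℝ × ℝ, ‖(h p.1 * (starRingEnd ℂ) (h p.2)) *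
        (∫ t : ℝ, (Real.exp (-b * t ^ 2) : ℂ) * cexp (I * t * (p.1 - p.2 : ℝ)))‖ₑ ≤
        (2 : ENNReal)⁻¹ * (‖h p.1‖ₑ ^ 2 * ENNReal.ofReal (g (p.2 - p.1))
          + ‖h p.2‖ₑ ^ 2 * ENNReal.ofReal (g (p.1 - p.2))) := by
      intro p
      have hs : g (p.2 - p.1) = g (p.1 - p.2) := by simp only [hg]; ring_nf
      rw [hs, ← add_mul, ← ofReal_norm, ← ofReal_norm, ← ofReal_norm,
        ← ENNReal.ofReal_pow (norm_nonneg _), ← ENNReal.ofReal_pow (norm_nonneg _),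
        ← ENNReal.ofReal_add (by positivity) (by positivity),
        ← ENNReal.ofReal_mul (by positivity),
        show (2 : ENNReal)⁻¹ = ENNReal.ofReal (2⁻¹) by
          rw [ENNReal.ofReal_inv_of_pos (by norm_num)]; simp,
        ← ENNReal.ofReal_mul (by positivity)]
      refine ENNReal.ofReal_le_ofReal ?_
      rw [norm_mul, norm_mul, RCLike.norm_conj]
      have := integral_gaussian_mul_cexp hb (p.1 - p.2)
      calc ‖h p.1‖ * ‖h p.2‖ * _ ≤ ‖h p.1‖ * ‖h p.2‖ * g (p.1 - p.2) := by gcongr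
        _ ≤ 2⁻¹ * (‖h p.1‖ ^ 2 + ‖h p.2‖ ^ 2) * g (p.1 - p.2) := by
            exact mul_le_mul_of_nonneg_right
              (by nlinarith [sq_nonneg (‖h p.1‖ - ‖h p.2‖)]) (hg0 _)
        _ = _ := by ring
    refine (lintegral_mono hpt).trans ?_
    have hm1 : AEMeasurable (fun p : ℝ × ℝ => ‖h p.1‖ₑ ^ 2 * ENNReal.ofReal (g (p.2 - p.1)))
        (volume.prod volume) := by
      exact ((hhm.comp_fst).pow_const 2).mul
        (hgm.comp (measurable_snd.sub measurable_fst)).ennreal_ofReal.aemeasurable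
    have hm2 : AEMeasurable (fun p : ℝ × ℝ => ‖h p.2‖ₑ ^ 2 * ENNReal.ofReal (g (p.1 - p.2)))
        (volume.prod volume) := by
      exact ((hhm.comp_snd).pow_const 2).mul
        (hgm.comp (measurable_fst.sub measurable_snd)).ennreal_ofReal.aemeasurable
    rw [lintegral_const_mul' _ _ (by simp)]
    rw [show (∫⁻ p : ℝ × ℝ, (‖h p.1‖ₑ ^ 2 * ENNReal.ofReal (g (p.2 - p.1))
          + ‖h p.2‖ₑ ^ 2 * ENNReal.ofReal (g (p.1 - p.2)))) =
        ∫⁻ p : ℝ × ℝ, (‖h p.1‖ₑ ^ 2 * ENNReal.ofReal (g (p.2 - p.1))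
          + ‖h p.2‖ₑ ^ 2 * ENNReal.ofReal (g (p.1 - p.2))) ∂(volume.prod volume) from rfl]
    rw [lintegral_add_left' hm1, lintegral_prod _ hm1, lintegral_prod_symm _ hm2]
    have hgk : ∀ v, ∫⁻ u, ENNReal.ofReal (g (u - v)) = ENNReal.ofReal (2 * Real.pi) :=
      gaussianKernel_lintegral hb
    have : ∀ v, ∫⁻ u, ‖h v‖ₑ ^ 2 * ENNReal.ofReal (g (u - v)) =
        ‖h v‖ₑ ^ 2 * ENNReal.ofReal (2 * Real.pi) := by
      intro v
      rw [lintegral_const_mul _ (by fun_prop), hgk]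
    simp_rw [this]
    rw [lintegral_mul_const' _ _ ENNReal.ofReal_ne_top, ← two_mul, ← mul_assoc,
      ENNReal.inv_mul_cancel (by simp) (by simp), one_mul, mul_comm]
    gcongr
  have key4 : ∫ t, Real.exp (-b * t ^ 2) * ‖H t‖ ^ 2 ≤ 2 * Real.pi * B := by
    rw [← ENNReal.ofReal_mul (by positivity)] at key3
    exact (ENNReal.ofReal_le_ofReal_iff (by positivity)).1 key3
  have hwint : Integrable (fun t : ℝ => Real.exp (-b * t ^ 2) * ‖H t‖ ^ 2) := by
    refine hw.mul_bdd (c := (∫ u, ‖h u‖) ^ 2) (by fun_prop) (ae_of_all _ fun t => ?_)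
    rw [norm_pow, norm_norm]
    gcongr
    exact hbound t
  have hfin : ∫ t in (-R)..R, ‖H t‖ ^ 2 ≤
      Real.exp 1 * ∫ t, Real.exp (-b * t ^ 2) * ‖H t‖ ^ 2 := by
    rw [intervalIntegral.integral_of_le (by linarith), ← integral_const_mul]
    refine le_trans ?_ (setIntegral_le_integral (s := Set.Ioc (-R) R) (hwint.const_mul _)
      (ae_of_all _ fun t => by positivity))
    refine setIntegral_mono_on ?_ (hwint.const_mul _).integrableOn measurableSet_Ioc ?_
    · exact ((hcont.norm.pow 2).integrableOn_Icc).mono_set Set.Ioc_subset_Icc_self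
    · intro t ht
      have : 1 ≤ Real.exp 1 * Real.exp (-b * t ^ 2) := by
        rw [← Real.exp_add]
        refine Real.one_le_exp ?_
        have : b * t ^ 2 ≤ 1 := by
          rw [hbdef, one_div, inv_mul_le_iff₀ (by positivity), mul_one]
          nlinarith [ht.1, ht.2]
        linarith
      calc ‖H t‖ ^ 2 = 1 * ‖H t‖ ^ 2 := (one_mul _).symm
        _ ≤ (Real.exp 1 * Real.exp (-b * t ^ 2)) * ‖H t‖ ^ 2 := by gcongr
        _ = _ := by ring
  refine hfin.trans ?_
  have he : Real.exp 1 * (2 * Real.pi) ≤ 20 := by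
    nlinarith [Real.exp_one_lt_d9, Real.pi_lt_d2, Real.exp_pos 1, Real.pi_pos]
  calc _ ≤ Real.exp 1 * (2 * Real.pi * B) := by gcongr
    _ = Real.exp 1 * (2 * Real.pi) * B := by ring
    _ ≤ _ := by gcongr

end Plancherel

section MellinWindow
open MeasureTheory Set

lemma exp_image_univ : Real.exp '' univ = Ioi (0:ℝ) := by
  rw [image_univ, Real.range_exp]

lemma integral_Ioi_eq_integral_exp (G : ℝ → ℂ) :
    ∫ x in Ioi (0:ℝ), G x = ∫ u : ℝ, Real.exp u • G (Real.exp u) := by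
  rw [← exp_image_univ, integral_image_eq_integral_abs_deriv_smul MeasurableSet.univ
    (fun u _ => (Real.hasDerivAt_exp u).hasDerivWithinAt) Real.exp_injective.injOn]
  simp [Real.abs_exp]

lemma integrableOn_Ioi_iff_integrable_exp (G : ℝ → ℂ) :
    IntegrableOn G (Ioi (0:ℝ)) ↔ Integrable (fun u : ℝ => Real.exp u • G (Real.exp u)) := by
  rw [← exp_image_univ, integrableOn_image_iff_integrableOn_abs_deriv_smul MeasurableSet.univ
    (fun u _ => (Real.hasDerivAt_exp u).hasDerivWithinAt) Real.exp_injective.injOn]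
  simp [Real.abs_exp]

lemma lintegral_Ioi_eq_lintegral_exp (G : ℝ → ENNReal) :
    ∫⁻ x in Ioi (0:ℝ), G x = ∫⁻ u : ℝ, ENNReal.ofReal (Real.exp u) * G (Real.exp u) := by
  rw [← exp_image_univ, lintegral_image_eq_lintegral_abs_deriv_mul MeasurableSet.univ
    (fun u _ => (Real.hasDerivAt_exp u).hasDerivWithinAt) Real.exp_injective.injOn]
  simp [Real.abs_exp]

lemma exp_smul_cpow (u : ℝ) (s z : ℂ) :
    Real.exp u • (z * ((Real.exp u : ℝ) : ℂ) ^ (-s - 1)) = z * cexp (-s * u) := by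
  rw [cpow_def_of_ne_zero (by simp),
    ← Complex.ofReal_log (Real.exp_pos u).le, Real.log_exp, Complex.real_smul, Complex.ofReal_exp,
    mul_left_comm, ← Complex.exp_add]
  congr 2
  ring

lemma norm_exp_sub_one_ge {z : ℂ} (hz : ‖z‖ ≤ 1 / 2) : ‖z‖ / 2 ≤ ‖cexp z - 1‖ := by
  have h := Complex.norm_exp_sub_one_sub_id_le (x := z) (by linarith)
  have h2 : ‖z‖ - ‖cexp z - 1 - z‖ ≤ ‖cexp z - 1‖ := by
    have := norm_sub_norm_le z (-(cexp z - 1 - z))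
    rw [norm_neg] at this
    rwa [show z - -(cexp z - 1 - z) = cexp z - 1 by ring] at this
  nlinarith [norm_nonneg z]

/-- Plancherel bound for the mean square of `s` times a Mellin transform on a vertical segment, in
terms of multiplicative differences. -/
lemma ofReal_mul_integral_mellin_sq_le {f : ℝ → ℂ} {α : ℝ} (hα : 0 < α)
    (hInt : IntegrableOn (fun x : ℝ => f x * (x:ℂ) ^ (-(α:ℂ) - 1)) (Ioi 0)) {T h : ℝ}
    (hT : 0 < T) (hh : 0 < h) (hTh : (T + α) * h ≤ 1 / 2) :
    ENNReal.ofReal (h ^ 2 * ∫ t in (-T)..T,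
        ‖(α + t * I) * ∫ x in Ioi (0:ℝ), f x * (x:ℂ) ^ (-(α + t * I) - 1)‖ ^ 2) ≤
      80 * ∫⁻ x in Ioi (0:ℝ), ‖f (x * Real.exp h) - f x‖ₑ ^ 2 *
        ENNReal.ofReal (x ^ (-2 * α - 1)) := by
  set g : ℝ → ℂ := fun u => f (Real.exp u) * cexp (-(α:ℂ) * u) with hg
  have hgi : Integrable g := by
    rw [integrableOn_Ioi_iff_integrable_exp] at hInt
    refine hInt.congr (ae_of_all _ fun u => ?_)
    simp only [hg]
    exact exp_smul_cpow u α (f (Real.exp u))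
  set k : ℝ → ℂ := fun u => cexp ((α:ℂ) * h) * g (u + h) - g u with hk
  have hgi2 : Integrable (fun u => cexp ((α:ℂ) * h) * g (u + h)) :=
    (hgi.comp_add_right h).const_mul _
  have hki : Integrable k := hgi2.sub hgi
  set Φ : ℝ → ℂ := fun t => ∫ x in Ioi (0:ℝ), f x * (x:ℂ) ^ (-(α + t * I) - 1) with hΦ
  have hΦg : ∀ t, Φ t = ∫ u : ℝ, g u * cexp (I * (-t : ℝ) * u) := by
    intro t
    simp only [hΦ]
    rw [integral_Ioi_eq_integral_exp]
    refine integral_congr_ae (ae_of_all _ fun u => ?_)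
    simp only [hg]
    rw [exp_smul_cpow, mul_assoc, ← Complex.exp_add]
    congr 2
    push_cast
    ring
  have hexpi : ∀ (q : ℝ → ℂ) (hq : Integrable q) (t : ℝ),
      Integrable (fun u : ℝ => q u * cexp (I * t * u)) := by
    intro q hq t
    refine hq.mul_bdd (c := 1) (by fun_prop) (ae_of_all _ fun u => le_of_eq ?_)
    rw [show I * (t : ℂ) * u = ((t * u : ℝ) : ℂ) * I by push_cast; ring, norm_exp_ofReal_mul_I]
  have hkΦ : ∀ t : ℝ, ∫ u : ℝ, k u * cexp (I * (-t : ℝ) * u) =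
      (cexp ((α + t * I) * h) - 1) * Φ t := by
    intro t
    rw [sub_mul, one_mul, hΦg t]
    have e1 : ∫ u : ℝ, g u * cexp (I * (-t : ℝ) * u) =
        ∫ u : ℝ, g (u + h) * cexp (I * (-t : ℝ) * (u + h : ℝ)) :=
      (integral_add_right_eq_self (fun u : ℝ => g u * cexp (I * (-t : ℝ) * u)) h).symm
    conv_rhs => rw [e1]
    conv_rhs => arg 2; rw [← e1]
    rw [← integral_const_mul, ← integral_sub]
    · refine integral_congr_ae (ae_of_all _ fun u => ?_)
      simp only [hk]
      have hexp : cexp (α * h) * cexp (I * (-t : ℝ) * u) =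
          cexp ((α + t * I) * h) * cexp (I * (-t : ℝ) * (u + h : ℝ)) := by
        rw [← Complex.exp_add, ← Complex.exp_add]
        congr 1
        push_cast
        ring
      linear_combination g (u + h) * hexp
    · exact ((hexpi g hgi (-t)).comp_add_right h).const_mul _
    · exact hexpi g hgi (-t)
  have hlint : ∫⁻ u, ‖k u‖ₑ ^ 2 = ∫⁻ x in Ioi (0:ℝ), ‖f (x * Real.exp h) - f x‖ₑ ^ 2 *
        ENNReal.ofReal (x ^ (-2 * α - 1)) := by
    rw [lintegral_Ioi_eq_lintegral_exp]
    refine lintegral_congr fun u => ?_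
    have : k u = (f (Real.exp u * Real.exp h) - f (Real.exp u)) * cexp (-(α:ℂ) * u) := by
      simp only [hk, hg]
      rw [Real.exp_add, sub_mul, mul_left_comm, ← Complex.exp_add]
      congr 3
      push_cast
      ring
    rw [this, enorm_mul, mul_pow, mul_left_comm]
    congr 1
    rw [← ofReal_norm, Complex.norm_exp, ← ENNReal.ofReal_pow (Real.exp_pos _).le,
      ← ENNReal.ofReal_mul (Real.exp_pos _).le]
    congr 1
    rw [← Real.exp_mul, ← Real.exp_add, ← Real.exp_nat_mul]
    congr 1
    simp
    ring
  rw [← hlint]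
  by_cases htop : ∫⁻ u, ‖k u‖ₑ ^ 2 = ⊤
  · rw [htop]; simp
  set B := (∫⁻ u, ‖k u‖ₑ ^ 2).toReal with hB
  have hBeq : ∫⁻ u, ‖k u‖ₑ ^ 2 = ENNReal.ofReal B := (ENNReal.ofReal_toReal htop).symm
  have hP := intervalIntegral_norm_sq_fourier_le hki (B := B) ENNReal.toReal_nonneg hBeq.le hT
  rw [hBeq, show (80 : ENNReal) = ENNReal.ofReal 80 by simp, ← ENNReal.ofReal_mul (by norm_num)]
  refine ENNReal.ofReal_le_ofReal ?_
  have hrefl : ∫ t in (-T)..T, ‖∫ u : ℝ, k u * cexp (I * t * u)‖ ^ 2 =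
      ∫ t in (-T)..T, ‖(cexp ((α + t * I) * h) - 1) * Φ t‖ ^ 2 := by
    simp_rw [← hkΦ]
    have := intervalIntegral.integral_comp_neg (a := -T) (b := T)
      (fun t : ℝ => ‖∫ u : ℝ, k u * cexp (I * t * u)‖ ^ 2)
    rw [neg_neg] at this
    exact this.symm
  rw [hrefl] at hP
  have hcont : Continuous Φ := by
    have : Φ = fun t : ℝ => ∫ u : ℝ, g u * cexp (I * (-t : ℝ) * u) := funext hΦg
    rw [this]
    refine continuous_of_dominated (bound := fun u => ‖g u‖) ?_ ?_ hgi.norm ?_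
    · intro t
      exact hgi.aestronglyMeasurable.mul (by fun_prop)
    · intro t
      refine ae_of_all _ fun u => le_of_eq ?_
      rw [norm_mul, show I * ((-t : ℝ) : ℂ) * u = ((-t * u : ℝ) : ℂ) * I by push_cast; ring,
        norm_exp_ofReal_mul_I, mul_one]
    · exact ae_of_all _ fun u => by fun_prop
  have hmono : ∫ t in (-T)..T, (h ^ 2 / 4) * ‖(α + t * I) * Φ t‖ ^ 2 ≤
      ∫ t in (-T)..T, ‖(cexp ((α + t * I) * h) - 1) * Φ t‖ ^ 2 := by
    refine intervalIntegral.integral_mono_on (by linarith) ?_ ?_ ?_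
    · exact Continuous.intervalIntegrable (by fun_prop) _ _
    · exact Continuous.intervalIntegrable (by fun_prop) _ _
    · intro t ht
      rw [norm_mul, norm_mul, mul_pow, mul_pow, ← mul_assoc]
      refine mul_le_mul_of_nonneg_right ?_ (by positivity)
      have hs : ‖(α + t * I : ℂ)‖ ≤ T + α := by
        refine (norm_add_le _ _).trans ?_
        rw [norm_mul, Complex.norm_I, mul_one, Complex.norm_real, Complex.norm_real,
          Real.norm_of_nonneg hα.le, Real.norm_eq_abs]
        have := abs_le.2 ht
        linarith
      have hz : ‖(α + t * I : ℂ) * h‖ = ‖(α + t * I : ℂ)‖ * h := by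
        rw [norm_mul, Complex.norm_real, Real.norm_of_nonneg hh.le]
      have := norm_exp_sub_one_ge (z := (α + t * I : ℂ) * h)
        (by rw [hz]; exact (mul_le_mul_of_nonneg_right hs hh.le).trans hTh)
      rw [hz] at this
      calc h ^ 2 / 4 * ‖(α + t * I : ℂ)‖ ^ 2 = (‖(α + t * I : ℂ)‖ * h / 2) ^ 2 := by ring
        _ ≤ _ := by gcongr
  rw [intervalIntegral.integral_const_mul] at hmono
  linarith

end MellinWindow

section CharSeries
open MeasureTheory Set Filter Topology Asymptotics

/-- A Dirichlet series with completely multiplicative coefficients bounded by `1` whose summatory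
function differs from `ρ x` by at most `1` on every interval. -/
structure CharSeries (a : ℕ → ℂ) (F : ℂ → ℂ) (ρ : ℂ) : Prop where
  map_one : a 1 = 1
  map_mul : ∀ m n, a (m * n) = a m * a n
  norm_le : ∀ n, ‖a n‖ ≤ 1
  norm_density_le : ‖ρ‖ ≤ 1
  remainder_le : ∀ (N : ℕ) (x : ℝ), N ≤ x →
    ‖∑ n ∈ Finset.Ioc N ⌊x⌋₊, a n - ρ * (x - N)‖ ≤ 1
  differentiableAt : ∀ s ≠ 1, DifferentiableAt ℂ F s
  eq_LSeries : ∀ s : ℂ, 1 < s.re → F s = LSeries a s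

/-- The remainder in the summatory function of `a` beyond `N`. -/
noncomputable def sumRemainder (a : ℕ → ℂ) (ρ : ℂ) (N : ℕ) (x : ℝ) : ℂ :=
  ∑ n ∈ Finset.Ioc N ⌊x⌋₊, a n - ρ * (x - N)

lemma measurable_comp_floor (g : ℕ → ℂ) : Measurable (fun x : ℝ => g ⌊x⌋₊) :=
  (measurable_from_nat (f := g)).comp Nat.measurable_floor

lemma measurable_sumRemainder (a : ℕ → ℂ) (ρ : ℂ) (N : ℕ) : Measurable (sumRemainder a ρ N) := by
  refine (measurable_comp_floor fun k => ∑ n ∈ Finset.Ioc N k, a n).sub ?_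
  fun_prop

lemma norm_mul_cpow_le {c : ℂ} (hc : ‖c‖ ≤ 1) {x : ℝ} (hx : 0 < x) (s : ℂ) :
    ‖c * (x:ℂ) ^ (-s - 1)‖ ≤ x ^ (-s.re - 1) := by
  rw [norm_mul, norm_cpow_eq_rpow_re_of_pos hx]
  simpa using mul_le_mul_of_nonneg_right hc (Real.rpow_nonneg hx.le _)

lemma integrableOn_mul_cpow {f : ℝ → ℂ} (hf : Measurable f) {N : ℝ} (hN : 0 < N)
    (hb : ∀ x, N < x → ‖f x‖ ≤ 1) {s : ℂ} (hs : 0 < s.re) :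
    IntegrableOn (fun x : ℝ => f x * (x:ℂ) ^ (-s - 1)) (Ioi N) := by
  have h := integrableOn_Ioi_rpow_of_lt (a := -s.re - 1) (by linarith) hN
  refine h.mono' ?_ ?_
  · exact (by fun_prop : Measurable fun x : ℝ => f x * (x:ℂ) ^ (-s - 1)).aestronglyMeasurable
  · refine (ae_restrict_iff' measurableSet_Ioi).2 (ae_of_all _ fun x hx => ?_)
    exact norm_mul_cpow_le (hb x hx) (hN.trans hx) s

lemma norm_integral_mul_cpow_le {f : ℝ → ℂ} {N : ℝ} (hN : 0 < N)
    (hb : ∀ x, N < x → ‖f x‖ ≤ 1) {s : ℂ} (hs : 0 < s.re) :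
    ‖∫ x in Ioi N, f x * (x:ℂ) ^ (-s - 1)‖ ≤ N ^ (-s.re) / s.re := by
  have h := integrableOn_Ioi_rpow_of_lt (a := -s.re - 1) (by linarith) hN
  refine (norm_integral_le_of_norm_le h ?_).trans (le_of_eq ?_)
  · refine (ae_restrict_iff' measurableSet_Ioi).2 (ae_of_all _ fun x hx => ?_)
    exact norm_mul_cpow_le (hb x hx) (hN.trans hx) s
  · rw [integral_Ioi_rpow_of_lt (by linarith) hN]
    rw [show -s.re - 1 + 1 = -s.re by ring, neg_div_neg_eq]

lemma differentiableAt_integral_mul_cpow {f : ℝ → ℂ} (hf : Measurable f) {N : ℝ} (hN : 0 < N)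
    (hb : ∀ x, N < x → ‖f x‖ ≤ 1) {s : ℂ} (hs : 0 < s.re) :
    DifferentiableAt ℂ (fun s : ℂ => ∫ x in Ioi N, f x * (x:ℂ) ^ (-s - 1)) s := by
  set g : ℝ → ℂ := (Ioi N).indicator f with hg
  have hgm : Measurable g := hf.indicator measurableSet_Ioi
  have hgb : ∀ x, ‖g x‖ ≤ 1 := by
    intro x
    by_cases hx : x ∈ Ioi N
    · rw [hg, indicator_of_mem hx]; exact hb x hx
    · rw [hg, indicator_of_notMem hx]; simp
  have h := mellin_differentiableAt_of_isBigO_rpow (f := g) (s := -s) (a := 0)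
    (b := -s.re - 1) ?_ ?_ (by simpa using hs) ?_ (by simp)
  · have h2 : (fun s : ℂ => ∫ x in Ioi N, f x * (x:ℂ) ^ (-s - 1)) = fun s => mellin g (-s) := by
      funext w
      rw [mellin]
      have : ∀ x : ℝ, (x:ℂ) ^ (-w - 1) • g x =
          (Ioi N).indicator (fun x => f x * (x:ℂ) ^ (-w - 1)) x := by
        intro x
        by_cases hx : x ∈ Ioi N
        · rw [hg, indicator_of_mem hx, indicator_of_mem hx, smul_eq_mul, mul_comm]
        · rw [hg, indicator_of_notMem hx, indicator_of_notMem hx, smul_zero]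
      simp_rw [this]
      rw [setIntegral_indicator measurableSet_Ioi, inter_eq_right.2 (Ioi_subset_Ioi hN.le)]
    rw [h2]
    exact h.comp s differentiableAt_id.neg
  · refine LocallyIntegrable.locallyIntegrableOn ?_ _
    exact (locallyIntegrable_const (1:ℝ)).mono hgm.aestronglyMeasurable
      (ae_of_all _ fun x => by simpa using hgb x)
  · refine IsBigO.of_bound 1 (Eventually.of_forall fun x => ?_)
    simpa using hgb x
  · refine IsBigO.of_bound 1 ?_
    filter_upwards [nhdsWithin_le_nhds (Iio_mem_nhds hN)] with x hx
    rw [hg, indicator_of_notMem (by simpa using (le_of_lt hx))]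
    simp

lemma CharSeries.norm_sumRemainder_le {a F ρ} (h : CharSeries a F ρ) {N : ℕ} {x : ℝ}
    (hx : N ≤ x) : ‖sumRemainder a ρ N x‖ ≤ 1 := h.remainder_le N x hx

lemma CharSeries.lseriesSummable {a F ρ} (h : CharSeries a F ρ) {s : ℂ} (hs : 1 < s.re) :
    LSeriesSummable a s :=
  LSeriesSummable_of_bounded_of_one_lt_re (m := 1) (fun n _ => h.norm_le n) hs

lemma CharSeries.eq_of_one_lt_re {a F ρ} (h : CharSeries a F ρ) {N : ℕ} (hN : 1 ≤ N) {s : ℂ}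
    (hs : 1 < s.re) :
    F s = ∑ n ∈ Finset.Icc 1 N, a n * (n:ℂ) ^ (-s) + ρ * ((N:ℂ) ^ (1 - s) / (s - 1)) +
      s * ∫ x in Ioi (N:ℝ), sumRemainder a ρ N x * (x:ℂ) ^ (-s - 1) := by
  have hN0 : (0:ℝ) < N := by exact_mod_cast hN
  have hs0 : 0 < s.re := by linarith
  have hsne : s ≠ 0 := by rintro rfl; simp at hs0
  have hsne1 : s - 1 ≠ 0 := by
    intro h0; rw [sub_eq_zero.1 h0] at hs; simp at hs
  set b : ℕ → ℂ := fun n => if N < n then a n else 0 with hb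
  have hbS : LSeriesSummable b s := by
    refine LSeriesSummable_of_bounded_of_one_lt_re (m := 1) (fun n _ => ?_) hs
    simp only [hb]
    split_ifs
    · exact h.norm_le n
    · simp
  have hsplit : LSeries a s = ∑ n ∈ Finset.Icc 1 N, a n * (n:ℂ) ^ (-s) + LSeries b s := by
    have h1 : LSeries a s - LSeries b s = LSeries (a - b) s := (LSeries_sub (h.lseriesSummable hs) hbS).symm
    have h2 : LSeries (a - b) s = ∑ n ∈ Finset.Icc 1 N, a n * (n:ℂ) ^ (-s) := by
      rw [LSeries, tsum_eq_sum (s := Finset.Icc 1 N)]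
      · refine Finset.sum_congr rfl fun n hn => ?_
        have hn' := Finset.mem_Icc.1 hn
        rw [LSeries.term_of_ne_zero (by omega)]
        simp only [hb, Pi.sub_apply, if_neg (not_lt.2 hn'.2), sub_zero]
        rw [cpow_neg, div_eq_mul_inv]
      · intro n hn
        rcases Nat.eq_zero_or_pos n with rfl | hpos
        · simp
        · have : N < n := by
            by_contra hc
            exact hn (Finset.mem_Icc.2 ⟨hpos, not_lt.1 hc⟩)
          rw [LSeries.term_of_ne_zero (by omega)]
          simp [hb, this]
    rw [← h2, ← h1]; ring
  have hbsum : ∀ k : ℕ, ∑ n ∈ Finset.Icc 1 k, b n = ∑ n ∈ Finset.Ioc N k, a n := by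
    intro k
    simp only [hb]
    rw [← Finset.sum_filter]
    refine Finset.sum_congr ?_ fun _ _ => rfl
    ext n
    simp only [Finset.mem_filter, Finset.mem_Icc, Finset.mem_Ioc]
    omega
  have hO : (fun n : ℕ ↦ ∑ k ∈ Finset.Icc 1 n, b k) =O[atTop] fun n : ℕ ↦ (n : ℝ) ^ (1:ℝ) := by
    refine IsBigO.of_bound 1 (Eventually.of_forall fun n => ?_)
    rw [Real.rpow_one, one_mul]
    refine (norm_sum_le _ _).trans ?_
    refine (Finset.sum_le_card_nsmul _ _ 1 fun k _ => ?_).trans ?_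
    · simp only [hb]
      split_ifs
      · exact h.norm_le k
      · simp
    · simp
  have hL := LSeries_eq_mul_integral b zero_le_one hs hbS hO
  have hInt : ∫ t in Ioi (1 : ℝ), (∑ k ∈ Finset.Icc 1 ⌊t⌋₊, b k) * (t:ℂ) ^ (-(s + 1)) =
      ∫ t in Ioi (N : ℝ), (∑ k ∈ Finset.Ioc N ⌊t⌋₊, a k) * (t:ℂ) ^ (-s - 1) := by
    have hsub : Ioi (N:ℝ) ⊆ Ioi 1 := Ioi_subset_Ioi (by exact_mod_cast hN)
    simp_rw [hbsum, neg_add']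
    rw [← setIntegral_eq_of_subset_of_forall_sdiff_eq_zero measurableSet_Ioi hsub]
    · intro t ht
      have : ⌊t⌋₊ ≤ N := by
        have : t ≤ N := not_lt.1 ht.2
        exact Nat.floor_le_of_le this
      rw [Finset.Ioc_eq_empty (by omega)]
      simp
  have hdecomp : ∀ t ∈ Ioi (N:ℝ), (∑ k ∈ Finset.Ioc N ⌊t⌋₊, a k) * (t:ℂ) ^ (-s - 1) =
      sumRemainder a ρ N t * (t:ℂ) ^ (-s - 1) +
        (ρ * (t:ℂ) ^ (-s) - ρ * N * (t:ℂ) ^ (-s - 1)) := by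
    intro t ht
    have ht0 : (t:ℂ) ≠ 0 := by exact_mod_cast (hN0.trans ht).ne'
    have : (t:ℂ) ^ (-s) = t * (t:ℂ) ^ (-s - 1) := by
      rw [cpow_sub _ _ ht0, cpow_one]; field_simp
    rw [this, sumRemainder]
    ring
  have i1 := integrableOn_mul_cpow (measurable_sumRemainder a ρ N) hN0
    (fun x hx => h.norm_sumRemainder_le (le_of_lt hx)) hs0
  have i2 : IntegrableOn (fun t : ℝ => (t:ℂ) ^ (-s)) (Ioi (N:ℝ)) :=
    integrableOn_Ioi_cpow_of_lt (by simpa using hs) hN0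
  have i3 : IntegrableOn (fun t : ℝ => (t:ℂ) ^ (-s - 1)) (Ioi (N:ℝ)) :=
    integrableOn_Ioi_cpow_of_lt (by simp; linarith) hN0
  have i4 : IntegrableOn (fun t : ℝ => ρ * (t:ℂ) ^ (-s) - ρ * N * (t:ℂ) ^ (-s - 1))
      (Ioi (N:ℝ)) := (i2.const_mul ρ).sub (i3.const_mul _)
  rw [h.eq_LSeries s hs, hsplit, hL, hInt, setIntegral_congr_fun measurableSet_Ioi hdecomp,
    integral_add i1 i4,
    integral_sub (i2.const_mul ρ) (i3.const_mul _), integral_const_mul, integral_const_mul,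
    integral_Ioi_cpow_of_lt (by simpa using hs) hN0,
    integral_Ioi_cpow_of_lt (by simp; linarith) hN0]
  have hNne : ((N:ℝ):ℂ) ≠ 0 := by exact_mod_cast hN0.ne'
  have e1 : ((N:ℝ):ℂ) ^ (-s + 1) = (N:ℂ) ^ (1 - s) := by
    rw [neg_add_eq_sub]; simp
  have e2 : (N:ℂ) * ((N:ℝ):ℂ) ^ (-s - 1 + 1) = (N:ℂ) ^ (1 - s) := by
    rw [← e1, show -s - 1 + 1 = -s by ring, cpow_add _ _ hNne, cpow_one, mul_comm]; simp
  have hs1 : -s + 1 ≠ 0 := by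
    intro h0; apply hsne1; linear_combination -h0
  have key : s * (ρ * (-((N:ℝ):ℂ) ^ (-s + 1) / (-s + 1)) -
      ρ * N * (-((N:ℝ):ℂ) ^ (-s - 1 + 1) / (-s - 1 + 1))) = ρ * ((N:ℂ) ^ (1 - s) / (s - 1)) := by
    have : ρ * (N:ℂ) * (-((N:ℝ):ℂ) ^ (-s - 1 + 1) / (-s - 1 + 1)) =
        ρ * ((N:ℂ) ^ (1 - s) / s) := by
      rw [← e2]
      rw [show -s - 1 + 1 = -s by ring]
      field_simp
    rw [this, e1, show -s + 1 = -(s - 1) by ring]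
    field_simp
    ring
  rw [mul_add, key]
  ring

theorem CharSeries.eq_sum_add {a F ρ} (h : CharSeries a F ρ) {N : ℕ} (hN : 1 ≤ N) {s : ℂ}
    (hs : 0 < s.re) (him : 0 < s.im) :
    F s = ∑ n ∈ Finset.Icc 1 N, a n * (n:ℂ) ^ (-s) + ρ * ((N:ℂ) ^ (1 - s) / (s - 1)) +
      s * ∫ x in Ioi (N:ℝ), sumRemainder a ρ N x * (x:ℂ) ^ (-s - 1) := by
  have hN0 : (0:ℝ) < N := by exact_mod_cast hN
  set U : Set ℂ := {s | 0 < s.re} ∩ {s | 0 < s.im} with hU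
  have hUo : IsOpen U := (isOpen_lt continuous_const continuous_re).inter
    (isOpen_lt continuous_const continuous_im)
  have hUc : IsPreconnected U :=
    ((convex_halfSpace_re_gt 0).inter (convex_halfSpace_im_gt 0)).isPreconnected
  have hne1 : ∀ z ∈ U, z ≠ 1 := by
    rintro z hz rfl
    simpa using hz.2
  have hF : AnalyticOnNhd ℂ F U := DifferentiableOn.analyticOnNhd
    (fun z hz => (h.differentiableAt z (hne1 z hz)).differentiableWithinAt) hUo
  have hG : AnalyticOnNhd ℂ (fun s => ∑ n ∈ Finset.Icc 1 N, a n * (n:ℂ) ^ (-s) +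
      ρ * ((N:ℂ) ^ (1 - s) / (s - 1)) +
      s * ∫ x in Ioi (N:ℝ), sumRemainder a ρ N x * (x:ℂ) ^ (-s - 1)) U := by
    refine DifferentiableOn.analyticOnNhd (fun z hz => ?_) hUo
    refine DifferentiableAt.differentiableWithinAt ?_
    have hNne : (N:ℂ) ≠ 0 := by exact_mod_cast hN0.ne'
    have d1 : DifferentiableAt ℂ (fun s : ℂ => ∑ n ∈ Finset.Icc 1 N, a n * (n:ℂ) ^ (-s)) z := by
      refine DifferentiableAt.fun_sum fun n hn => ?_
      have hn0 : (n:ℂ) ≠ 0 := by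
        have := (Finset.mem_Icc.1 hn).1
        exact_mod_cast (by omega : n ≠ 0)
      exact (differentiableAt_id.neg.const_cpow (Or.inl hn0)).const_mul _
    have d2 : DifferentiableAt ℂ (fun s : ℂ => ρ * ((N:ℂ) ^ (1 - s) / (s - 1))) z := by
      refine DifferentiableAt.const_mul (DifferentiableAt.div ?_ ?_ ?_) _
      · exact (differentiableAt_id.const_sub 1).const_cpow (Or.inl hNne)
      · exact differentiableAt_id.sub_const 1
      · exact sub_ne_zero.2 (hne1 z hz)
    have d3 := differentiableAt_integral_mul_cpow (measurable_sumRemainder a ρ N) hN0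
      (fun x hx => h.norm_sumRemainder_le (le_of_lt hx)) hz.1
    exact (d1.add d2).add (differentiableAt_id.mul d3)
  have h0 : (2 + I : ℂ) ∈ U := by simp [hU]
  refine hF.eqOn_of_preconnected_of_eventuallyEq hG hUc h0 ?_ ⟨hs, him⟩
  have : {s : ℂ | 1 < s.re} ∈ 𝓝 (2 + I : ℂ) :=
    (isOpen_lt continuous_const continuous_re).mem_nhds (by simp)
  filter_upwards [this] with z hz
  exact h.eq_of_one_lt_re hN hz

end CharSeries

section PointwiseBounds
open MeasureTheory Set Filter Topology

lemma norm_natCast_cpow_neg (n : ℕ) (hn : 1 ≤ n) (s : ℂ) : ‖(n:ℂ) ^ (-s)‖ = (n:ℝ) ^ (-s.re) := by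
  rw [norm_natCast_cpow_of_pos (by omega)]
  simp

/-- Convexity-type bound with an `ε`-loss. -/
theorem CharSeries.norm_le_rpow {a F ρ} (h : CharSeries a F ρ) {α κ : ℝ} (hα : 0 < α)
    (hα1 : α ≤ 1) (hκ : 0 < κ) :
    ∃ C : ℝ, 0 ≤ C ∧ ∀ s : ℂ, α ≤ s.re → s.re ≤ 2 → 1 ≤ s.im →
      ‖F s‖ ≤ C * s.im ^ (1 - α + κ) := by
  set Z : ℝ := ∑' n : ℕ, (n:ℝ) ^ (-1 - κ) with hZ
  have hsum : Summable (fun n : ℕ => (n:ℝ) ^ (-1 - κ)) := Real.summable_nat_rpow.2 (by linarith)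
  have hZ0 : 0 ≤ Z := tsum_nonneg fun n => by positivity
  refine ⟨(Z + 1 + 3 / α) * 2 ^ (1 - α + κ), by positivity, fun s h1 h2 h3 => ?_⟩
  set t := s.im with ht
  set N := ⌈t⌉₊ with hN
  have hNt : t ≤ N := Nat.le_ceil t
  have hN1 : 1 ≤ N := Nat.one_le_iff_ne_zero.2 (by
    rw [hN]; exact (Nat.ceil_pos.2 (by linarith)).ne')
  have hN1' : (1:ℝ) ≤ N := by exact_mod_cast hN1
  have hN0 : (0:ℝ) < N := by linarith
  have hN2 : (N:ℝ) ≤ 2 * t := by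
    have := Nat.ceil_lt_add_one (a := t) (by linarith)
    linarith
  rw [h.eq_sum_add hN1 (by linarith) (by linarith : 0 < s.im)]
  have hmain : (N:ℝ) ^ (1 - α) ≤ (N:ℝ) ^ (1 - α + κ) :=
    Real.rpow_le_rpow_of_exponent_le hN1' (by linarith)
  have b1 : ‖∑ n ∈ Finset.Icc 1 N, a n * (n:ℂ) ^ (-s)‖ ≤ Z * (N:ℝ) ^ (1 - α + κ) := by
    refine (norm_sum_le _ _).trans ?_
    have : ∀ n ∈ Finset.Icc 1 N, ‖a n * (n:ℂ) ^ (-s)‖ ≤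
        (n:ℝ) ^ (-1 - κ) * (N:ℝ) ^ (1 - α + κ) := by
      intro n hn
      have hn' := Finset.mem_Icc.1 hn
      have hn1 : (1:ℝ) ≤ n := by exact_mod_cast hn'.1
      rw [norm_mul, norm_natCast_cpow_neg n hn'.1]
      calc ‖a n‖ * (n:ℝ) ^ (-s.re) ≤ 1 * (n:ℝ) ^ (-α) := by
            gcongr
            · exact h.norm_le n
        _ = (n:ℝ) ^ (-1 - κ) * (n:ℝ) ^ (1 - α + κ) := by
            rw [← Real.rpow_add (by linarith), one_mul]; congr 1; ring
        _ ≤ _ := by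
            gcongr
            · linarith
    refine (Finset.sum_le_sum this).trans ?_
    rw [← Finset.sum_mul]
    gcongr
    exact hsum.sum_le_tsum _ (fun n _ => by positivity)
  have b2 : ‖ρ * ((N:ℂ) ^ (1 - s) / (s - 1))‖ ≤ (N:ℝ) ^ (1 - α + κ) := by
    rw [norm_mul, norm_div, norm_natCast_cpow_of_pos (by omega)]
    have h4 : 1 ≤ ‖s - 1‖ := by
      have := abs_im_le_norm (s - 1)
      rw [sub_im, one_im, sub_zero] at this
      exact (h3.trans (le_abs_self _)).trans this
    have h5 : (N:ℝ) ^ (1 - s).re ≤ (N:ℝ) ^ (1 - α) :=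
      Real.rpow_le_rpow_of_exponent_le hN1' (by simp; linarith)
    calc ‖ρ‖ * ((N:ℝ) ^ (1 - s).re / ‖s - 1‖) ≤ 1 * ((N:ℝ) ^ (1 - s).re / 1) := by
          gcongr
          exact h.norm_density_le
      _ ≤ _ := by rw [one_mul, div_one]; exact h5.trans hmain
  have b3 : ‖s * ∫ x in Ioi (N:ℝ), sumRemainder a ρ N x * (x:ℂ) ^ (-s - 1)‖ ≤
      3 / α * (N:ℝ) ^ (1 - α + κ) := by
    rw [norm_mul]
    have h4 := norm_integral_mul_cpow_le (f := sumRemainder a ρ N) hN0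
      (fun x hx => h.norm_sumRemainder_le (le_of_lt hx)) (s := s) (by linarith)
    have h5 : ‖s‖ ≤ 3 * N := by
      have := norm_le_abs_re_add_abs_im s
      rw [abs_of_nonneg (by linarith : 0 ≤ s.re), abs_of_nonneg (by linarith : 0 ≤ s.im)] at this
      linarith
    calc _ ≤ (3 * N) * ((N:ℝ) ^ (-s.re) / s.re) := by gcongr
      _ ≤ (3 * N) * ((N:ℝ) ^ (-α) / α) := by gcongr
      _ = 3 / α * (N:ℝ) ^ (1 - α) := by
          rw [sub_eq_add_neg, Real.rpow_add hN0, Real.rpow_one]; ring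
      _ ≤ _ := by gcongr
  calc _ ≤ Z * (N:ℝ) ^ (1 - α + κ) + (N:ℝ) ^ (1 - α + κ) + 3 / α * (N:ℝ) ^ (1 - α + κ) :=
        (norm_add₃_le).trans (by gcongr)
    _ = (Z + 1 + 3 / α) * (N:ℝ) ^ (1 - α + κ) := by ring
    _ ≤ (Z + 1 + 3 / α) * (2 * t) ^ (1 - α + κ) := by
        gcongr
    _ = _ := by rw [Real.mul_rpow (by norm_num) (by linarith)]; ring

theorem CharSeries.norm_sub_le {a F ρ} (h : CharSeries a F ρ) {α κ : ℝ} (hα : 0 < α)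
    (hα1 : α ≤ 1) (hκ : 0 < κ) :
    ∃ C : ℝ, 0 ≤ C ∧ ∀ (t : ℝ) (z w : ℂ), α ≤ z.re → z.re ≤ 3 / 2 → 2 ≤ z.im → z.im ≤ t →
      α ≤ w.re → w.re ≤ 3 / 2 → 2 ≤ w.im → w.im ≤ t →
      ‖F w - F z‖ ≤ C * t ^ (1 - α + κ) * ‖w - z‖ := by
  set δ := min (κ / 2) (min (α / 2) (1 / 4)) with hδ
  have hδ0 : 0 < δ := by simp only [hδ, lt_min_iff]; refine ⟨by linarith, by linarith, by norm_num⟩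
  have hδ1 : δ ≤ κ / 2 := min_le_left _ _
  have hδ2 : δ ≤ α / 2 := (min_le_right _ _).trans (min_le_left _ _)
  have hδ3 : δ ≤ 1 / 4 := (min_le_right _ _).trans (min_le_right _ _)
  obtain ⟨C, hC0, hC⟩ := h.norm_le_rpow (α := α - δ) (κ := κ - δ) (by linarith) (by linarith)
    (by linarith)
  have hexp : 1 - (α - δ) + (κ - δ) = 1 - α + κ := by ring
  rw [hexp] at hC
  refine ⟨C * 2 ^ (1 - α + κ) / δ, by positivity, fun t z w hz1 hz2 hz3 hz4 hw1 hw2 hw3 hw4 => ?_⟩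
  set S : Set ℂ := ({s | α ≤ s.re} ∩ {s | s.re ≤ 3 / 2}) ∩ ({s | 2 ≤ s.im} ∩ {s | s.im ≤ t})
  have hS : Convex ℝ S := ((convex_halfSpace_re_ge _).inter (convex_halfSpace_re_le _)).inter
    ((convex_halfSpace_im_ge _).inter (convex_halfSpace_im_le _))
  have hne1 : ∀ z : ℂ, 0 < z.im → z ≠ 1 := by
    rintro z hz rfl
    simp at hz
  refine hS.norm_image_sub_le_of_norm_deriv_le (f := F) (fun x hx => ?_) (fun x hx => ?_)
    ⟨⟨hz1, hz2⟩, hz3, hz4⟩ ⟨⟨hw1, hw2⟩, hw3, hw4⟩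
  · exact h.differentiableAt x (hne1 x (by have : 2 ≤ x.im := hx.2.1; linarith))
  · have hx1 : α ≤ x.re := hx.1.1
    have hx2 : x.re ≤ 3 / 2 := hx.1.2
    have hx3 : 2 ≤ x.im := hx.2.1
    have hx4 : x.im ≤ t := hx.2.2
    have hball : ∀ y ∈ Metric.closedBall x δ, |y.re - x.re| ≤ δ ∧ |y.im - x.im| ≤ δ := by
      intro y hy
      rw [Metric.mem_closedBall, dist_eq_norm] at hy
      exact ⟨by simpa using (abs_re_le_norm (y - x)).trans hy,
        by simpa using (abs_im_le_norm (y - x)).trans hy⟩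
    have hd : DiffContOnCl ℂ F (Metric.ball x δ) := by
      refine DifferentiableOn.diffContOnCl_ball (c := x) (R := δ) (U := Metric.closedBall x δ)
        (fun y hy => ?_) subset_rfl
      have := (abs_le.1 (hball y hy).2).1
      exact (h.differentiableAt y (hne1 y (by linarith))).differentiableWithinAt
    have := Complex.norm_deriv_le_of_forall_mem_sphere_norm_le (c := x) (R := δ) (f := F)
      (C := C * (2 * t) ^ (1 - α + κ)) hδ0 hd (fun y hy => ?_)
    · refine this.trans (le_of_eq ?_)
      rw [Real.mul_rpow (by norm_num) (by linarith)]
      ring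
    · obtain ⟨h1, h2⟩ := hball y (Metric.sphere_subset_closedBall hy)
      rw [abs_le] at h1 h2
      refine (hC y (by linarith) (by linarith) (by linarith)).trans ?_
      gcongr
      · linarith
      · linarith

theorem CharSeries.norm_one_line_sub_sum_le {a F ρ} (h : CharSeries a F ρ) {N : ℕ} (hN : 1 ≤ N)
    {t : ℝ} (ht : 1 ≤ t) :
    ‖F (1 + t * I) - ∑ n ∈ Finset.Icc 1 N, a n * (n:ℂ) ^ (-(1 + t * I : ℂ))‖ ≤
      1 / t + (1 + t) / N := by
  have hN0 : (0:ℝ) < N := by exact_mod_cast hN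
  rw [h.eq_sum_add hN (by simp) (by simp; linarith), add_assoc, add_sub_cancel_left]
  refine (norm_add_le _ _).trans (add_le_add ?_ ?_)
  · rw [norm_mul, norm_div, norm_natCast_cpow_of_pos (by omega)]
    simp only [sub_re, one_re, add_re, mul_re, ofReal_re, I_re, mul_zero, ofReal_im, I_im, mul_one,
      sub_self, add_zero, Real.rpow_zero, add_sub_cancel_left, norm_mul, norm_real, norm_I]
    rw [Real.norm_of_nonneg (by linarith)]
    calc ‖ρ‖ * (1 / t) ≤ 1 * (1 / t) := by
          gcongr
          exact h.norm_density_le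
      _ = _ := one_mul _
  · rw [norm_mul]
    have h4 := norm_integral_mul_cpow_le (f := sumRemainder a ρ N) hN0
      (fun x hx => h.norm_sumRemainder_le (le_of_lt hx)) (s := 1 + t * I) (by simp)
    have h5 : ‖(1 + t * I : ℂ)‖ ≤ 1 + t := by
      refine (norm_add_le _ _).trans ?_
      rw [norm_mul, norm_I, norm_real, norm_one, Real.norm_of_nonneg (by linarith), mul_one]
    have h6 : (N:ℝ) ^ (-(1 + t * I : ℂ).re) / (1 + t * I : ℂ).re = 1 / N := by
      simp [Real.rpow_neg_one]
    rw [h6] at h4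
    calc _ ≤ (1 + t) * (1 / N) := by gcongr
      _ = _ := by ring

/-- Lower bound on the line `Re s = 1` from an inequality of 3-4-1 type. -/
theorem CharSeries.one_le_norm_one_line {a F ρ} (h : CharSeries a F ρ)
    (h341 : ∀ κ : ℝ, 0 < κ → ∃ C : ℝ, 0 ≤ C ∧ ∀ x : ℝ, 0 < x → x ≤ 1 / 2 → ∀ t : ℝ, 2 ≤ t →
      x ^ 3 ≤ C * ‖F (1 + x + t * I)‖ ^ 4 * t ^ κ) {κ : ℝ} (hκ : 0 < κ) :
    ∃ C : ℝ, 0 < C ∧ ∀ t : ℝ, 2 ≤ t → 1 ≤ C * t ^ κ * ‖F (1 + t * I)‖ := by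
  set δ := κ / 4 with hδ
  have hδ0 : 0 < δ := by positivity
  obtain ⟨A, hA0, hA⟩ := h341 δ hδ0
  obtain ⟨B', hB0', hB'⟩ := h.norm_sub_le (α := 1) (κ := δ) one_pos le_rfl hδ0
  set B := B' + 1 with hB
  have hB0 : 1 ≤ B := by linarith
  set c : ℝ := 1 / (2 + 32 * A * B ^ 4) with hc
  have hc0 : 0 < c := by positivity
  refine ⟨1 / (B * c), by positivity, fun t ht => ?_⟩
  have ht0 : 0 < t := by linarith
  set u := t ^ δ with hu
  have hu1 : 1 ≤ u := Real.one_le_rpow (by linarith) hδ0.le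
  have hu4 : t ^ κ = u ^ 4 := by
    rw [hu, ← Real.rpow_natCast, ← Real.rpow_mul ht0.le]; congr 1; rw [hδ]; push_cast; ring
  set x := c / u ^ 5 with hx
  have hx0 : 0 < x := by positivity
  have hx1 : x ≤ 1 / 2 := by
    calc x ≤ c := div_le_self hc0.le (one_le_pow₀ hu1)
      _ ≤ 1 / 2 := by
        rw [hc]; gcongr; nlinarith [mul_nonneg hA0 (pow_nonneg (by linarith : 0 ≤ B) 4)]
  have key : 2 * B * u * x ≤ ‖F (1 + x + t * I)‖ := by
    by_contra hlt
    push Not at hlt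
    have h1 := hA x hx0 hx1 t ht
    have h2 : ‖F (1 + x + t * I)‖ ^ 4 ≤ (2 * B * u * x) ^ 4 := by gcongr
    have h3 : x ^ 3 ≤ A * (2 * B * u * x) ^ 4 * u := h1.trans (by gcongr)
    have h4 : 1 ≤ 16 * A * B ^ 4 * (u ^ 5 * x) := by
      have : x ^ 3 * 1 ≤ x ^ 3 * (16 * A * B ^ 4 * (u ^ 5 * x)) := by
        calc x ^ 3 * 1 ≤ A * (2 * B * u * x) ^ 4 * u := by linarith
          _ = _ := by ring
      exact le_of_mul_le_mul_left this (by positivity)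
    have h5 : u ^ 5 * x = c := by rw [hx]; field_simp
    rw [h5, hc, mul_one_div, le_div_iff₀ (by positivity)] at h4
    nlinarith [mul_nonneg hA0 (pow_nonneg (by linarith : 0 ≤ B) 4)]
  have hlip := hB' t (1 + t * I) (1 + x + t * I) (by simp) (by simp; norm_num) (by simpa using ht)
    (by simp) (by simp; linarith) (by simp; linarith) (by simpa using ht) (by simp)
  have e1 : (1 + x + t * I - (1 + t * I) : ℂ) = x := by ring
  rw [e1, norm_real, Real.norm_of_nonneg hx0.le, sub_self, zero_add] at hlip
  have h7 : ‖F (1 + x + t * I)‖ - ‖F (1 + t * I)‖ ≤ B * u * x := by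
    refine ((norm_sub_norm_le _ _).trans hlip).trans ?_
    gcongr
    linarith
  have h8 : B * u * x ≤ ‖F (1 + t * I)‖ := by linarith
  rw [hu4]
  calc (1:ℝ) = 1 / (B * c) * u ^ 4 * (B * u * x) := by rw [hx]; field_simp
    _ ≤ _ := by gcongr

end PointwiseBounds

section Instances
open MeasureTheory Set Filter Topology

theorem charSeries_riemannZeta : CharSeries (fun _ => 1) riemannZeta 1 where
  map_one := rfl
  map_mul := by simp
  norm_le := by simp
  norm_density_le := by simp
  remainder_le := by
    intro N x hx
    have hx0 : 0 ≤ x := (Nat.cast_nonneg N).trans hx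
    have hN : N ≤ ⌊x⌋₊ := Nat.le_floor hx
    have h1 := Nat.floor_le hx0
    have h2 := Nat.lt_floor_add_one x
    have h3 : ∑ n ∈ Finset.Ioc N ⌊x⌋₊, (1:ℂ) - 1 * (x - N) = (((⌊x⌋₊ : ℝ) - x : ℝ) : ℂ) := by
      simp [Nat.cast_sub hN]
    rw [h3, Complex.norm_real, Real.norm_eq_abs, abs_le]
    constructor <;> linarith
  differentiableAt := fun s hs => differentiableAt_riemannZeta hs
  eq_LSeries := fun s hs => (LSeries_one_eq_riemannZeta hs).symm

lemma norm_riemannZeta_one_add_le {x : ℝ} (hx : 0 < x) (hx1 : x ≤ 1) :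
    ‖riemannZeta (1 + x)‖ ≤ 4 / x := by
  have h := charSeries_riemannZeta
  have hre : ((1:ℂ) + x).re = 1 + x := by simp
  rw [h.eq_of_one_lt_re (N := 1) le_rfl (s := 1 + x) (by rw [hre]; linarith)]
  have h1 : ‖∫ y in Ioi ((1:ℕ):ℝ), sumRemainder (fun _ => 1) 1 1 y * (y:ℂ) ^ (-((1:ℂ)+x) - 1)‖
      ≤ 1 := by
    have := norm_integral_mul_cpow_le (f := sumRemainder (fun _ => 1) 1 1) (N := ((1:ℕ):ℝ))
      (by simp) (fun y hy => h.norm_sumRemainder_le hy.le) (s := 1 + x) (by rw [hre]; linarith)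
    refine this.trans ?_
    rw [hre, Nat.cast_one, Real.one_rpow]
    exact div_le_one_of_le₀ (by linarith) (by linarith)
  have h2 : ‖(1:ℂ) + x‖ ≤ 2 := by
    refine (norm_add_le _ _).trans ?_
    simp [abs_of_pos hx]; linarith
  have h3 : ‖(1:ℂ) * (((1:ℕ):ℂ) ^ (1 - ((1:ℂ)+x)) / ((1:ℂ) + x - 1))‖ = 1 / x := by
    simp [abs_of_pos hx]
  refine (norm_add₃_le).trans ?_
  rw [h3, norm_mul]
  have h4 : 1 ≤ 1 / x := by rw [le_div_iff₀ hx]; linarith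
  have h5 : ‖∑ n ∈ Finset.Icc (1:ℕ) 1, (1:ℂ) * (n:ℂ) ^ (-((1:ℂ)+x))‖ = 1 := by simp
  rw [h5]
  have := mul_le_mul h2 h1 (norm_nonneg _) (by norm_num)
  have h6 : 4 / x = 4 * (1/x) := by ring
  refine (add_le_add_right this _).trans ?_
  linarith

lemma three_four_one_aux {A F B κ x t : ℝ} (hx : 0 < x) {C : ℝ} (hA0 : 0 ≤ A)
    (hB0 : 0 ≤ B) (h : 1 ≤ A ^ 3 * F ^ 4 * B) (hA : A ≤ 4 / x)
    (ht : 0 ≤ t) (hB : B ≤ C * (2 * t) ^ κ) :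
    x ^ 3 ≤ (64 * C * 2 ^ κ) * F ^ 4 * t ^ κ := by
  have h1 : A ^ 3 ≤ 64 / x ^ 3 := by
    calc A ^ 3 ≤ (4 / x) ^ 3 := pow_le_pow_left₀ hA0 hA 3
      _ = 64 / x ^ 3 := by rw [div_pow]; norm_num
  have h2 : A ^ 3 * F ^ 4 * B ≤ 64 / x ^ 3 * F ^ 4 * (C * (2 * t) ^ κ) := by gcongr
  have h3 := h.trans h2
  rw [Real.mul_rpow (by norm_num) ht] at h3
  have h4 : 64 / x ^ 3 * F ^ 4 * (C * (2 ^ κ * t ^ κ)) =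
      ((64 * C * 2 ^ κ) * F ^ 4 * t ^ κ) / x ^ 3 := by ring
  rw [h4, le_div_iff₀ (by positivity), one_mul] at h3
  exact h3

lemma riemannZeta_three_four_one {κ : ℝ} (hκ : 0 < κ) : ∃ C : ℝ, 0 ≤ C ∧ ∀ x : ℝ, 0 < x →
    x ≤ 1 / 2 → ∀ t : ℝ, 2 ≤ t → x ^ 3 ≤ C * ‖riemannZeta (1 + x + t * I)‖ ^ 4 * t ^ κ := by
  obtain ⟨C, hC, hC2⟩ := charSeries_riemannZeta.norm_le_rpow one_pos le_rfl hκ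
  refine ⟨64 * C * 2 ^ κ, by positivity, fun x hx hx2 t ht => ?_⟩
  have h := DirichletCharacter.norm_LFunction_product_ge_one (N := 1) 1 hx t
  rw [DirichletCharacter.LFunctionTrivChar, one_pow,
    DirichletCharacter.LFunction_modOne_eq, norm_mul, norm_mul, norm_pow, norm_pow] at h
  rw [show (1:ℂ) + x + t * I = 1 + x + I * t by ring]
  refine three_four_one_aux hx (norm_nonneg _) (norm_nonneg _) h
    (norm_riemannZeta_one_add_le hx (by linarith)) (by linarith) ?_
  have := hC2 (1 + x + 2 * I * t) (by simp; linarith) (by simp; linarith) (by simp; linarith)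
  refine this.trans (le_of_eq ?_)
  simp

/-- The nontrivial Dirichlet character modulo `3`. -/
noncomputable def chiThree : DirichletCharacter ℂ 3 :=
  (quadraticChar (ZMod 3)).ringHomComp (Int.castRingHom ℂ)

lemma chiThree_zero : chiThree 0 = 0 := by simp [chiThree]

lemma chiThree_two : chiThree 2 = -1 := by
  have : quadraticChar (ZMod 3) 2 = -1 := by decide
  simp [chiThree, this]

lemma chiThree_natCast (n : ℕ) :
    chiThree (n : ZMod 3) = if n % 3 = 1 then 1 else if n % 3 = 2 then -1 else 0 := by
  have h : (n : ZMod 3) = ((n % 3 : ℕ) : ZMod 3) := by simp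
  have h3 : n % 3 < 3 := Nat.mod_lt _ (by norm_num)
  rw [h]
  interval_cases hn : n % 3
  · simp [chiThree_zero]
  · simp
  · simpa using chiThree_two

lemma sum_chiThree_range (k : ℕ) :
    ∑ n ∈ Finset.range (k + 1), chiThree (n : ZMod 3) = if k % 3 = 1 then 1 else 0 := by
  induction k with
  | zero => simp [chiThree_zero]
  | succ k ih =>
    rw [Finset.sum_range_succ, ih, chiThree_natCast]
    have : k % 3 < 3 := Nat.mod_lt _ (by norm_num)
    have h2 : (k + 1) % 3 = (k % 3 + 1) % 3 := by omega
    rw [h2]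
    interval_cases k % 3 <;> norm_num

lemma norm_sum_chiThree_Ioc_le {N k : ℕ} (h : N ≤ k) :
    ‖∑ n ∈ Finset.Ioc N k, chiThree (n : ZMod 3)‖ ≤ 1 := by
  have : ∑ n ∈ Finset.Ioc N k, chiThree (n : ZMod 3) =
      (if k % 3 = 1 then 1 else 0) - (if N % 3 = 1 then 1 else 0) := by
    rw [← sum_chiThree_range, ← sum_chiThree_range, eq_sub_iff_add_eq, add_comm,
      Finset.range_eq_Ico, Finset.range_eq_Ico]
    rw [← Finset.sum_Ico_consecutive _ (Nat.zero_le (N+1)) (Nat.succ_le_succ h)]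
    congr 1
    refine Finset.sum_congr ?_ fun _ _ => rfl
    ext n
    simp only [Finset.mem_Ioc, Finset.mem_Ico]
    omega
  rw [this]
  split_ifs <;> simp

lemma chiThree_ne_one : chiThree ≠ 1 := by
  intro h
  have h2 := chiThree_two
  rw [h, MulChar.one_apply (by decide)] at h2
  norm_num at h2

lemma chiThree_sq : chiThree ^ 2 = 1 := by
  refine MulChar.ext' fun a => ?_
  rw [MulChar.pow_apply' _ (by norm_num)]
  fin_cases a
  · change chiThree 0 ^ 2 = (1 : DirichletCharacter ℂ 3) 0
    rw [chiThree_zero, MulChar.map_nonunit _ (by decide)]; simp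
  · change chiThree 1 ^ 2 = (1 : DirichletCharacter ℂ 3) 1
    simp
  · change chiThree 2 ^ 2 = (1 : DirichletCharacter ℂ 3) 2
    rw [chiThree_two, MulChar.one_apply (by decide)]; simp

theorem charSeries_chiThree :
    CharSeries (fun n => chiThree (n : ZMod 3)) (DirichletCharacter.LFunction chiThree) 0 where
  map_one := by simp
  map_mul := by simp
  norm_le := fun n => DirichletCharacter.norm_le_one _ _
  norm_density_le := by simp
  remainder_le := by
    intro N x hx
    simpa using norm_sum_chiThree_Ioc_le (Nat.le_floor hx)
  differentiableAt := fun s _ => DirichletCharacter.differentiable_LFunction chiThree_ne_one s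
  eq_LSeries := fun s hs => DirichletCharacter.LFunction_eq_LSeries _ hs

lemma norm_one_sub_three_cpow_le {s : ℂ} (hs : 0 ≤ s.re) : ‖1 - (3:ℂ) ^ (-s)‖ ≤ 2 := by
  refine (norm_sub_le _ _).trans ?_
  have : ‖(3:ℂ) ^ (-s)‖ ≤ 1 := by
    rw [show (3:ℂ) = ((3:ℝ):ℂ) by norm_num, norm_cpow_eq_rpow_re_of_pos (by norm_num)]
    exact Real.rpow_le_one_of_one_le_of_nonpos (by norm_num) (by simpa using hs)
  rw [norm_one]; linarith

lemma norm_LFunctionTrivChar_three_le {s : ℂ} (hs : 0 ≤ s.re) (h1 : s ≠ 1) :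
    ‖DirichletCharacter.LFunctionTrivChar 3 s‖ ≤ 2 * ‖riemannZeta s‖ := by
  rw [DirichletCharacter.LFunctionTrivChar_eq_mul_riemannZeta h1, Nat.prime_three.primeFactors,
    Finset.prod_singleton, norm_mul]
  exact mul_le_mul_of_nonneg_right (by exact_mod_cast norm_one_sub_three_cpow_le hs) (norm_nonneg _)

lemma chiThree_three_four_one {κ : ℝ} (hκ : 0 < κ) : ∃ C : ℝ, 0 ≤ C ∧ ∀ x : ℝ, 0 < x →
    x ≤ 1 / 2 → ∀ t : ℝ, 2 ≤ t →
    x ^ 3 ≤ C * ‖DirichletCharacter.LFunction chiThree (1 + x + t * I)‖ ^ 4 * t ^ κ := by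
  obtain ⟨C, hC, hC2⟩ := charSeries_riemannZeta.norm_le_rpow one_pos le_rfl hκ
  refine ⟨64 * (16 * C) * 2 ^ κ, by positivity, fun x hx hx2 t ht => ?_⟩
  have h := DirichletCharacter.norm_LFunction_product_ge_one chiThree hx t
  rw [chiThree_sq, norm_mul, norm_mul, norm_pow, norm_pow] at h
  rw [show (1:ℂ) + x + t * I = 1 + x + I * t by ring]
  have h1 := norm_LFunctionTrivChar_three_le (s := 1 + x) (by simp; linarith) (by
    simp; exact hx.ne')
  have h2 := norm_LFunctionTrivChar_three_le (s := 1 + x + 2 * I * t) (by simp; linarith) (by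
    intro h0
    have := congrArg Complex.re h0
    simp at this; linarith)
  have h3 := hC2 (1 + x + 2 * I * t) (by simp; linarith) (by simp; linarith) (by simp; linarith)
  have h4 : ((1:ℂ) + x + 2 * I * t).im = 2 * t := by simp
  rw [h4, sub_self, zero_add] at h3
  refine three_four_one_aux (A := ‖riemannZeta (1 + x)‖) (B := 16 * ‖riemannZeta (1 + x + 2 * I * t)‖) hx (norm_nonneg _)
    (by positivity) ?_ (norm_riemannZeta_one_add_le hx (by linarith)) (by linarith)
    (by linarith)
  refine h.trans ?_
  calc _ ≤ (2 * ‖riemannZeta (1 + x)‖) ^ 3 *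
        ‖DirichletCharacter.LFunction chiThree (1 + x + I * t)‖ ^ 4 *
        (2 * ‖riemannZeta (1 + x + 2 * I * t)‖) := by gcongr
    _ = _ := by ring
end Instances

section MeanValue
open MeasureTheory Set Filter Topology

/-- The summatory function of `c` over the elements of `S` up to `x`. -/
noncomputable def partialSum (S : Finset ℕ) (c : ℕ → ℂ) (x : ℝ) : ℂ :=
  ∑ n ∈ S, if (n:ℝ) ≤ x then c n else 0

lemma measurable_partialSum (S : Finset ℕ) (c : ℕ → ℂ) : Measurable (partialSum S c) :=
  Finset.measurable_sum _ fun _ _ =>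
    Measurable.ite measurableSet_Ici measurable_const measurable_const

lemma exp_sub_one_le {h : ℝ} (h0 : 0 ≤ h) (h1 : h ≤ 1) : Real.exp h - 1 ≤ 2 * h := by
  have := Real.abs_exp_sub_one_le (x := h) (by rwa [abs_of_nonneg h0])
  rw [abs_of_nonneg h0] at this
  exact (le_abs_self _).trans this

lemma partialSum_sub (S : Finset ℕ) (c : ℕ → ℂ) {x y : ℝ} (hxy : x ≤ y) :
    partialSum S c y - partialSum S c x =
      ∑ n ∈ S.filter (fun n : ℕ => x < n ∧ (n:ℝ) ≤ y), c n := by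
  rw [partialSum, partialSum, ← Finset.sum_sub_distrib, Finset.sum_filter]
  refine Finset.sum_congr rfl fun n _ => ?_
  by_cases h1 : (n:ℝ) ≤ x
  · simp [h1, h1.trans hxy, not_lt.2 h1]
  · simp [h1, not_le.1 h1]

lemma card_window_le (S : Finset ℕ) {x y : ℝ} (hx : 0 ≤ x) (hxy : x ≤ y) :
    ((S.filter (fun n : ℕ => x < n ∧ (n:ℝ) ≤ y)).card : ℝ) ≤ 1 + (y - x) := by
  have h : (S.filter (fun n : ℕ => x < n ∧ (n:ℝ) ≤ y)) ⊆ Finset.Ioc ⌊x⌋₊ ⌊y⌋₊ := by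
    intro n hn
    obtain ⟨_, h1, h2⟩ := Finset.mem_filter.1 hn
    exact Finset.mem_Ioc.2 ⟨(Nat.floor_lt hx).2 h1, Nat.le_floor h2⟩
  have h2 := Finset.card_le_card h
  rw [Nat.card_Ioc] at h2
  have h3 : ((⌊y⌋₊ - ⌊x⌋₊ : ℕ) : ℝ) = ⌊y⌋₊ - ⌊x⌋₊ := Nat.cast_sub (Nat.floor_mono hxy)
  have h4 := Nat.floor_le (hx.trans hxy)
  have h5 := Nat.lt_floor_add_one x
  have h6 : ((S.filter (fun n : ℕ => x < n ∧ (n:ℝ) ≤ y)).card : ℝ) ≤ ((⌊y⌋₊ - ⌊x⌋₊ : ℕ) : ℝ) := by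
    exact_mod_cast h2
  linarith

lemma norm_partialSum_sub_sq_le (S : Finset ℕ) (c : ℕ → ℂ) {x h : ℝ} (hx : 0 < x) (h0 : 0 ≤ h)
    (h1 : h ≤ 1) :
    ‖partialSum S c (x * Real.exp h) - partialSum S c x‖ ^ 2 ≤
      ∑ n ∈ S, (Ico ((n:ℝ) * Real.exp (-h)) n).indicator
        (fun _ => ‖c n‖ ^ 2 * (1 + 2 * h * n)) x := by
  have hxy : x ≤ x * Real.exp h := le_mul_of_one_le_right hx.le (Real.one_le_exp h0)
  rw [partialSum_sub S c hxy]
  set W := S.filter (fun n : ℕ => x < n ∧ (n:ℝ) ≤ x * Real.exp h) with hW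
  have hcard := card_window_le S hx.le hxy
  have hsq : (∑ n ∈ W, ‖c n‖) ^ 2 ≤ W.card * ∑ n ∈ W, ‖c n‖ ^ 2 := sq_sum_le_card_mul_sum_sq
  have he := exp_sub_one_le h0 h1
  calc ‖∑ n ∈ W, c n‖ ^ 2 ≤ (∑ n ∈ W, ‖c n‖) ^ 2 := by
        gcongr; exact norm_sum_le _ _
    _ ≤ W.card * ∑ n ∈ W, ‖c n‖ ^ 2 := hsq
    _ = ∑ n ∈ W, ‖c n‖ ^ 2 * W.card := by rw [Finset.mul_sum]; simp_rw [mul_comm]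
    _ ≤ ∑ n ∈ W, ‖c n‖ ^ 2 * (1 + 2 * h * n) := by
        refine Finset.sum_le_sum fun n hn => ?_
        refine mul_le_mul_of_nonneg_left ?_ (sq_nonneg _)
        obtain ⟨_, hn1, _⟩ := Finset.mem_filter.1 hn
        refine hcard.trans ?_
        nlinarith [mul_le_mul_of_nonneg_left he hx.le, mul_le_mul_of_nonneg_left hn1.le h0]
    _ = _ := by
        rw [hW, Finset.sum_filter]
        refine Finset.sum_congr rfl fun n _ => ?_
        have : (x < n ∧ (n:ℝ) ≤ x * Real.exp h) ↔ x ∈ Ico ((n:ℝ) * Real.exp (-h)) n := by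
          rw [mem_Ico, Real.exp_neg, ← div_eq_mul_inv, div_le_iff₀ (Real.exp_pos h), and_comm]
        by_cases hm : x ∈ Ico ((n:ℝ) * Real.exp (-h)) n
        · rw [indicator_of_mem hm, if_pos (this.2 hm)]
        · rw [indicator_of_notMem hm, if_neg (fun h => hm (this.1 h))]

lemma enorm_sq_eq_ofReal (z : ℂ) : ‖z‖ₑ ^ 2 = ENNReal.ofReal (‖z‖ ^ 2) := by
  rw [← ofReal_norm, ENNReal.ofReal_pow (norm_nonneg _)]

theorem lintegral_partialSum_window_le (S : Finset ℕ) (hS : ∀ n ∈ S, 1 ≤ n) (c : ℕ → ℂ)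
    {α h : ℝ} (hα : 0 ≤ α) (h0 : 0 ≤ h) (h1 : h ≤ 1) :
    ∫⁻ x in Ioi (0:ℝ), ‖partialSum S c (x * Real.exp h) - partialSum S c x‖ₑ ^ 2 *
        ENNReal.ofReal (x ^ (-2 * α - 1)) ≤
      ENNReal.ofReal (Real.exp (2 * α + 1) * h *
        ∑ n ∈ S, ‖c n‖ ^ 2 * (n:ℝ) ^ (-2 * α) * (1 + 2 * h * n)) := by
  set w : ℕ → ℝ := fun n => ‖c n‖ ^ 2 * (1 + 2 * h * n) *
    (Real.exp (2 * α + 1) * (n:ℝ) ^ (-2 * α - 1)) with hw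
  have hw0 : ∀ n, 0 ≤ w n := fun n => by positivity
  have hpt : ∀ x ∈ Ioi (0:ℝ), ‖partialSum S c (x * Real.exp h) - partialSum S c x‖ₑ ^ 2 *
        ENNReal.ofReal (x ^ (-2 * α - 1)) ≤
      ∑ n ∈ S, (Ico ((n:ℝ) * Real.exp (-h)) n).indicator (fun _ => ENNReal.ofReal (w n)) x := by
    intro x hx
    have hx0 : (0:ℝ) < x := hx
    have hr : ∑ n ∈ S, (Ico ((n:ℝ) * Real.exp (-h)) n).indicator (fun _ => ENNReal.ofReal (w n)) x =
        ENNReal.ofReal (∑ n ∈ S, (Ico ((n:ℝ) * Real.exp (-h)) n).indicator (fun _ => w n) x) := by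
      rw [ENNReal.ofReal_sum_of_nonneg fun n _ => indicator_nonneg (fun _ _ => hw0 n) _]
      refine Finset.sum_congr rfl fun n _ => ?_
      by_cases hm : x ∈ Ico ((n:ℝ) * Real.exp (-h)) n
      · rw [indicator_of_mem hm, indicator_of_mem hm]
      · rw [indicator_of_notMem hm, indicator_of_notMem hm, ENNReal.ofReal_zero]
    rw [enorm_sq_eq_ofReal, ← ENNReal.ofReal_mul (sq_nonneg _), hr]
    refine ENNReal.ofReal_le_ofReal ?_
    refine (mul_le_mul_of_nonneg_right (norm_partialSum_sub_sq_le S c hx0 h0 h1)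
      (Real.rpow_nonneg hx0.le _)).trans ?_
    rw [Finset.sum_mul]
    refine Finset.sum_le_sum fun n hn => ?_
    by_cases hm : x ∈ Ico ((n:ℝ) * Real.exp (-h)) n
    · rw [indicator_of_mem hm, indicator_of_mem hm]
      refine mul_le_mul_of_nonneg_left ?_ (by positivity)
      have hn0 : (0:ℝ) < n := by exact_mod_cast hS n hn
      calc x ^ (-2 * α - 1) ≤ ((n:ℝ) * Real.exp (-h)) ^ (-2 * α - 1) :=
            Real.rpow_le_rpow_of_nonpos (by positivity) hm.1 (by linarith)
        _ = Real.exp (h * (2 * α + 1)) * (n:ℝ) ^ (-2 * α - 1) := by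
            rw [Real.mul_rpow hn0.le (Real.exp_pos _).le, ← Real.exp_mul, mul_comm]
            congr 2; ring
        _ ≤ _ := by gcongr; nlinarith
    · rw [indicator_of_notMem hm, indicator_of_notMem hm, zero_mul]
  refine (setLIntegral_mono' measurableSet_Ioi hpt).trans ?_
  rw [lintegral_finsetSum _ fun n _ => measurable_const.indicator measurableSet_Ico, Finset.mul_sum,
    ENNReal.ofReal_sum_of_nonneg fun n _ => by positivity]
  refine Finset.sum_le_sum fun n hn => ?_
  have hn0 : (0:ℝ) < n := by exact_mod_cast hS n hn
  calc ∫⁻ x in Ioi (0:ℝ), (Ico ((n:ℝ) * Real.exp (-h)) n).indicator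
          (fun _ => ENNReal.ofReal (w n)) x
      ≤ ∫⁻ x, (Ico ((n:ℝ) * Real.exp (-h)) n).indicator (fun _ => ENNReal.ofReal (w n)) x :=
        setLIntegral_le_lintegral _ _
    _ = ENNReal.ofReal (w n * (n - n * Real.exp (-h))) := by
        rw [lintegral_indicator_const measurableSet_Ico, Real.volume_Ico,
          ENNReal.ofReal_mul (hw0 n)]
    _ ≤ _ := by
        refine ENNReal.ofReal_le_ofReal ?_
        have h2 : (n:ℝ) - n * Real.exp (-h) ≤ n * h := by
          have := Real.add_one_le_exp (-h)
          nlinarith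
        refine (mul_le_mul_of_nonneg_left h2 (hw0 n)).trans (le_of_eq ?_)
        have h3 : (n:ℝ) ^ (-2 * α - 1) * n = (n:ℝ) ^ (-2 * α) := by
          rw [← Real.rpow_add_one hn0.ne']; congr 1; ring
        rw [hw]
        simp only
        rw [← h3]; ring

lemma integrableOn_ite_mul_cpow {n : ℕ} (hn : 1 ≤ n) (c : ℂ) {s : ℂ} (hs : 0 < s.re) :
    IntegrableOn (fun x : ℝ => (if (n:ℝ) ≤ x then c else 0) * (x:ℂ) ^ (-s - 1)) (Ioi 0) ∧
    ∫ x in Ioi (0:ℝ), (if (n:ℝ) ≤ x then c else 0) * (x:ℂ) ^ (-s - 1) = c * ((n:ℂ) ^ (-s) / s) := by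
  have hn0 : (0:ℝ) < n := by exact_mod_cast hn
  have hs0 : s ≠ 0 := by rintro rfl; simp at hs
  have heq : (fun x : ℝ => (if (n:ℝ) ≤ x then c else 0) * (x:ℂ) ^ (-s - 1)) =
      (Ici (n:ℝ)).indicator (fun x : ℝ => c * (x:ℂ) ^ (-s - 1)) := by
    funext x
    by_cases hx : (n:ℝ) ≤ x
    · rw [indicator_of_mem (mem_Ici.2 hx), if_pos hx]
    · rw [indicator_of_notMem (by simpa using hx), if_neg hx, zero_mul]
  have hsub : Ici (n:ℝ) ⊆ Ioi 0 := fun x hx => hn0.trans_le hx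
  have hInt : IntegrableOn (fun x : ℝ => c * (x:ℂ) ^ (-s - 1)) (Ici (n:ℝ)) := by
    rw [integrableOn_Ici_iff_integrableOn_Ioi]
    exact (integrableOn_Ioi_cpow_of_lt (a := -s - 1) (by simp; linarith) hn0).const_mul c
  rw [heq]
  constructor
  · exact (integrable_indicator_iff measurableSet_Ici).2 hInt |>.integrableOn
  · rw [setIntegral_indicator measurableSet_Ici, inter_eq_right.2 hsub, integral_Ici_eq_integral_Ioi,
      integral_const_mul, integral_Ioi_cpow_of_lt (by simp; linarith) hn0]
    congr 1
    rw [ofReal_natCast, show -s - 1 + 1 = -s by ring, neg_div_neg_eq]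

lemma integrableOn_partialSum_mul_cpow (S : Finset ℕ) (hS : ∀ n ∈ S, 1 ≤ n) (c : ℕ → ℂ)
    {s : ℂ} (hs : 0 < s.re) :
    IntegrableOn (fun x : ℝ => partialSum S c x * (x:ℂ) ^ (-s - 1)) (Ioi 0) := by
  simp_rw [partialSum, Finset.sum_mul]
  exact integrable_finsetSum _ fun n hn => (integrableOn_ite_mul_cpow (hS n hn) (c n) hs).1

lemma integral_partialSum_mul_cpow (S : Finset ℕ) (hS : ∀ n ∈ S, 1 ≤ n) (c : ℕ → ℂ)
    {s : ℂ} (hs : 0 < s.re) :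
    s * ∫ x in Ioi (0:ℝ), partialSum S c x * (x:ℂ) ^ (-s - 1) = ∑ n ∈ S, c n * (n:ℂ) ^ (-s) := by
  have hs0 : s ≠ 0 := by rintro rfl; simp at hs
  simp_rw [partialSum, Finset.sum_mul]
  rw [integral_finsetSum _ fun n hn => (integrableOn_ite_mul_cpow (hS n hn) (c n) hs).1,
    Finset.mul_sum]
  refine Finset.sum_congr rfl fun n hn => ?_
  rw [(integrableOn_ite_mul_cpow (hS n hn) (c n) hs).2]
  field_simp

/-- Mean value theorem for Dirichlet polynomials on the line `Re s = 1`. -/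
theorem integral_norm_sq_dirichletPoly_le (S : Finset ℕ) (hS : ∀ n ∈ S, 1 ≤ n) (c : ℕ → ℂ)
    {T : ℝ} (hT : 1 ≤ T) :
    ∫ t in (-T)..T, ‖∑ n ∈ S, c n * (n:ℂ) ^ (-(1 + t * I))‖ ^ 2 ≤
      320 * Real.exp 3 * ∑ n ∈ S, ‖c n‖ ^ 2 * (n:ℝ) ^ (-2:ℝ) * (T + n) := by
  set h : ℝ := 1 / (2 * (T + 1)) with hh
  have hh0 : 0 < h := by positivity
  have hh1 : h ≤ 1 := by
    rw [hh, div_le_one (by positivity)]; linarith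
  have h1 := ofReal_mul_integral_mellin_sq_le (f := partialSum S c) (α := 1) one_pos
    (by
      simpa using integrableOn_partialSum_mul_cpow S hS c (s := 1) (by simp))
    (T := T) (by linarith) hh0 (by
      rw [hh]; exact le_of_eq (by field_simp))
  have h2 := h1.trans (mul_le_mul_right
    (lintegral_partialSum_window_le S hS c zero_le_one hh0.le hh1) 80)
  have h3 : ∀ t : ℝ, ((1:ℝ) + t * I) * ∫ x in Ioi (0:ℝ), partialSum S c x *
      (x:ℂ) ^ (-((1:ℝ) + t * I) - 1) = ∑ n ∈ S, c n * (n:ℂ) ^ (-(1 + t * I)) := by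
    intro t
    rw [integral_partialSum_mul_cpow S hS c (s := (1:ℝ) + t * I) (by simp), ofReal_one]
  simp_rw [h3] at h2
  rw [show (80:ENNReal) = ENNReal.ofReal 80 by simp, ← ENNReal.ofReal_mul (by norm_num)] at h2
  rw [ENNReal.ofReal_le_ofReal_iff (by positivity)] at h2
  rw [← mul_le_mul_iff_right₀ (show 0 < h ^ 2 by positivity)]
  refine h2.trans ?_
  have h4 : ∑ n ∈ S, ‖c n‖ ^ 2 * (n:ℝ) ^ (-2 * (1:ℝ)) * (1 + 2 * h * n) ≤
      h * (4 * ∑ n ∈ S, ‖c n‖ ^ 2 * (n:ℝ) ^ (-2:ℝ) * (T + n)) := by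
    rw [Finset.mul_sum, Finset.mul_sum]
    refine Finset.sum_le_sum fun n _ => ?_
    have h5 : 1 + 2 * h * n ≤ h * (4 * (T + n)) := by
      have h6 : h * (2 * (T + 1)) = 1 := by rw [hh]; field_simp
      have : 0 ≤ h * n := by positivity
      nlinarith
    rw [mul_one]
    calc _ ≤ ‖c n‖ ^ 2 * (n:ℝ) ^ (-2:ℝ) * (h * (4 * (T + n))) := by gcongr
      _ = _ := by ring
  calc 80 * (Real.exp (2 * 1 + 1) * h * ∑ n ∈ S, ‖c n‖ ^ 2 * (n:ℝ) ^ (-2 * (1:ℝ)) * (1 + 2 * h * n))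
      ≤ 80 * (Real.exp (2 * 1 + 1) * h * (h * (4 * ∑ n ∈ S, ‖c n‖ ^ 2 * (n:ℝ) ^ (-2:ℝ) * (T + n)))) := by
        gcongr
    _ = _ := by rw [show (2:ℝ) * 1 + 1 = 3 by norm_num]; ring

end MeanValue

section SecondMoment
open MeasureTheory Set Filter Topology

lemma sum_Icc_inv_le (K : ℕ) : ∑ n ∈ Finset.Icc 1 K, (n:ℝ)⁻¹ ≤ 1 + Real.log K := by
  have h := harmonic_le_one_add_log K
  rw [harmonic_eq_sum_Icc] at h
  push_cast at h
  exact h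

lemma CharSeries.indicator_sumRemainder_eq {a F ρ} (_h : CharSeries a F ρ) {K : ℕ} {y : ℝ}
    (hy : y ≤ K) : (Ioi (1:ℝ)).indicator (sumRemainder a ρ 1) y =
      partialSum (Finset.Ioc 1 K) a y - ρ * (max (y - 1) 0 : ℝ) := by
  by_cases h1 : 1 < y
  · rw [indicator_of_mem (mem_Ioi.2 h1), sumRemainder, max_eq_left (by linarith), partialSum,
      ← Finset.sum_filter]
    push_cast
    congr 2
    ext n
    simp only [Finset.mem_Ioc, Finset.mem_filter]
    rw [Nat.le_floor_iff (by linarith)]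
    constructor
    · rintro ⟨h2, h3⟩
      exact ⟨⟨h2, by exact_mod_cast h3.trans hy⟩, h3⟩
    · rintro ⟨⟨h2, _⟩, h3⟩
      exact ⟨h2, h3⟩
  · rw [indicator_of_notMem (by simpa using h1), max_eq_right (by linarith), partialSum,
      Finset.sum_eq_zero]
    · simp
    · intro n hn
      have : (1:ℝ) < n := by exact_mod_cast (Finset.mem_Ioc.1 hn).1
      rw [if_neg (by linarith)]

lemma CharSeries.norm_indicator_sumRemainder_le {a F ρ} (h : CharSeries a F ρ) (y : ℝ) :
    ‖(Ioi (1:ℝ)).indicator (sumRemainder a ρ 1) y‖ ≤ 1 := by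
  by_cases h1 : 1 < y
  · rw [indicator_of_mem (mem_Ioi.2 h1)]
    exact h.norm_sumRemainder_le (by simpa using h1.le)
  · rw [indicator_of_notMem (by simpa using h1)]; simp

lemma abs_max_mul_exp_sub_le {x h : ℝ} (hx : 0 < x) (h0 : 0 ≤ h) (h1 : h ≤ 1 / 2) :
    |max (x * Real.exp h - 1) 0 - max (x - 1) 0| ≤ if 1 / 2 ≤ x then 2 * h * x else 0 := by
  have he := exp_sub_one_le h0 (by linarith)
  have he1 := Real.one_le_exp h0
  split_ifs with hx2
  · refine (abs_max_sub_max_le_abs _ _ _).trans ?_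
    rw [show x * Real.exp h - 1 - (x - 1) = x * (Real.exp h - 1) by ring, abs_of_nonneg
      (mul_nonneg hx.le (by linarith))]
    nlinarith
  · have : x * Real.exp h ≤ 1 := by nlinarith
    rw [max_eq_right (by linarith), max_eq_right (by linarith)]; simp

lemma CharSeries.norm_window_sq_le {a F ρ} (h : CharSeries a F ρ) {T η α : ℝ} {K : ℕ}
    (hK : 2 * T ≤ K) (h0 : 0 ≤ η) (h1 : η ≤ 1 / 2) (hα : 1 / 2 ≤ α) {x : ℝ} (hx : 0 < x) :
    ‖(Ioi (1:ℝ)).indicator (sumRemainder a ρ 1) (x * Real.exp η) -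
        (Ioi (1:ℝ)).indicator (sumRemainder a ρ 1) x‖ ^ 2 * x ^ (-2 * α - 1) ≤
      2 * (‖partialSum (Finset.Ioc 1 K) a (x * Real.exp η) -
        partialSum (Finset.Ioc 1 K) a x‖ ^ 2 * x ^ (-2 * α - 1)) +
      ((Ioc 0 T).indicator (fun _ => 8 * η ^ 2 * 2 ^ (2 * α - 1)) x +
      (Ioi T).indicator (fun x => 4 * x ^ (-2 * α - 1)) x) := by
  by_cases hT : x ≤ T
  · rw [indicator_of_mem (show x ∈ Ioc 0 T from ⟨hx, hT⟩),
      indicator_of_notMem (show x ∉ Ioi T from not_lt.2 hT), add_zero]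
    have he : Real.exp η ≤ 2 := by
      have := exp_sub_one_le h0 (by linarith); linarith
    rw [h.indicator_sumRemainder_eq (K := K) (by nlinarith),
      h.indicator_sumRemainder_eq (K := K) (by nlinarith)]
    set P := partialSum (Finset.Ioc 1 K) a (x * Real.exp η) - partialSum (Finset.Ioc 1 K) a x
    set Q : ℂ := ρ * ((max (x * Real.exp η - 1) 0 - max (x - 1) 0 : ℝ) : ℂ)
    have hPQ : partialSum (Finset.Ioc 1 K) a (x * Real.exp η) -
        ρ * ((max (x * Real.exp η - 1) 0 : ℝ) : ℂ) - (partialSum (Finset.Ioc 1 K) a x -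
        ρ * ((max (x - 1) 0 : ℝ) : ℂ)) = P - Q := by
      simp only [P, Q]; push_cast; ring
    rw [hPQ]
    have hQ : ‖Q‖ ≤ if 1 / 2 ≤ x then 2 * η * x else 0 := by
      have := abs_max_mul_exp_sub_le hx h0 h1
      simp only [Q]
      rw [norm_mul, Complex.norm_real, Real.norm_eq_abs]
      exact (mul_le_of_le_one_left (abs_nonneg _) h.norm_density_le).trans this
    have hsq : ‖P - Q‖ ^ 2 ≤ 2 * ‖P‖ ^ 2 + 2 * ‖Q‖ ^ 2 := by
      have := _root_.norm_sub_le P Q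
      nlinarith [sq_nonneg (‖P‖ - ‖Q‖), norm_nonneg (P - Q)]
    have hQ2 : 2 * ‖Q‖ ^ 2 * x ^ (-2 * α - 1) ≤ 8 * η ^ 2 * 2 ^ (2 * α - 1) := by
      split_ifs at hQ with hx2
      · calc 2 * ‖Q‖ ^ 2 * x ^ (-2 * α - 1) ≤ 2 * (2 * η * x) ^ 2 * x ^ (-2 * α - 1) := by gcongr
          _ = 8 * η ^ 2 * x ^ (-(2 * α - 1)) := by
            have : x ^ (-(2 * α - 1)) = x ^ (-2 * α - 1) * x ^ 2 := by
              rw [← Real.rpow_natCast, ← Real.rpow_add hx]; congr 1; norm_num; ring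
            rw [this]; ring
          _ ≤ 8 * η ^ 2 * (1 / 2) ^ (-(2 * α - 1)) := by
            refine mul_le_mul_of_nonneg_left ?_ (by positivity)
            exact Real.rpow_le_rpow_of_nonpos (by norm_num) hx2 (by linarith)
          _ = _ := by
            rw [one_div, Real.inv_rpow (by norm_num), Real.rpow_neg (by norm_num), inv_inv]
      · have : ‖Q‖ = 0 := le_antisymm hQ (norm_nonneg _)
        rw [this]; simp; positivity
    calc _ ≤ (2 * ‖P‖ ^ 2 + 2 * ‖Q‖ ^ 2) * x ^ (-2 * α - 1) := by gcongr
      _ = 2 * (‖P‖ ^ 2 * x ^ (-2 * α - 1)) + 2 * ‖Q‖ ^ 2 * x ^ (-2 * α - 1) := by ring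
      _ ≤ _ := by gcongr
  · rw [indicator_of_notMem (show x ∉ Ioc 0 T from fun h => hT h.2),
      indicator_of_mem (show x ∈ Ioi T from not_le.1 hT), zero_add]
    have h2 : ‖(Ioi (1:ℝ)).indicator (sumRemainder a ρ 1) (x * Real.exp η) -
        (Ioi (1:ℝ)).indicator (sumRemainder a ρ 1) x‖ ≤ 2 := by
      refine (_root_.norm_sub_le _ _).trans ?_
      linarith [h.norm_indicator_sumRemainder_le (x * Real.exp η),
        h.norm_indicator_sumRemainder_le x]
    calc _ ≤ (2:ℝ) ^ 2 * x ^ (-2 * α - 1) := by gcongr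
      _ = 0 + 4 * x ^ (-2 * α - 1) := by norm_num
      _ ≤ _ := by gcongr; positivity

lemma lintegral_Ioi_rpow_le {T α : ℝ} (hT : 1 ≤ T) (hα : 1 / 2 ≤ α) :
    ∫⁻ x in Ioi T, ENNReal.ofReal (4 * x ^ (-2 * α - 1)) ≤ ENNReal.ofReal (4 / T) := by
  have hT0 : 0 < T := by linarith
  rw [← ofReal_integral_eq_lintegral_ofReal
    ((integrableOn_Ioi_rpow_of_lt (by linarith) hT0).const_mul 4)]
  · refine ENNReal.ofReal_le_ofReal ?_
    rw [integral_const_mul, integral_Ioi_rpow_of_lt (by linarith) hT0, div_eq_mul_inv 4 T]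
    refine mul_le_mul_of_nonneg_left ?_ (by norm_num)
    rw [show -2 * α - 1 + 1 = -(2 * α) by ring, neg_div_neg_eq]
    have : T ^ (-(2 * α)) ≤ T⁻¹ := by
      rw [← Real.rpow_neg_one]
      exact Real.rpow_le_rpow_of_exponent_le hT (by linarith)
    exact (div_le_self (Real.rpow_nonneg hT0.le _) (by linarith)).trans this
  · refine (ae_restrict_iff' measurableSet_Ioi).2 (ae_of_all _ fun x hx => ?_)
    have : 0 < x := hT0.trans hx
    positivity

lemma sum_window_weights_le {T η α : ℝ} {K : ℕ} {a : ℕ → ℂ} (ha : ∀ n, ‖a n‖ ≤ 1)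
    (hT : 2 ≤ T) (hK : (K:ℝ) ≤ 3 * T) (hα : 1 / 2 ≤ α) (h0 : 0 ≤ η) (hη : 2 * η * T ≤ 1) :
    ∑ n ∈ Finset.Ioc 1 K, ‖a n‖ ^ 2 * (n:ℝ) ^ (-2 * α) * (1 + 2 * η * n) ≤ 10 * Real.log T := by
  have hlog : 1 / 2 ≤ Real.log T := by
    have := Real.log_two_gt_d9
    have := Real.log_le_log (by norm_num) hT
    linarith
  have h1 : ∑ n ∈ Finset.Ioc 1 K, ‖a n‖ ^ 2 * (n:ℝ) ^ (-2 * α) * (1 + 2 * η * n) ≤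
      ∑ n ∈ Finset.Icc 1 K, ((n:ℝ)⁻¹ + 2 * η) := by
    refine (Finset.sum_le_sum fun n hn => ?_).trans
      (Finset.sum_le_sum_of_subset_of_nonneg (s := Finset.Ioc 1 K) ?_ ?_)
    · have hn1 : (1:ℝ) ≤ n := by exact_mod_cast (Finset.mem_Ioc.1 hn).1.le
      have hn0 : (0:ℝ) < n := by linarith
      have h2 : (n:ℝ) ^ (-2 * α) ≤ (n:ℝ)⁻¹ := by
        rw [← Real.rpow_neg_one]
        exact Real.rpow_le_rpow_of_exponent_le hn1 (by linarith)
      have h3 : ‖a n‖ ^ 2 ≤ 1 := pow_le_one₀ (norm_nonneg _) (ha n)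
      calc _ ≤ 1 * (n:ℝ)⁻¹ * (1 + 2 * η * n) := by gcongr
        _ = _ := by field_simp
    · intro n hn
      rw [Finset.mem_Icc]; rw [Finset.mem_Ioc] at hn; omega
    · intro n _ _; positivity
  refine h1.trans ?_
  rw [Finset.sum_add_distrib, Finset.sum_const, Nat.card_Icc, nsmul_eq_mul, Nat.add_sub_cancel]
  have h2 := sum_Icc_inv_le K
  have h3 : (K:ℝ) * (2 * η) ≤ 3 := by nlinarith
  have h4 : Real.log K ≤ 2 + Real.log T := by
    rcases Nat.eq_zero_or_pos K with rfl | hK0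
    · simp; linarith
    · have h5 := Real.log_le_log (by exact_mod_cast hK0) hK
      rw [Real.log_mul (by norm_num) (by linarith)] at h5
      have h6 := Real.log_le_sub_one_of_pos (x := 3) (by norm_num)
      linarith
  linarith [Real.log_two_gt_d9, Real.log_le_log (by norm_num) hT]

/-- The second moment of `F` on a vertical line to the right of the critical line. -/
theorem CharSeries.integral_norm_sq_le {a F ρ} (h : CharSeries a F ρ) {α : ℝ} (hα : 1 / 2 ≤ α) :
    ∃ C : ℝ, 0 ≤ C ∧ ∀ T : ℝ, 2 ≤ T →
      ∫ t in (1:ℝ)..T, ‖F (α + t * I)‖ ^ 2 ≤ C * (T * Real.log T) := by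
  set f := (Ioi (1:ℝ)).indicator (sumRemainder a ρ 1) with hf
  set E := Real.exp (2 * α + 1)
  set A : ℝ := 2 ^ (2 * α - 1)
  set β : ℝ := 2 * (1 + α)
  have hα0 : 0 < α := by linarith
  have hE : 0 < E := Real.exp_pos _
  have hA : 0 < A := by positivity
  have hβ : 0 < β := by positivity
  have hfm : Measurable f := (measurable_sumRemainder a ρ 1).indicator measurableSet_Ioi
  have hfc : ∀ s : ℂ, ∫ x in Ioi (0:ℝ), f x * (x:ℂ) ^ (-s - 1) =
      ∫ x in Ioi (1:ℝ), sumRemainder a ρ 1 x * (x:ℂ) ^ (-s - 1) := by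
    intro s
    have : (fun x : ℝ => f x * (x:ℂ) ^ (-s - 1)) =
        (Ioi (1:ℝ)).indicator (fun x : ℝ => sumRemainder a ρ 1 x * (x:ℂ) ^ (-s - 1)) := by
      funext x
      by_cases hx : x ∈ Ioi (1:ℝ)
      · rw [hf, indicator_of_mem hx, indicator_of_mem hx]
      · rw [hf, indicator_of_notMem hx, indicator_of_notMem hx, zero_mul]
    rw [this, setIntegral_indicator measurableSet_Ioi,
      inter_eq_right.2 (Ioi_subset_Ioi zero_le_one)]
  have hrem : ∀ x : ℝ, 1 < x → ‖sumRemainder a ρ 1 x‖ ≤ 1 := fun x hx =>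
    h.norm_sumRemainder_le (by simpa using hx.le)
  have hInt : IntegrableOn (fun x : ℝ => f x * (x:ℂ) ^ (-(α:ℂ) - 1)) (Ioi 0) := by
    have : (fun x : ℝ => f x * (x:ℂ) ^ (-(α:ℂ) - 1)) =
        (Ioi (1:ℝ)).indicator (fun x : ℝ => sumRemainder a ρ 1 x * (x:ℂ) ^ (-(α:ℂ) - 1)) := by
      funext x
      by_cases hx : x ∈ Ioi (1:ℝ)
      · rw [hf, indicator_of_mem hx, indicator_of_mem hx]
      · rw [hf, indicator_of_notMem hx, indicator_of_notMem hx, zero_mul]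
    rw [this]
    exact ((integrable_indicator_iff measurableSet_Ioi).2 (integrableOn_mul_cpow
      (measurable_sumRemainder a ρ 1) one_pos hrem (by simpa using hα0))).integrableOn
  set G : ℝ → ℂ := fun t => (α + t * I) * ∫ x in Ioi (0:ℝ), f x * (x:ℂ) ^ (-(α + t * I) - 1)
    with hG
  have hGc : Continuous G := by
    rw [continuous_iff_continuousAt]
    intro t
    have h1 : ContinuousAt (fun s : ℂ => s * ∫ x in Ioi (0:ℝ), f x * (x:ℂ) ^ (-s - 1))
        (α + t * I) := by
      simp_rw [hfc]
      exact continuousAt_id.mul (differentiableAt_integral_mul_cpow (measurable_sumRemainder a ρ 1)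
        one_pos hrem (by simpa using hα0)).continuousAt
    exact h1.comp (f := fun t : ℝ => (α:ℂ) + t * I) (by fun_prop)
  have hkey : ∀ T : ℝ, 2 ≤ T → ∫ t in (-T)..T, ‖G t‖ ^ 2 ≤
      80 * (40 * E * β + 16 * A + 8 * β ^ 2) * (T * Real.log T) := by
    intro T hT
    have hT0 : 0 < T := by linarith
    set η : ℝ := 1 / (2 * (T + α)) with hη
    have hη0 : 0 < η := by positivity
    have hη1 : (T + α) * η = 1 / 2 := by rw [hη]; field_simp
    have hη2 : η ≤ 1 / 2 := by nlinarith
    have hη3 : 2 * η * T ≤ 1 := by nlinarith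
    set K := ⌈2 * T⌉₊ with hKdef
    have hK1 : 2 * T ≤ K := Nat.le_ceil _
    have hK2 : (K:ℝ) ≤ 3 * T := by
      have := Nat.ceil_lt_add_one (show 0 ≤ 2 * T by linarith)
      linarith
    have h1 := ofReal_mul_integral_mellin_sq_le (f := f) hα0 hInt hT0 hη0 hη1.le
    have h2 : ∫⁻ x in Ioi (0:ℝ), ‖f (x * Real.exp η) - f x‖ₑ ^ 2 *
        ENNReal.ofReal (x ^ (-2 * α - 1)) ≤
        ENNReal.ofReal (20 * E * η * Real.log T + 8 * η ^ 2 * A * T + 4 / T) := by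
      have hpt : ∀ x ∈ Ioi (0:ℝ), ‖f (x * Real.exp η) - f x‖ₑ ^ 2 *
          ENNReal.ofReal (x ^ (-2 * α - 1)) ≤
          2 * (‖partialSum (Finset.Ioc 1 K) a (x * Real.exp η) -
            partialSum (Finset.Ioc 1 K) a x‖ₑ ^ 2 * ENNReal.ofReal (x ^ (-2 * α - 1))) +
          ((Ioc 0 T).indicator (fun _ => ENNReal.ofReal (8 * η ^ 2 * A)) x +
          (Ioi T).indicator (fun x => ENNReal.ofReal (4 * x ^ (-2 * α - 1))) x) := by
        intro x hx
        have hx0 : (0:ℝ) < x := hx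
        have h3 := ENNReal.ofReal_le_ofReal (h.norm_window_sq_le hK1 hη0.le hη2 hα hx0)
        rw [ENNReal.ofReal_add (by positivity) (add_nonneg
          (indicator_nonneg (fun _ _ => by positivity) _)
          (indicator_nonneg (fun y hy => by have : 0 < y := hT0.trans hy; positivity) _)),
          ENNReal.ofReal_add (indicator_nonneg (fun _ _ => by positivity) _)
          (indicator_nonneg (fun y hy => by have : 0 < y := hT0.trans hy; positivity) _),
          ENNReal.ofReal_mul (by norm_num), ENNReal.ofReal_mul (by positivity),
          ENNReal.ofReal_mul (by positivity), ← enorm_sq_eq_ofReal, ← enorm_sq_eq_ofReal] at h3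
        refine h3.trans (le_of_eq ?_)
        congr 1
        · simp
        · congr 1
          · by_cases hm : x ∈ Ioc 0 T
            · rw [indicator_of_mem hm, indicator_of_mem hm]
            · rw [indicator_of_notMem hm, indicator_of_notMem hm, ENNReal.ofReal_zero]
          · by_cases hm : x ∈ Ioi T
            · rw [indicator_of_mem hm, indicator_of_mem hm]
            · rw [indicator_of_notMem hm, indicator_of_notMem hm, ENNReal.ofReal_zero]
      refine (setLIntegral_mono' measurableSet_Ioi hpt).trans ?_
      have hps := measurable_partialSum (Finset.Ioc 1 K) a
      rw [lintegral_add_left (by fun_prop), lintegral_add_left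
        (measurable_const.indicator measurableSet_Ioc), lintegral_const_mul _ (by fun_prop)]
      have h4 := lintegral_partialSum_window_le (Finset.Ioc 1 K)
        (fun n hn => (Finset.mem_Ioc.1 hn).1.le) a hα0.le hη0.le (by linarith)
      have h5 := sum_window_weights_le (K := K) h.norm_le hT hK2 hα hη0.le hη3
      have h6 : ∫⁻ x in Ioi (0:ℝ), (Ioc 0 T).indicator
          (fun _ => ENNReal.ofReal (8 * η ^ 2 * A)) x ≤ ENNReal.ofReal (8 * η ^ 2 * A * T) := by
        refine (setLIntegral_le_lintegral _ _).trans (le_of_eq ?_)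
        rw [lintegral_indicator_const measurableSet_Ioc, Real.volume_Ioc, sub_zero,
          ← ENNReal.ofReal_mul (by positivity)]
      have h7 : ∫⁻ x in Ioi (0:ℝ), (Ioi T).indicator
          (fun x => ENNReal.ofReal (4 * x ^ (-2 * α - 1))) x ≤ ENNReal.ofReal (4 / T) := by
        refine (setLIntegral_le_lintegral _ _).trans ?_
        rw [lintegral_indicator measurableSet_Ioi]
        exact lintegral_Ioi_rpow_le (by linarith) hα
      have hlogT : 0 ≤ Real.log T := Real.log_nonneg (by linarith)
      rw [add_assoc (20 * E * η * Real.log T), ENNReal.ofReal_add (by positivity) (by positivity),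
        ENNReal.ofReal_add (by positivity) (by positivity)]
      refine add_le_add ?_ (add_le_add h6 h7)
      rw [show 20 * E * η * Real.log T = 2 * (E * η * (10 * Real.log T)) by ring,
        ENNReal.ofReal_mul (by norm_num : (0:ℝ) ≤ 2)]
      rw [show ENNReal.ofReal 2 = 2 by simp]
      refine mul_le_mul_right (h4.trans (ENNReal.ofReal_le_ofReal ?_)) 2
      exact mul_le_mul_of_nonneg_left h5 (by positivity)
    have h3 := h1.trans (mul_le_mul_right h2 80)
    have hlogT : 1 / 2 ≤ Real.log T := by
      have := Real.log_two_gt_d9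
      have := Real.log_le_log (by norm_num) hT
      linarith
    have hlogT0 : 0 ≤ Real.log T := by linarith
    rw [show (80:ENNReal) = ENNReal.ofReal 80 by simp, ← ENNReal.ofReal_mul (by norm_num),
      ENNReal.ofReal_le_ofReal_iff (by positivity)] at h3
    rw [← mul_le_mul_iff_right₀ (show 0 < η ^ 2 by positivity)]
    refine h3.trans ?_
    have h8 : 1 ≤ η * (β * T) := by
      have : 2 * (T + α) ≤ β * T := by simp only [β]; nlinarith
      nlinarith
    have h9 : T ≤ 2 * (T * Real.log T) := by nlinarith
    have h10 : 4 / T ≤ 4 * (η ^ 2 * β ^ 2 * T) := by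
      rw [div_le_iff₀ hT0]
      nlinarith
    have h11 : 20 * E * η * Real.log T ≤ 20 * E * Real.log T * η * (η * (β * T)) := by
      nlinarith [show 0 ≤ 20 * E * Real.log T * η by positivity]
    have h12 : η ^ 2 * A * T ≤ η ^ 2 * A * (2 * (T * Real.log T)) := by gcongr
    have h13 : η ^ 2 * β ^ 2 * T ≤ η ^ 2 * β ^ 2 * (2 * (T * Real.log T)) := by gcongr
    have h14 : 0 ≤ E * β * η ^ 2 * (T * Real.log T) := by positivity
    nlinarith
  refine ⟨3 * (80 * (40 * E * β + 16 * A + 8 * β ^ 2) + 4), by positivity, fun T hT => ?_⟩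
  have hT0 : 0 < T := by linarith
  have hFG : ∀ t : ℝ, 1 ≤ t → ‖F (α + t * I)‖ ^ 2 ≤ 3 * (2 + ‖G t‖ ^ 2) := by
    intro t ht
    have h1 := h.eq_sum_add (N := 1) le_rfl (s := α + t * I) (by simpa using hα0) (by simp; linarith)
    have h2 : ‖∑ n ∈ Finset.Icc 1 1, a n * (n:ℂ) ^ (-(α + t * I))‖ ≤ 1 := by
      simp [h.map_one]
    have h3 : ‖ρ * (((1:ℕ):ℂ) ^ (1 - (α + t * I)) / (α + t * I - 1))‖ ≤ 1 := by
      have h5 : 1 ≤ ‖(α:ℂ) + t * I - 1‖ := by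
        have := Complex.abs_im_le_norm ((α:ℂ) + t * I - 1)
        simp at this
        linarith [le_abs_self t]
      rw [norm_mul, norm_div, Nat.cast_one, one_cpow, norm_one]
      refine mul_le_one₀ h.norm_density_le (by positivity) ?_
      exact div_le_one_of_le₀ h5 (norm_nonneg _)
    have h4 : (α + t * I) * ∫ x in Ioi ((1:ℕ):ℝ), sumRemainder a ρ 1 x * (x:ℂ) ^ (-(α + t * I) - 1)
        = G t := by
      rw [hG]; simp only [hfc, Nat.cast_one]
    rw [h4] at h1
    rw [h1]
    refine (pow_le_pow_left₀ (norm_nonneg _) norm_add₃_le 2).trans ?_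
    nlinarith [norm_nonneg (∑ n ∈ Finset.Icc 1 1, a n * (n:ℂ) ^ (-(α + t * I))),
      norm_nonneg (ρ * (((1:ℕ):ℂ) ^ (1 - (α + t * I)) / (α + t * I - 1))), norm_nonneg (G t),
      sq_nonneg (‖G t‖ - 1)]
  have hGi : ∀ u v : ℝ, IntervalIntegrable (fun t => ‖G t‖ ^ 2) volume u v := fun u v =>
    (hGc.norm.pow 2).intervalIntegrable _ _
  have hlogT : 1 / 2 ≤ Real.log T := by
    have := Real.log_two_gt_d9
    have := Real.log_le_log (by norm_num) hT
    linarith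
  have h1 : ∫ t in (1:ℝ)..T, ‖F (α + t * I)‖ ^ 2 ≤ ∫ t in (1:ℝ)..T, 3 * (2 + ‖G t‖ ^ 2) := by
    refine intervalIntegral.integral_mono_on_of_le_Ioo (by linarith) ?_ ?_ fun t ht =>
      hFG t ht.1.le
    · refine ContinuousOn.intervalIntegrable fun t ht => ContinuousAt.continuousWithinAt ?_
      rw [uIcc_of_le (by linarith)] at ht
      have h2 : ContinuousAt F (α + t * I) := by
        refine (h.differentiableAt _ fun h0 => ?_).continuousAt
        have := congrArg Complex.im h0
        simp at this
        linarith [ht.1]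
      exact (ContinuousAt.comp (f := fun t : ℝ => (α:ℂ) + t * I) h2 (by fun_prop)).norm.pow 2
    · exact Continuous.intervalIntegrable (by fun_prop) _ _
  have h2 : ∫ t in (1:ℝ)..T, 3 * (2 + ‖G t‖ ^ 2) =
      6 * (T - 1) + 3 * ∫ t in (1:ℝ)..T, ‖G t‖ ^ 2 := by
    rw [intervalIntegral.integral_const_mul, intervalIntegral.integral_add (by simp) (hGi _ _)]
    simp; ring
  have h3 : ∫ t in (1:ℝ)..T, ‖G t‖ ^ 2 ≤ ∫ t in (-T)..T, ‖G t‖ ^ 2 :=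
    intervalIntegral.integral_mono_interval (by linarith) (by linarith) le_rfl
      (ae_of_all _ fun t => by positivity) (hGi _ _)
  have h4 := hkey T hT
  nlinarith
end SecondMoment

section Sawtooth
open MeasureTheory Set Filter Topology

/-- The increment over a step `v` of the sawtooth function of period `m`. -/
noncomputable def sawDiff (v : ℝ) (m : ℕ) (x : ℝ) : ℝ := Int.fract ((x + v) / m) - Int.fract (x / m)

lemma measurable_sawDiff (v : ℝ) (m : ℕ) : Measurable (sawDiff v m) := by
  unfold sawDiff; fun_prop

lemma abs_sawDiff_le (v : ℝ) (m : ℕ) (x : ℝ) : |sawDiff v m x| ≤ 1 := by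
  have h1 := Int.fract_nonneg ((x + v) / m)
  have h2 := Int.fract_lt_one ((x + v) / m)
  have h3 := Int.fract_nonneg (x / m)
  have h4 := Int.fract_lt_one (x / m)
  rw [sawDiff, abs_le]; constructor <;> linarith

lemma periodic_sawDiff (v : ℝ) {m : ℕ} (hm : 1 ≤ m) : Function.Periodic (sawDiff v m) m := by
  intro x
  have hm0 : (m:ℝ) ≠ 0 := by positivity
  rw [sawDiff, sawDiff, show (x + m + v) / (m:ℝ) = (x + v) / m + 1 by field_simp; ring,
    show (x + m) / (m:ℝ) = x / m + 1 by field_simp, Int.fract_add_one, Int.fract_add_one]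

lemma fract_intCast_add_div (j : ℤ) {n : ℕ} (hn : 1 ≤ n) {θ : ℝ} (h0 : 0 ≤ θ) (h1 : θ < 1) :
    Int.fract (((j:ℝ) + θ) / n) = (((j % n : ℤ) : ℝ) + θ) / n := by
  have hn0 : (0:ℝ) < n := by positivity
  have hnz : (0:ℤ) < n := by exact_mod_cast hn
  rw [Int.fract_eq_iff]
  have h2 := Int.emod_nonneg j hnz.ne'
  have h3 := Int.emod_lt_of_pos j hnz
  have h2' : (0:ℝ) ≤ ((j % n : ℤ) : ℝ) := by exact_mod_cast h2
  have h3' : ((j % n : ℤ) : ℝ) + 1 ≤ n := by exact_mod_cast h3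
  refine ⟨by positivity, by rw [div_lt_one hn0]; linarith, j / n, ?_⟩
  have h4 : ((j:ℤ):ℝ) = ((n * (j / n) + j % n : ℤ) : ℝ) := by rw [Int.mul_ediv_add_emod]
  rw [h4]; push_cast; field_simp; ring

lemma sum_emod_range {n p : ℕ} (hn : 1 ≤ n) (hpn : p.Coprime n) (a : ℤ) :
    ∑ k ∈ Finset.range n, (((a + k * p) % n : ℤ) : ℝ) = n * (n - 1) / 2 := by
  have hnz : (0:ℤ) < n := by exact_mod_cast hn
  set g : ℕ → ℕ := fun k => ((a + k * p) % n : ℤ).toNat with hg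
  have hcast : ∀ k, ((g k : ℕ) : ℤ) = (a + k * p) % n := fun k =>
    Int.toNat_of_nonneg (Int.emod_nonneg _ hnz.ne')
  have hinj : Set.InjOn g (Finset.range n) := by
    intro k hk l hl hkl
    have h1 : (a + k * p) % (n:ℤ) = (a + l * p) % n := by rw [← hcast, ← hcast, hkl]
    have h2 : (k * p : ℤ) ≡ l * p [ZMOD n] := Int.ModEq.add_left_cancel' a h1
    have h3 : k * p ≡ l * p [MOD n] := by
      rw [← Int.natCast_modEq_iff]; exact_mod_cast h2
    have h4 := Nat.ModEq.cancel_right_of_coprime (by rwa [Nat.coprime_comm] at hpn) h3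
    exact Nat.ModEq.eq_of_lt_of_lt h4 (Finset.mem_range.1 hk) (Finset.mem_range.1 hl)
  have himg : (Finset.range n).image g = Finset.range n := by
    refine Finset.eq_of_subset_of_card_le ?_ (by rw [Finset.card_image_of_injOn hinj])
    intro j hj
    obtain ⟨k, _, rfl⟩ := Finset.mem_image.1 hj
    rw [Finset.mem_range]
    have := Int.emod_lt_of_pos (a + k * p) hnz
    rw [← hcast] at this
    exact_mod_cast this
  have h1 : ∑ k ∈ Finset.range n, (((a + k * p) % n : ℤ) : ℝ) = ∑ k ∈ Finset.range n, ((g k : ℕ) : ℝ) := by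
    refine Finset.sum_congr rfl fun k _ => ?_
    rw [← hcast]; simp
  rw [h1, ← Finset.sum_image (f := fun j : ℕ => (j:ℝ)) hinj, himg]
  have h2 := Finset.sum_range_id_mul_two n
  have h3 : ((∑ i ∈ Finset.range n, i : ℕ) : ℝ) * 2 = n * (n - 1) := by
    have := congrArg (Nat.cast (R := ℝ)) h2
    rw [Nat.cast_mul, Nat.cast_mul, Nat.cast_sub hn] at this
    simpa using this
  push_cast at h3
  linarith

lemma sum_fract_range {n p : ℕ} (hn : 1 ≤ n) (hpn : p.Coprime n) (y : ℝ) :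
    ∑ k ∈ Finset.range n, Int.fract ((y + k * p) / n) = Int.fract y + (n - 1) / 2 := by
  have hn0 : (0:ℝ) < n := by positivity
  have h1 : ∀ k : ℕ, Int.fract ((y + k * p) / n) =
      (((⌊y⌋ + k * p) % n : ℤ) : ℝ) / n + Int.fract y / n := by
    intro k
    rw [← add_div, ← fract_intCast_add_div _ hn (Int.fract_nonneg y) (Int.fract_lt_one y)]
    congr 2
    push_cast
    linarith [Int.floor_add_fract y]
  simp_rw [h1]
  rw [Finset.sum_add_distrib, ← Finset.sum_div, sum_emod_range hn hpn, Finset.sum_const,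
    Finset.card_range, nsmul_eq_mul]
  field_simp
  ring

lemma sum_sawDiff_range (v : ℝ) {g p n : ℕ} (hg : 1 ≤ g) (hn : 1 ≤ n) (hpn : p.Coprime n) (x : ℝ) :
    ∑ k ∈ Finset.range n, sawDiff v (g * n) (x + k * (g * p : ℕ)) = sawDiff v g x := by
  have hg0 : (0:ℝ) < g := by positivity
  have hn0 : (0:ℝ) < n := by positivity
  have h1 : ∀ k : ℕ, sawDiff v (g * n) (x + k * (g * p : ℕ)) =
      Int.fract (((x + v) / g + k * p) / n) - Int.fract ((x / g + k * p) / n) := by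
    intro k
    rw [sawDiff]
    congr 2 <;> (push_cast; field_simp; try ring)
  simp_rw [h1]
  rw [Finset.sum_sub_distrib, sum_fract_range hn hpn, sum_fract_range hn hpn, sawDiff]
  ring

lemma intervalIntegrable_of_bounded {φ : ℝ → ℝ} (hφ : Measurable φ) {B : ℝ} (hb : ∀ x, |φ x| ≤ B) (a b : ℝ) :
    IntervalIntegrable φ volume a b :=
  (intervalIntegrable_const (c := B)).mono_fun hφ.aestronglyMeasurable
    (ae_of_all _ fun x => by
      simpa [Real.norm_eq_abs] using (hb x).trans (le_abs_self B))

lemma abs_mul_sawDiff_le {F : ℝ → ℝ} (hb : ∀ x, |F x| ≤ 1) (v : ℝ) (m : ℕ) (x : ℝ) :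
    |F x * sawDiff v m x| ≤ 1 := by
  rw [abs_mul]
  exact mul_le_one₀ (hb x) (abs_nonneg _) (abs_sawDiff_le v m x)

lemma integral_mul_sawDiff (v : ℝ) {g p n : ℕ} (hg : 1 ≤ g) (hn : 1 ≤ n)
    (hpn : p.Coprime n) {F : ℝ → ℝ} (hF : Measurable F) (hb : ∀ x, |F x| ≤ 1)
    (hper : Function.Periodic F (g * p : ℕ)) :
    ∫ x in (0:ℝ)..(n * (g * p : ℕ)), F x * sawDiff v (g * n) x =
      ∫ x in (0:ℝ)..(g * p : ℕ), F x * sawDiff v g x := by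
  set P : ℝ := ((g * p : ℕ) : ℝ) with hP
  set H : ℝ → ℝ := fun x => F x * sawDiff v (g * n) x with hH
  have hHi : ∀ a b, IntervalIntegrable H volume a b := intervalIntegrable_of_bounded
    (hF.mul (measurable_sawDiff v _)) (abs_mul_sawDiff_le hb v _)
  have h1 := intervalIntegral.sum_integral_adjacent_intervals (f := H) (μ := volume)
    (a := fun k : ℕ => (k:ℝ) * P) (n := n) (fun k _ => hHi _ _)
  rw [Nat.cast_zero, zero_mul] at h1
  rw [← h1]
  have h2 : ∀ k : ℕ, ∫ x in ((k:ℝ) * P)..(((k + 1 : ℕ) : ℝ) * P), H x =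
      ∫ x in (0:ℝ)..P, F x * sawDiff v (g * n) (x + k * P) := by
    intro k
    have h3 := intervalIntegral.integral_comp_add_right (a := 0) (b := P) H (k * P)
    rw [show (0:ℝ) + k * P = k * P by ring, show P + k * P = ((k + 1 : ℕ) : ℝ) * P by push_cast; ring]
      at h3
    rw [← h3]
    refine intervalIntegral.integral_congr fun x _ => ?_
    simp only [hH]
    rw [hper.nat_mul k x]
  simp_rw [h2]
  rw [← intervalIntegral.integral_finsetSum]
  · refine intervalIntegral.integral_congr fun x _ => ?_
    rw [← Finset.mul_sum, sum_sawDiff_range v hg hn hpn]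
  · intro k _
    refine intervalIntegrable_of_bounded (B := 1) (hF.mul ((measurable_sawDiff v _).comp
      (measurable_id.add_const _))) (fun x => ?_) _ _
    rw [Pi.mul_apply, abs_mul]
    exact mul_le_one₀ (hb x) (abs_nonneg _) (abs_sawDiff_le v _ _)

lemma integral_sawDiff_eq_zero (v : ℝ) {g : ℕ} (hg : 1 ≤ g) :
    ∫ x in (0:ℝ)..g, sawDiff v g x = 0 := by
  have hg0 : (0:ℝ) < g := by positivity
  set ψ : ℝ → ℝ := fun x => Int.fract (x / g) with hψ
  have hm : Measurable ψ := by fun_prop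
  have hb : ∀ x, |ψ x| ≤ 1 := fun x => by
    rw [abs_of_nonneg (Int.fract_nonneg _)]; exact (Int.fract_lt_one _).le
  have hper : Function.Periodic ψ g := by
    intro x
    simp only [hψ]
    rw [show (x + g) / (g:ℝ) = x / g + 1 by field_simp, Int.fract_add_one]
  have h1 : ∀ x, sawDiff v g x = ψ (x + v) - ψ x := fun x => rfl
  simp_rw [h1]
  rw [intervalIntegral.integral_sub, intervalIntegral.integral_comp_add_right, zero_add, add_comm,
    hper.intervalIntegral_add_eq v 0, zero_add, sub_self]
  · exact intervalIntegrable_of_bounded (hm.comp (measurable_id.add_const _)) (fun x => hb _) _ _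
  · exact intervalIntegrable_of_bounded hm hb _ _

lemma integral_sawDiff_sq_le {v : ℝ} (hv : 0 ≤ v) {g : ℕ} (hg : 1 ≤ g) :
    ∫ x in (0:ℝ)..g, sawDiff v g x ^ 2 ≤ min v g := by
  have hg0 : (0:ℝ) < g := by positivity
  have hi : ∀ a b, IntervalIntegrable (fun x => sawDiff v g x ^ 2) volume a b :=
    intervalIntegrable_of_bounded ((measurable_sawDiff v g).pow_const 2) (B := 1) fun x => by
      rw [abs_pow]; exact pow_le_one₀ (abs_nonneg _) (abs_sawDiff_le v g x)
  have h1 : ∫ x in (0:ℝ)..g, sawDiff v g x ^ 2 ≤ g := by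
    have := intervalIntegral.integral_mono_on (a := 0) (b := (g:ℝ)) hg0.le (hi _ _)
      (intervalIntegrable_const (c := (1:ℝ))) (fun x _ => by
        rw [← sq_abs]; exact pow_le_one₀ (abs_nonneg _) (abs_sawDiff_le v g x))
    simpa using this
  rcases le_or_gt (g:ℝ) v with hvg | hvg
  · rwa [min_eq_right hvg]
  rw [min_eq_left hvg.le]
  have hw1 : v / g < 1 := (div_lt_one hg0).2 hvg
  have hw0 : 0 ≤ v / g := by positivity
  have h2 : ∀ x, sawDiff v g x ^ 2 = v / g - (v / g) ^ 2 - (1 - 2 * (v / g)) * sawDiff v g x := by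
    intro x
    set N : ℤ := ⌊(x + v) / g⌋ - ⌊x / g⌋ with hN
    have h3 : sawDiff v g x = v / g - N := by
      rw [sawDiff, Int.fract, Int.fract, hN, add_div]; push_cast; ring
    have h4 := abs_le.1 (abs_sawDiff_le v g x)
    have hlt : |sawDiff v g x| < 1 := by
      rw [sawDiff, abs_lt]
      constructor <;> linarith [Int.fract_nonneg ((x + v) / g), Int.fract_lt_one ((x + v) / g),
        Int.fract_nonneg (x / g), Int.fract_lt_one (x / g)]
    rw [h3, abs_lt] at hlt
    have h5 : (-1:ℝ) < N := by linarith
    have h6 : (N:ℝ) < 2 := by linarith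
    have h7 : N = 0 ∨ N = 1 := by
      have : (-1:ℤ) < N := by exact_mod_cast h5
      have : N < 2 := by exact_mod_cast h6
      omega
    rw [h3]
    rcases h7 with h7 | h7 <;> rw [h7] <;> push_cast <;> ring
  simp_rw [h2]
  rw [intervalIntegral.integral_sub (by simp), intervalIntegral.integral_const_mul,
    integral_sawDiff_eq_zero v hg]
  · simp only [intervalIntegral.integral_const, smul_eq_mul, mul_zero, sub_zero]
    have : (g:ℝ) * (v / g) = v := by field_simp
    nlinarith [mul_nonneg hg0.le (sq_nonneg (v / g))]
  · exact (intervalIntegrable_of_bounded (measurable_sawDiff v g) (abs_sawDiff_le v g) _ _).const_mul _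

/-- The correlation of two sawtooth increments over a common period. -/
theorem abs_integral_sawDiff_mul_le {v : ℝ} (hv : 0 ≤ v) {m n : ℕ} (hm : 1 ≤ m) (hn : 1 ≤ n) :
    |∫ x in (0:ℝ)..(m.lcm n : ℕ), sawDiff v m x * sawDiff v n x| ≤ min v (m.gcd n) := by
  obtain ⟨g, p, q, hg, hpq, rfl, rfl⟩ := Nat.exists_coprime' (Nat.gcd_pos_of_pos_left n hm)
  have hp : 1 ≤ p := Nat.pos_of_mul_pos_right hm
  have hq : 1 ≤ q := Nat.pos_of_mul_pos_right hn
  have hgcd : (p * g).gcd (q * g) = g := by rw [Nat.gcd_mul_right, hpq.gcd_eq_one, one_mul]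
  have hlcm : (p * g).lcm (q * g) = q * (g * p) := by
    rw [Nat.lcm_mul_right, hpq.lcm_eq_mul]; ring
  rw [hgcd, hlcm, mul_comm p g, mul_comm q g]
  have h1 := integral_mul_sawDiff v (g := g) (p := p) (n := q) hg hq hpq
    (measurable_sawDiff v (g * p)) (abs_sawDiff_le v _)
    (periodic_sawDiff v (Nat.mul_pos hg hp))
  have h2 := integral_mul_sawDiff v (g := g) (p := 1) (n := p) hg hp (Nat.coprime_one_left p)
    (measurable_sawDiff v g) (abs_sawDiff_le v _) (by simpa using periodic_sawDiff v hg)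
  push_cast at h1 h2 ⊢
  rw [h1]
  rw [mul_one, mul_comm (p:ℝ) g] at h2
  have h3 : ∀ x, sawDiff v (g * p) x * sawDiff v g x = sawDiff v g x * sawDiff v (g * p) x :=
    fun x => mul_comm _ _
  simp_rw [h3]
  rw [h2]
  simp_rw [← pow_two]
  rw [abs_of_nonneg (intervalIntegral.integral_nonneg (by positivity) fun x _ => sq_nonneg _)]
  exact integral_sawDiff_sq_le hv hg

lemma periodic_sawDiff_mul (v : ℝ) {m n : ℕ} (hm : 1 ≤ m) (hn : 1 ≤ n) :
    Function.Periodic (fun x => sawDiff v m x * sawDiff v n x) (m.lcm n : ℕ) := by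
  obtain ⟨k, hk⟩ := Nat.dvd_lcm_left m n
  obtain ⟨l, hl⟩ := Nat.dvd_lcm_right m n
  refine Function.Periodic.mul ?_ ?_
  · rw [hk, mul_comm, Nat.cast_mul]; exact (periodic_sawDiff v hm).nat_mul k
  · rw [hl, mul_comm, Nat.cast_mul]; exact (periodic_sawDiff v hn).nat_mul l

end Sawtooth

section PeriodicTail
open MeasureTheory Set Filter Topology

lemma abs_integral_period_mul_rpow_le {φ : ℝ → ℝ} (hφ : Measurable φ) (hb : ∀ x, |φ x| ≤ 2) {P : ℝ}
    (hP : 0 < P) (hper : Function.Periodic φ P) (h0 : ∫ x in (0:ℝ)..P, φ x = 0) {Y : ℝ}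
    (hY : 0 < Y) :
    |∫ x in Y..(Y + P), φ x * x ^ (-3:ℝ)| ≤ 2 * P * (Y ^ (-3:ℝ) - (Y + P) ^ (-3:ℝ)) := by
  have hφi : ∀ a b, IntervalIntegrable φ volume a b := intervalIntegrable_of_bounded hφ hb
  have hY0 : ∫ x in Y..(Y + P), φ x = 0 := by
    rw [hper.intervalIntegral_add_eq Y 0, zero_add, h0]
  have hcont : ContinuousOn (fun x : ℝ => x ^ (-3:ℝ)) (uIcc Y (Y + P)) := by
    intro x hx
    rw [uIcc_of_le (by linarith)] at hx
    exact (Real.continuousAt_rpow_const _ _ (Or.inl (by linarith [hx.1]))).continuousWithinAt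
  have h1 : ∫ x in Y..(Y + P), φ x * x ^ (-3:ℝ) =
      ∫ x in Y..(Y + P), φ x * (x ^ (-3:ℝ) - Y ^ (-3:ℝ)) := by
    simp_rw [mul_sub]
    rw [intervalIntegral.integral_sub ((hφi _ _).mul_continuousOn hcont) ((hφi _ _).mul_const _),
      intervalIntegral.integral_mul_const, hY0, zero_mul, sub_zero]
  rw [h1, ← Real.norm_eq_abs]
  have h2 := intervalIntegral.norm_integral_le_of_norm_le_const (a := Y) (b := Y + P)
    (f := fun x => φ x * (x ^ (-3:ℝ) - Y ^ (-3:ℝ)))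
    (C := 2 * (Y ^ (-3:ℝ) - (Y + P) ^ (-3:ℝ))) (by
      intro x hx
      rw [uIoc_of_le (by linarith)] at hx
      rw [norm_mul, Real.norm_eq_abs, Real.norm_eq_abs]
      have h3 : x ^ (-3:ℝ) ≤ Y ^ (-3:ℝ) := Real.rpow_le_rpow_of_nonpos hY hx.1.le (by norm_num)
      have h4 : (Y + P) ^ (-3:ℝ) ≤ x ^ (-3:ℝ) :=
        Real.rpow_le_rpow_of_nonpos (hY.trans hx.1) hx.2 (by norm_num)
      rw [abs_of_nonpos (sub_nonpos.2 h3)]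
      exact mul_le_mul (hb x) (by linarith) (by linarith) (by norm_num))
  refine h2.trans (le_of_eq ?_)
  rw [add_sub_cancel_left, abs_of_pos hP]; ring

lemma abs_integral_periods_mul_rpow_le {φ : ℝ → ℝ} (hφ : Measurable φ) (hb : ∀ x, |φ x| ≤ 2)
    {P : ℝ} (hP : 0 < P) (hper : Function.Periodic φ P) (h0 : ∫ x in (0:ℝ)..P, φ x = 0) {X : ℝ}
    (hX : 0 < X) (n : ℕ) :
    |∫ x in X..(X + n * P), φ x * x ^ (-3:ℝ)| ≤
      2 * P * (X ^ (-3:ℝ) - (X + n * P) ^ (-3:ℝ)) := by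
  have hi : ∀ a b, X ≤ a → X ≤ b → IntervalIntegrable (fun x => φ x * x ^ (-3:ℝ)) volume a b := by
    intro a b ha hb'
    refine (intervalIntegrable_of_bounded hφ hb a b).mul_continuousOn fun x hx => ?_
    have : X ≤ x := (le_min ha hb').trans hx.1
    exact (Real.continuousAt_rpow_const _ _ (Or.inl (by linarith))).continuousWithinAt
  induction n with
  | zero => simp
  | succ n ih =>
    have hn : 0 ≤ n * P := by positivity
    have h1 := abs_integral_period_mul_rpow_le hφ hb hP hper h0 (Y := X + n * P) (by linarith)
    have h2 : X + ((n + 1 : ℕ) : ℝ) * P = X + n * P + P := by push_cast; ring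
    rw [h2, ← intervalIntegral.integral_add_adjacent_intervals (b := X + n * P)
      (hi _ _ le_rfl (by linarith)) (hi _ _ (by linarith) (by linarith))]
    refine (abs_add_le _ _).trans ?_
    linarith

lemma integrableOn_mul_rpow_Ioi {φ : ℝ → ℝ} (hφ : Measurable φ) {B : ℝ} (hb : ∀ x, |φ x| ≤ B) {X : ℝ}
    (hX : 0 < X) : IntegrableOn (fun x => φ x * x ^ (-3:ℝ)) (Ioi X) :=
  (integrableOn_Ioi_rpow_of_lt (by norm_num) hX).bdd_mul hφ.aestronglyMeasurable
    (ae_of_all _ fun x => by simpa [Real.norm_eq_abs] using hb x)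

/-- The tail integral of a bounded periodic function against `x⁻³`. -/
theorem abs_integral_Ioi_periodic_le {φ : ℝ → ℝ} (hφ : Measurable φ) (hb : ∀ x, |φ x| ≤ 1) {P : ℝ}
    (hP : 0 < P) (hper : Function.Periodic φ P) {X : ℝ} (hX : 0 < X) :
    |∫ x in Ioi X, φ x * x ^ (-3:ℝ)| ≤
      |∫ x in (0:ℝ)..P, φ x| / P * X ^ (-2:ℝ) + 2 * P * X ^ (-3:ℝ) := by
  set μ : ℝ := (∫ x in (0:ℝ)..P, φ x) / P with hμ
  have hφi : ∀ a b, IntervalIntegrable φ volume a b := intervalIntegrable_of_bounded hφ hb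
  have hμ1 : |μ| ≤ 1 := by
    rw [hμ, abs_div, abs_of_pos hP, div_le_one hP]
    have := intervalIntegral.norm_integral_le_of_norm_le_const (a := 0) (b := P) (f := φ) (C := 1)
      (fun x _ => by simpa [Real.norm_eq_abs] using hb x)
    simpa [abs_of_pos hP] using this
  set φ₀ : ℝ → ℝ := fun x => φ x - μ with hφ₀
  have hm : Measurable φ₀ := hφ.sub_const _
  have hb₀ : ∀ x, |φ₀ x| ≤ 2 := fun x => (abs_sub _ _).trans (by linarith [hb x])
  have hper₀ : Function.Periodic φ₀ P := fun x => by simp only [hφ₀]; rw [hper x]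
  have h0 : ∫ x in (0:ℝ)..P, φ₀ x = 0 := by
    simp only [hφ₀]
    rw [intervalIntegral.integral_sub (hφi _ _) (by simp)]
    simp [hμ]; field_simp; simp
  have hlim : Tendsto (fun n : ℕ => ∫ x in X..(X + n * P), φ₀ x * x ^ (-3:ℝ)) atTop
      (𝓝 (∫ x in Ioi X, φ₀ x * x ^ (-3:ℝ))) :=
    intervalIntegral_tendsto_integral_Ioi X (integrableOn_mul_rpow_Ioi hm hb₀ hX)
      (tendsto_atTop_add_const_left _ _ (tendsto_natCast_atTop_atTop.atTop_mul_const hP))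
  have h1 : |∫ x in Ioi X, φ₀ x * x ^ (-3:ℝ)| ≤ 2 * P * X ^ (-3:ℝ) := by
    refine le_of_tendsto hlim.abs (Eventually.of_forall fun n => ?_)
    refine (abs_integral_periods_mul_rpow_le hm hb₀ hP hper₀ h0 hX n).trans ?_
    have : 0 ≤ (X + n * P) ^ (-3:ℝ) := by positivity
    refine mul_le_mul_of_nonneg_left (by linarith) (by positivity)
  have h2 : ∫ x in Ioi X, φ x * x ^ (-3:ℝ) =
      (∫ x in Ioi X, φ₀ x * x ^ (-3:ℝ)) + μ * (X ^ (-2:ℝ) / 2) := by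
    have h3 : ∫ x in Ioi X, μ * x ^ (-3:ℝ) = μ * (X ^ (-2:ℝ) / 2) := by
      rw [integral_const_mul, integral_Ioi_rpow_of_lt (by norm_num) hX]
      norm_num
    rw [← h3, ← integral_add (integrableOn_mul_rpow_Ioi hm hb₀ hX)
      ((integrableOn_Ioi_rpow_of_lt (by norm_num) hX).const_mul μ)]
    refine setIntegral_congr_fun measurableSet_Ioi fun x _ => ?_
    simp only [hφ₀]; ring
  rw [h2]
  refine (abs_add_le _ _).trans ?_
  have h4 : |μ * (X ^ (-2:ℝ) / 2)| ≤ |∫ x in (0:ℝ)..P, φ x| / P * X ^ (-2:ℝ) := by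
    have hX2 : 0 ≤ X ^ (-2:ℝ) := by positivity
    rw [abs_mul, hμ, abs_div, abs_of_pos hP, abs_of_nonneg (by positivity : 0 ≤ X ^ (-2:ℝ) / 2)]
    refine mul_le_mul_of_nonneg_left (by linarith) (by positivity)
  linarith

/-- A weighted sum over pairs controlling mollified second moments. -/
noncomputable def gcdWeight (S : Finset ℕ) (b : ℕ → ℂ) : ℝ :=
  ∑ m ∈ S, ∑ n ∈ S, ‖b m‖ * ‖b n‖ / (m.lcm n : ℕ)

lemma gcdWeight_nonneg (S : Finset ℕ) (b : ℕ → ℂ) : 0 ≤ gcdWeight S b := by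
  unfold gcdWeight; positivity

lemma norm_sum_mul_sq_le (S : Finset ℕ) (b : ℕ → ℂ) (δ : ℕ → ℝ) :
    ‖∑ m ∈ S, b m * (δ m : ℂ)‖ ^ 2 =
      ∑ m ∈ S, ∑ n ∈ S, (b m * (starRingEnd ℂ) (b n)).re * (δ m * δ n) := by
  rw [← Complex.normSq_eq_norm_sq, ← Complex.ofReal_inj, ← Complex.mul_conj, map_sum,
    Finset.sum_mul_sum]
  have h1 : (∑ m ∈ S, ∑ n ∈ S, b m * (δ m : ℂ) * (starRingEnd ℂ) (b n * (δ n : ℂ))) =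
      ∑ m ∈ S, ∑ n ∈ S, (b m * (starRingEnd ℂ) (b n)) * ((δ m * δ n : ℝ) : ℂ) := by
    refine Finset.sum_congr rfl fun m _ => Finset.sum_congr rfl fun n _ => ?_
    rw [map_mul, Complex.conj_ofReal]; push_cast; ring
  have h2 : (((∑ m ∈ S, b m * (δ m : ℂ)) * (starRingEnd ℂ) (∑ m ∈ S, b m * (δ m : ℂ))).re : ℂ) =
      (∑ m ∈ S, b m * (δ m : ℂ)) * (starRingEnd ℂ) (∑ m ∈ S, b m * (δ m : ℂ)) := by
    rw [Complex.mul_conj]; simp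
  rw [map_sum, Finset.sum_mul_sum, h1] at h2
  rw [h1, ← h2]
  simp [Complex.re_sum]

/-- The mean square of a combination of sawtooth increments on a tail. -/
theorem integral_norm_sq_sawDiff_le (S : Finset ℕ) (hS : ∀ m ∈ S, 1 ≤ m) (b : ℕ → ℂ) {v X : ℝ}
    (hv : 0 ≤ v) (hX : 0 < X) :
    ∫ x in Ioi X, ‖∑ m ∈ S, b m * (sawDiff v m x : ℂ)‖ ^ 2 * x ^ (-3:ℝ) ≤
      ∑ m ∈ S, ∑ n ∈ S, ‖b m‖ * ‖b n‖ *
        (min v (m.gcd n) / (m.lcm n : ℕ) * X ^ (-2:ℝ) + 2 * (m.lcm n : ℕ) * X ^ (-3:ℝ)) := by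
  have hInt : ∀ m n : ℕ, IntegrableOn (fun x => (b m * (starRingEnd ℂ) (b n)).re *
      ((sawDiff v m x * sawDiff v n x) * x ^ (-3:ℝ))) (Ioi X) := fun m n =>
    (integrableOn_mul_rpow_Ioi ((measurable_sawDiff v m).mul (measurable_sawDiff v n))
      (abs_mul_sawDiff_le (abs_sawDiff_le v m) v n) hX).const_mul _
  have h1 : ∀ x : ℝ, ‖∑ m ∈ S, b m * (sawDiff v m x : ℂ)‖ ^ 2 * x ^ (-3:ℝ) =
      ∑ m ∈ S, ∑ n ∈ S, (b m * (starRingEnd ℂ) (b n)).re *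
        ((sawDiff v m x * sawDiff v n x) * x ^ (-3:ℝ)) := by
    intro x
    rw [norm_sum_mul_sq_le, Finset.sum_mul]
    refine Finset.sum_congr rfl fun m _ => ?_
    rw [Finset.sum_mul]
    exact Finset.sum_congr rfl fun n _ => by ring
  simp_rw [h1]
  rw [integral_finsetSum _ fun m _ => integrable_finsetSum _ fun n _ => hInt m n]
  refine Finset.sum_le_sum fun m hm => ?_
  rw [integral_finsetSum _ fun n _ => hInt m n]
  refine Finset.sum_le_sum fun n hn => ?_
  rw [integral_const_mul]
  have hL : 0 < ((m.lcm n : ℕ) : ℝ) := by exact_mod_cast Nat.lcm_pos (hS m hm) (hS n hn)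
  have h2 := abs_integral_Ioi_periodic_le (φ := fun x => sawDiff v m x * sawDiff v n x)
    ((measurable_sawDiff v m).mul (measurable_sawDiff v n))
    (abs_mul_sawDiff_le (abs_sawDiff_le v m) v n) hL
    (periodic_sawDiff_mul v (hS m hm) (hS n hn)) hX
  have h3 := abs_integral_sawDiff_mul_le hv (hS m hm) (hS n hn)
  refine (le_abs_self _).trans ?_
  rw [abs_mul]
  refine mul_le_mul ?_ (h2.trans ?_) (abs_nonneg _) (by positivity)
  · refine (Complex.abs_re_le_norm _).trans ?_
    rw [norm_mul, RCLike.norm_conj]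
  · gcongr

end PeriodicTail

section FractionalPart
open MeasureTheory Set Filter Topology

lemma integrableOn_fract_Ioc {s : ℂ} (h1 : s.re < 1) :
    IntegrableOn (fun x : ℝ => ((Int.fract x : ℝ) : ℂ) * (x:ℂ) ^ (-s - 1)) (Ioc 0 1) ∧
    ∫ x in Ioc (0:ℝ) 1, ((Int.fract x : ℝ) : ℂ) * (x:ℂ) ^ (-s - 1) = 1 / (1 - s) := by
  have hae : ∀ᵐ x : ℝ ∂(volume.restrict (Ioc 0 1)),
      (x:ℂ) ^ (-s) = ((Int.fract x : ℝ) : ℂ) * (x:ℂ) ^ (-s - 1) := by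
    rw [← restrict_Ioo_eq_restrict_Ioc, ae_restrict_iff' measurableSet_Ioo]
    refine ae_of_all _ fun x hx => ?_
    have hx0 : (x:ℂ) ≠ 0 := by exact_mod_cast hx.1.ne'
    rw [Int.fract_eq_self.2 ⟨hx.1.le, hx.2⟩, cpow_sub _ _ hx0, cpow_one]
    field_simp
  have hi : IntegrableOn (fun x : ℝ => (x:ℂ) ^ (-s)) (Ioc 0 1) := by
    have := intervalIntegral.intervalIntegrable_cpow' (a := 0) (b := 1) (r := -s)
      (by simpa using h1)
    rwa [intervalIntegrable_iff_integrableOn_Ioc_of_le zero_le_one] at this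
  refine ⟨hi.congr_fun_ae hae, ?_⟩
  rw [← integral_congr_ae hae, ← intervalIntegral.integral_of_le zero_le_one,
    integral_cpow (Or.inl (by simpa using h1))]
  have : -s + 1 ≠ 0 := fun h => by
    have := congrArg Complex.re h
    simp at this; linarith
  simp [Complex.zero_cpow this]
  ring

lemma integrableOn_fract_mul_cpow {s : ℂ} (h0 : 0 < s.re) (h1 : s.re < 1) :
    IntegrableOn (fun x : ℝ => ((Int.fract x : ℝ) : ℂ) * (x:ℂ) ^ (-s - 1)) (Ioi 0) := by
  rw [← Ioc_union_Ioi_eq_Ioi (zero_le_one (α := ℝ))]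
  refine (integrableOn_fract_Ioc h1).1.union (integrableOn_mul_cpow (by fun_prop) zero_lt_one
    (fun x _ => ?_) h0)
  rw [Complex.norm_real, Real.norm_eq_abs, abs_of_nonneg (Int.fract_nonneg x)]
  exact (Int.fract_lt_one x).le

/-- The Mellin transform of the fractional part. -/
theorem mul_integral_fract_mul_cpow {s : ℂ} (h0 : 0 < s.re) (h1 : s.re < 1) (him : 0 < s.im) :
    s * ∫ x in Ioi (0:ℝ), ((Int.fract x : ℝ) : ℂ) * (x:ℂ) ^ (-s - 1) = -riemannZeta s := by
  have hi := integrableOn_fract_mul_cpow h0 h1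
  rw [← Ioc_union_Ioi_eq_Ioi (zero_le_one (α := ℝ))] at hi ⊢
  rw [setIntegral_union (Ioc_disjoint_Ioi le_rfl) measurableSet_Ioi hi.left_of_union
    hi.right_of_union, (integrableOn_fract_Ioc h1).2]
  have h := charSeries_riemannZeta.eq_sum_add (N := 1) le_rfl h0 him
  have h2 : ∫ x in Ioi ((1:ℕ):ℝ), sumRemainder (fun _ => 1) 1 1 x * (x:ℂ) ^ (-s - 1) =
      -∫ x in Ioi (1:ℝ), ((Int.fract x : ℝ) : ℂ) * (x:ℂ) ^ (-s - 1) := by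
    rw [← integral_neg, Nat.cast_one]
    refine setIntegral_congr_fun measurableSet_Ioi fun x hx => ?_
    have hx1 : (1:ℝ) < x := hx
    have hfl : 1 ≤ ⌊x⌋₊ := Nat.le_floor (by simpa using hx1.le)
    have hfr : (Int.fract x : ℝ) = x - ⌊x⌋₊ := by
      rw [Int.fract, natCast_floor_eq_intCast_floor (by linarith)]
    simp only [sumRemainder, Finset.sum_const, Nat.card_Ioc, nsmul_eq_mul, hfr]
    push_cast [Nat.cast_sub hfl]
    ring
  rw [h2] at h
  rw [h]
  have hs1 : s - 1 ≠ 0 := fun h => by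
    have := congrArg Complex.im h
    simp at this; linarith
  have hs2 : 1 - s ≠ 0 := fun h => hs1 (by linear_combination -h)
  simp only [Finset.Icc_self, Finset.sum_singleton, Nat.cast_one, Complex.one_cpow]
  have : 1 / (1 - s) = -(1 / (s - 1)) := by
    rw [← neg_sub s 1, one_div, one_div, neg_inv, ]
  rw [this]
  field_simp
  ring

/-- The combination `-∑ b_m {x/m}`, whose Mellin transform is `ζ(s) ∑ b_m m^{-s} / s`. -/
noncomputable def fractSum (S : Finset ℕ) (b : ℕ → ℂ) (x : ℝ) : ℂ :=
  -∑ m ∈ S, b m * ((Int.fract (x / m) : ℝ) : ℂ)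

lemma measurable_fractSum (S : Finset ℕ) (b : ℕ → ℂ) : Measurable (fractSum S b) := by
  unfold fractSum; fun_prop

lemma fract_div_mul_cpow {m : ℕ} (hm : 1 ≤ m) (s : ℂ) {x : ℝ} (hx : 0 < x) :
    ((Int.fract (x / m) : ℝ) : ℂ) * (x:ℂ) ^ (-s - 1) = (m:ℂ) ^ (-s - 1) *
      (((Int.fract ((m:ℝ)⁻¹ * x) : ℝ) : ℂ) * (((m:ℝ)⁻¹ * x : ℝ) : ℂ) ^ (-s - 1)) := by
  have hm0 : (0:ℝ) < m := by positivity
  have h : (m:ℂ) ^ (-s - 1) * (((m:ℝ)⁻¹ * x : ℝ) : ℂ) ^ (-s - 1) = (x:ℂ) ^ (-s - 1) := by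
    rw [← Complex.ofReal_natCast, ← Complex.mul_cpow_ofReal_nonneg hm0.le (by positivity),
      ← Complex.ofReal_mul]
    congr 2; field_simp
  rw [← h, inv_mul_eq_div]; ring

lemma integrableOn_fract_div_mul_cpow {m : ℕ} (hm : 1 ≤ m) {s : ℂ} (h0 : 0 < s.re)
    (h1 : s.re < 1) :
    IntegrableOn (fun x : ℝ => ((Int.fract (x / m) : ℝ) : ℂ) * (x:ℂ) ^ (-s - 1)) (Ioi 0) := by
  have hm0 : (0:ℝ) < (m:ℝ)⁻¹ := by positivity
  have h := (integrableOn_Ioi_comp_mul_left_iff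
    (fun x : ℝ => ((Int.fract x : ℝ) : ℂ) * (x:ℂ) ^ (-s - 1)) 0 hm0).2
    (by simpa using integrableOn_fract_mul_cpow h0 h1)
  exact IntegrableOn.congr_fun (h.const_mul ((m:ℂ) ^ (-s - 1)))
    (fun x hx => (fract_div_mul_cpow hm s hx).symm) measurableSet_Ioi

lemma integral_fract_div_mul_cpow {m : ℕ} (hm : 1 ≤ m) (s : ℂ) :
    ∫ x in Ioi (0:ℝ), ((Int.fract (x / m) : ℝ) : ℂ) * (x:ℂ) ^ (-s - 1) = (m:ℂ) ^ (-s) *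
      ∫ x in Ioi (0:ℝ), ((Int.fract x : ℝ) : ℂ) * (x:ℂ) ^ (-s - 1) := by
  have hm0 : (0:ℝ) < (m:ℝ)⁻¹ := by positivity
  have hmc : (m:ℂ) ≠ 0 := by exact_mod_cast (by omega : m ≠ 0)
  rw [setIntegral_congr_fun measurableSet_Ioi fun x hx => fract_div_mul_cpow hm s hx,
    integral_const_mul, integral_comp_mul_left_Ioi
      (fun x : ℝ => ((Int.fract x : ℝ) : ℂ) * (x:ℂ) ^ (-s - 1)) 0 hm0, mul_zero, inv_inv,
    Complex.real_smul, Complex.ofReal_natCast, ← mul_assoc, cpow_sub _ _ hmc, cpow_one]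
  field_simp

lemma integrableOn_fractSum_mul_cpow {S : Finset ℕ} (hS : ∀ m ∈ S, 1 ≤ m) (b : ℕ → ℂ) {s : ℂ}
    (h0 : 0 < s.re) (h1 : s.re < 1) :
    IntegrableOn (fun x : ℝ => fractSum S b x * (x:ℂ) ^ (-s - 1)) (Ioi 0) := by
  have : (fun x : ℝ => fractSum S b x * (x:ℂ) ^ (-s - 1)) = fun x : ℝ =>
      -∑ m ∈ S, b m * (((Int.fract (x / m) : ℝ) : ℂ) * (x:ℂ) ^ (-s - 1)) := by
    ext x
    simp only [fractSum, neg_mul, Finset.sum_mul, mul_assoc]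
  rw [this]
  exact (integrable_finsetSum _ fun m hm =>
    (integrableOn_fract_div_mul_cpow (hS m hm) h0 h1).const_mul _).neg

theorem mul_integral_fractSum_mul_cpow {S : Finset ℕ} (hS : ∀ m ∈ S, 1 ≤ m) (b : ℕ → ℂ) {s : ℂ}
    (h0 : 0 < s.re) (h1 : s.re < 1) (him : 0 < s.im) :
    s * ∫ x in Ioi (0:ℝ), fractSum S b x * (x:ℂ) ^ (-s - 1) =
      riemannZeta s * ∑ m ∈ S, b m * (m:ℂ) ^ (-s) := by
  have : (fun x : ℝ => fractSum S b x * (x:ℂ) ^ (-s - 1)) = fun x : ℝ =>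
      -∑ m ∈ S, b m * (((Int.fract (x / m) : ℝ) : ℂ) * (x:ℂ) ^ (-s - 1)) := by
    ext x
    simp only [fractSum, neg_mul, Finset.sum_mul, mul_assoc]
  rw [this, integral_neg, integral_finsetSum _ fun m hm =>
    (integrableOn_fract_div_mul_cpow (hS m hm) h0 h1).const_mul _]
  have h := mul_integral_fract_mul_cpow h0 h1 him
  rw [← neg_eq_iff_eq_neg] at h
  rw [← h, Finset.mul_sum, mul_neg, Finset.mul_sum, ← Finset.sum_neg_distrib]
  refine Finset.sum_congr rfl fun m hm => ?_
  rw [integral_const_mul, integral_fract_div_mul_cpow (hS m hm)]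
  ring

end FractionalPart

section TwistedSmall
open MeasureTheory Set Filter Topology

lemma fractSum_eq_partialSum_sub {S : Finset ℕ} (hS : ∀ m ∈ S, 1 ≤ m) (b : ℕ → ℂ) {K : ℕ} {x : ℝ}
    (hx : 0 ≤ x) (hK : x ≤ K) :
    fractSum S b x = partialSum (Finset.Icc 1 K) (fun n => ∑ m ∈ S, if m ∣ n then b m else 0) x -
      x * ∑ m ∈ S, b m / m := by
  have h1 : ∀ m ∈ S, ((Int.fract (x / m) : ℝ) : ℂ) = x / m -
      ∑ n ∈ Finset.Icc 1 K, if (n:ℝ) ≤ x then (if m ∣ n then 1 else 0) else 0 := by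
    intro m hm
    have hm0 : (0:ℝ) < m := by exact_mod_cast hS m hm
    have h2 : ((Finset.Icc 1 K).filter (fun n : ℕ => (n:ℝ) ≤ x)).filter (fun n => m ∣ n) =
        (Finset.Ioc 0 ⌊x⌋₊).filter (fun n => m ∣ n) := by
      congr 1
      ext n
      simp only [Finset.mem_filter, Finset.mem_Icc, Finset.mem_Ioc, Nat.le_floor_iff hx]
      constructor
      · rintro ⟨⟨h3, _⟩, h4⟩; exact ⟨h3, h4⟩
      · rintro ⟨h3, h4⟩; exact ⟨⟨h3, by exact_mod_cast h4.trans hK⟩, h4⟩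
    rw [← Finset.sum_filter, ← Finset.sum_filter, h2, Finset.sum_const,
      Nat.Ioc_filter_dvd_card_eq_div, ← Nat.floor_div_natCast, Int.fract,
      ← natCast_floor_eq_intCast_floor (by positivity)]
    push_cast
    simp
  rw [fractSum, Finset.sum_congr rfl fun m hm => by rw [h1 m hm], partialSum]
  simp only [mul_sub, Finset.sum_sub_distrib, Finset.mul_sum]
  rw [Finset.sum_comm (s := S)]
  have h3 : ∀ n : ℕ, (∑ m ∈ S, b m * if (n:ℝ) ≤ x then (if m ∣ n then 1 else 0) else 0) =
      if (n:ℝ) ≤ x then ∑ m ∈ S, (if m ∣ n then b m else 0) else 0 := by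
    intro n
    split_ifs with h
    · exact Finset.sum_congr rfl fun m _ => by split_ifs <;> simp
    · simp
  simp only [h3]
  rw [neg_sub]
  congr 1
  exact Finset.sum_congr rfl fun m _ => by ring

lemma sum_Icc_dvd_inv_le {K l : ℕ} (hl : 1 ≤ l) :
    ∑ n ∈ (Finset.Icc 1 K).filter (fun n => l ∣ n), (n:ℝ)⁻¹ ≤ (1 + Real.log K) / l := by
  have h1 : ∑ n ∈ (Finset.Icc 1 K).filter (fun n => l ∣ n), (n:ℝ)⁻¹ ≤
      ∑ n ∈ (Finset.Icc 1 K).image (fun k => l * k), (n:ℝ)⁻¹ := by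
    refine Finset.sum_le_sum_of_subset_of_nonneg ?_ fun _ _ _ => by positivity
    intro n hn
    obtain ⟨h2, k, rfl⟩ := Finset.mem_filter.1 hn
    rw [Finset.mem_Icc] at h2
    refine Finset.mem_image.2 ⟨k, Finset.mem_Icc.2 ⟨?_, ?_⟩, rfl⟩
    · exact Nat.pos_of_mul_pos_left h2.1
    · exact (Nat.le_mul_of_pos_left k hl).trans h2.2
  rw [Finset.sum_image fun a _ b _ h => Nat.eq_of_mul_eq_mul_left hl h] at h1
  refine h1.trans ?_
  push_cast
  simp_rw [mul_inv]
  rw [← Finset.mul_sum, div_eq_inv_mul]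
  exact mul_le_mul_of_nonneg_left (sum_Icc_inv_le K) (by positivity)

lemma sum_norm_sq_divisorSum_le {S : Finset ℕ} (hS : ∀ m ∈ S, 1 ≤ m) (b : ℕ → ℂ) (K : ℕ) :
    ∑ n ∈ Finset.Icc 1 K, ‖∑ m ∈ S, if m ∣ n then b m else 0‖ ^ 2 * (n:ℝ)⁻¹ ≤
      gcdWeight S b * (1 + Real.log K) := by
  have h1 : ∀ n : ℕ, ‖∑ m ∈ S, if m ∣ n then b m else 0‖ ^ 2 ≤
      ∑ m ∈ S, ∑ k ∈ S, if m.lcm k ∣ n then ‖b m‖ * ‖b k‖ else 0 := by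
    intro n
    calc ‖∑ m ∈ S, if m ∣ n then b m else 0‖ ^ 2 ≤
        (∑ m ∈ S, if m ∣ n then ‖b m‖ else 0) ^ 2 := by
          gcongr
          refine (norm_sum_le _ _).trans (Finset.sum_le_sum fun m _ => ?_)
          split_ifs <;> simp
      _ = _ := by
          rw [sq, Finset.sum_mul_sum]
          refine Finset.sum_congr rfl fun m _ => Finset.sum_congr rfl fun k _ => ?_
          simp only [Nat.lcm_dvd_iff]
          split_ifs <;> simp_all
  calc _ ≤ ∑ n ∈ Finset.Icc 1 K, (∑ m ∈ S, ∑ k ∈ S,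
        if m.lcm k ∣ n then ‖b m‖ * ‖b k‖ else 0) * (n:ℝ)⁻¹ := by
        gcongr with n _; exact h1 n
    _ = ∑ m ∈ S, ∑ k ∈ S, ‖b m‖ * ‖b k‖ *
        ∑ n ∈ (Finset.Icc 1 K).filter (fun n => m.lcm k ∣ n), (n:ℝ)⁻¹ := by
        simp_rw [Finset.sum_mul]
        rw [Finset.sum_comm]
        refine Finset.sum_congr rfl fun m _ => ?_
        rw [Finset.sum_comm]
        refine Finset.sum_congr rfl fun k _ => ?_
        rw [Finset.mul_sum, Finset.sum_filter]
        refine Finset.sum_congr rfl fun n _ => ?_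
        split_ifs <;> simp
    _ ≤ ∑ m ∈ S, ∑ k ∈ S, ‖b m‖ * ‖b k‖ * ((1 + Real.log K) / (m.lcm k : ℕ)) := by
        gcongr with m hm k hk
        exact sum_Icc_dvd_inv_le (Nat.lcm_pos (hS m hm) (hS k hk))
    _ = _ := by
        rw [gcdWeight, Finset.sum_mul]
        refine Finset.sum_congr rfl fun m _ => ?_
        rw [Finset.sum_mul]
        exact Finset.sum_congr rfl fun k _ => by ring

lemma norm_sum_div_sq_le {S : Finset ℕ} (hS : ∀ m ∈ S, 1 ≤ m) (b : ℕ → ℂ) :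
    ‖∑ m ∈ S, b m / m‖ ^ 2 ≤ gcdWeight S b := by
  calc ‖∑ m ∈ S, b m / m‖ ^ 2 ≤ (∑ m ∈ S, ‖b m‖ / m) ^ 2 := by
        gcongr
        refine (norm_sum_le _ _).trans (Finset.sum_le_sum fun m _ => ?_)
        simp
    _ = ∑ m ∈ S, ∑ k ∈ S, ‖b m‖ * ‖b k‖ / (m * k) := by
        rw [sq, Finset.sum_mul_sum]
        exact Finset.sum_congr rfl fun m _ => Finset.sum_congr rfl fun k _ => by ring
    _ ≤ _ := by
        rw [gcdWeight]
        gcongr with m hm k hk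
        · exact_mod_cast Nat.lcm_pos (hS m hm) (hS k hk)
        · exact_mod_cast Nat.le_of_dvd (Nat.mul_pos (hS m hm) (hS k hk)) (Nat.lcm_dvd_mul m k)

lemma lintegral_fractSum_small_le {S : Finset ℕ} (hS : ∀ m ∈ S, 1 ≤ m) (b : ℕ → ℂ) {T h : ℝ}
    (hT : 2 ≤ T) (h0 : 0 ≤ h) (hT1 : h * T ≤ 1 / 2) :
    ∫⁻ x in Ioc 0 T, ‖fractSum S b (x * Real.exp h) - fractSum S b x‖ₑ ^ 2 *
        ENNReal.ofReal (x ^ (-2 * (1 / 2) - 1 : ℝ)) ≤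
      ENNReal.ofReal (h * (400 * Real.log T * gcdWeight S b)) := by
  set K : ℕ := ⌈2 * T⌉₊
  have hK : 2 * T ≤ K := Nat.le_ceil _
  have hK' : (K:ℝ) ≤ 3 * T := by
    have := Nat.ceil_lt_add_one (a := 2 * T) (by linarith); linarith
  have hh : h ≤ 1 / 4 := by nlinarith
  set W := gcdWeight S b
  have hW : 0 ≤ W := gcdWeight_nonneg S b
  set c : ℕ → ℂ := fun n => ∑ m ∈ S, if m ∣ n then b m else 0
  set B : ℂ := ∑ m ∈ S, b m / m
  have hB : ‖B‖ ^ 2 ≤ W := norm_sum_div_sq_le hS b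
  have he := exp_sub_one_le h0 (by linarith)
  have he1 := Real.one_le_exp h0
  have hlog : 1 / 2 ≤ Real.log T := by
    have := Real.log_two_gt_d9
    have := Real.log_le_log (by norm_num) hT
    linarith
  have hpt : ∀ x ∈ Ioc 0 T, ‖fractSum S b (x * Real.exp h) - fractSum S b x‖ₑ ^ 2 *
        ENNReal.ofReal (x ^ (-2 * (1 / 2) - 1 : ℝ)) ≤
      2 * (‖partialSum (Finset.Icc 1 K) c (x * Real.exp h) -
        partialSum (Finset.Icc 1 K) c x‖ₑ ^ 2 * ENNReal.ofReal (x ^ (-2 * (1 / 2) - 1 : ℝ))) +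
      ENNReal.ofReal (8 * h ^ 2 * W) := by
    intro x hx
    have hx0 : 0 < x := hx.1
    rw [enorm_sq_eq_ofReal, enorm_sq_eq_ofReal, ← ENNReal.ofReal_mul (sq_nonneg _),
      ← ENNReal.ofReal_mul (sq_nonneg _), show (2:ENNReal) = ENNReal.ofReal 2 by simp,
      ← ENNReal.ofReal_mul (by norm_num), ← ENNReal.ofReal_add (by positivity) (by positivity)]
    refine ENNReal.ofReal_le_ofReal ?_
    rw [fractSum_eq_partialSum_sub hS b (K := K) (by positivity) (by nlinarith [hx.2]),
      fractSum_eq_partialSum_sub hS b (K := K) (by positivity) (by linarith [hx.2])]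
    set P := partialSum (Finset.Icc 1 K) c (x * Real.exp h) - partialSum (Finset.Icc 1 K) c x
    have hPQ : partialSum (Finset.Icc 1 K) c (x * Real.exp h) - ((x * Real.exp h : ℝ) : ℂ) * B -
        (partialSum (Finset.Icc 1 K) c x - x * B) =
        P - ((x * (Real.exp h - 1) : ℝ) : ℂ) * B := by
      simp only [P]; push_cast; ring
    rw [hPQ]
    set Q := ((x * (Real.exp h - 1) : ℝ) : ℂ) * B
    have hQ : ‖Q‖ ^ 2 ≤ (2 * h * x) ^ 2 * W := by
      simp only [Q]
      rw [norm_mul, mul_pow, Complex.norm_real, Real.norm_eq_abs, sq_abs]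
      refine mul_le_mul ?_ hB (sq_nonneg _) (sq_nonneg _)
      exact pow_le_pow_left₀ (mul_nonneg hx0.le (by linarith)) (by nlinarith) 2
    have hsq : ‖P - Q‖ ^ 2 ≤ 2 * ‖P‖ ^ 2 + 2 * ‖Q‖ ^ 2 := by
      have := norm_sub_le P Q
      nlinarith [sq_nonneg (‖P‖ - ‖Q‖), norm_nonneg (P - Q)]
    have hxx : x ^ 2 * x ^ (-2 * (1 / 2) - 1 : ℝ) = 1 := by
      rw [← Real.rpow_natCast, ← Real.rpow_add hx0]; norm_num
    calc _ ≤ (2 * ‖P‖ ^ 2 + 2 * ((2 * h * x) ^ 2 * W)) * x ^ (-2 * (1 / 2) - 1 : ℝ) := by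
          gcongr; linarith
      _ = 2 * (‖P‖ ^ 2 * x ^ (-2 * (1 / 2) - 1 : ℝ)) +
          8 * h ^ 2 * W * (x ^ 2 * x ^ (-2 * (1 / 2) - 1 : ℝ)) := by ring
      _ = _ := by rw [hxx, mul_one]
  have hsum : ∑ n ∈ Finset.Icc 1 K, ‖c n‖ ^ 2 * (n:ℝ) ^ (-2 * (1 / 2) : ℝ) * (1 + 2 * h * n) ≤
      20 * Real.log T * W := by
    calc _ ≤ ∑ n ∈ Finset.Icc 1 K, 4 * (‖c n‖ ^ 2 * (n:ℝ)⁻¹) := by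
          refine Finset.sum_le_sum fun n hn => ?_
          have hn1 : (n:ℝ) ≤ K := by exact_mod_cast (Finset.mem_Icc.1 hn).2
          rw [show (-2 * (1 / 2) : ℝ) = -1 by norm_num, Real.rpow_neg_one, mul_comm]
          refine mul_le_mul_of_nonneg_right ?_ (by positivity)
          nlinarith
      _ ≤ 4 * (W * (1 + Real.log K)) := by
          rw [← Finset.mul_sum]
          exact mul_le_mul_of_nonneg_left (sum_norm_sq_divisorSum_le hS b K) (by norm_num)
      _ ≤ _ := by
          have h1 : Real.log K ≤ Real.log (T ^ 2 * 2) :=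
            Real.log_le_log (by linarith) (by nlinarith)
          rw [Real.log_mul (by positivity) (by norm_num), Real.log_pow] at h1
          have h2 := Real.log_two_lt_d9
          have h3 : 1 + Real.log K ≤ 5 * Real.log T := by
            push_cast at h1; have := Real.log_le_log (by norm_num) hT; linarith
          calc 4 * (W * (1 + Real.log K)) ≤ 4 * (W * (5 * Real.log T)) := by gcongr
            _ = _ := by ring
  have hexp : Real.exp 2 ≤ 7.4 := by
    have h1 := Real.exp_one_lt_d9
    have h2 : Real.exp 2 = Real.exp 1 ^ 2 := by rw [← Real.exp_nat_mul]; norm_num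
    rw [h2]; nlinarith [Real.exp_pos 1]
  calc _ ≤ ∫⁻ x in Ioc 0 T, (2 * (‖partialSum (Finset.Icc 1 K) c (x * Real.exp h) -
        partialSum (Finset.Icc 1 K) c x‖ₑ ^ 2 * ENNReal.ofReal (x ^ (-2 * (1 / 2) - 1 : ℝ))) +
      ENNReal.ofReal (8 * h ^ 2 * W)) := setLIntegral_mono' measurableSet_Ioc hpt
    _ = 2 * (∫⁻ x in Ioc 0 T, ‖partialSum (Finset.Icc 1 K) c (x * Real.exp h) -
        partialSum (Finset.Icc 1 K) c x‖ₑ ^ 2 * ENNReal.ofReal (x ^ (-2 * (1 / 2) - 1 : ℝ))) +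
      ENNReal.ofReal (8 * h ^ 2 * W) * ENNReal.ofReal T := by
        rw [lintegral_add_right _ measurable_const, lintegral_const_mul' _ _ (by simp)]
        simp
    _ ≤ 2 * ENNReal.ofReal (Real.exp (2 * (1 / 2) + 1) * h * (20 * Real.log T * W)) +
      ENNReal.ofReal (8 * h ^ 2 * W) * ENNReal.ofReal T := by
        gcongr
        refine (lintegral_mono_set Ioc_subset_Ioi_self).trans
          ((lintegral_partialSum_window_le (Finset.Icc 1 K)
            (fun n hn => (Finset.mem_Icc.1 hn).1) c (by norm_num) h0 (by linarith)).trans ?_)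
        exact ENNReal.ofReal_le_ofReal (mul_le_mul_of_nonneg_left hsum (by positivity))
    _ ≤ _ := by
        rw [show (2:ENNReal) = ENNReal.ofReal 2 by simp, ← ENNReal.ofReal_mul (by norm_num),
          ← ENNReal.ofReal_mul (by positivity), ← ENNReal.ofReal_add (by positivity)
          (by positivity)]
        refine ENNReal.ofReal_le_ofReal ?_
        rw [show (2 * (1 / 2) + 1 : ℝ) = 2 by norm_num]
        have h1 : 8 * h ^ 2 * W * T ≤ 8 * (h * W * Real.log T) := by
          have : h * W * (h * T) ≤ h * W * Real.log T :=
            mul_le_mul_of_nonneg_left (by linarith) (by positivity)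
          linarith
        have h2 : Real.exp 2 * (h * W * Real.log T) ≤ 7.4 * (h * W * Real.log T) :=
          mul_le_mul_of_nonneg_right hexp (by positivity)
        have h3 : 0 ≤ h * W * Real.log T := by positivity
        linarith

end TwistedSmall

section TwistedLarge
open MeasureTheory Set Filter Topology

lemma fractSum_add_sub (S : Finset ℕ) (b : ℕ → ℂ) (x v : ℝ) :
    fractSum S b (x + v) - fractSum S b x = -∑ m ∈ S, b m * (sawDiff v m x : ℂ) := by
  simp only [fractSum, sawDiff]
  push_cast
  simp only [mul_sub, Finset.sum_sub_distrib]
  ring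

/-- The mean square weight `∑ ‖b m‖ ‖b n‖ (min(v,Y) / lcm · X⁻² + 2 lcm · X⁻³)` is controlled. -/
lemma lintegral_fractSum_tail_le {S : Finset ℕ} {Y : ℕ} (hS : S ⊆ Finset.Icc 1 Y) (b : ℕ → ℂ)
    {v X : ℝ} (hv : 0 ≤ v) (hX : 0 < X) :
    ∫⁻ x in Ioi X, ‖fractSum S b (x + v) - fractSum S b x‖ₑ ^ 2 * ENNReal.ofReal (x ^ (-3:ℝ)) ≤
      ENNReal.ofReal (min v Y * gcdWeight S b * X ^ (-2:ℝ) +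
        2 * Y ^ 2 * (∑ m ∈ S, ‖b m‖) ^ 2 * X ^ (-3:ℝ)) := by
  have hS1 : ∀ m ∈ S, 1 ≤ m := fun m hm => (Finset.mem_Icc.1 (hS hm)).1
  have hSY : ∀ m ∈ S, m ≤ Y := fun m hm => (Finset.mem_Icc.1 (hS hm)).2
  have h1 : ∀ x ∈ Ioi X, ‖fractSum S b (x + v) - fractSum S b x‖ₑ ^ 2 *
      ENNReal.ofReal (x ^ (-3:ℝ)) =
      ENNReal.ofReal (‖∑ m ∈ S, b m * (sawDiff v m x : ℂ)‖ ^ 2 * x ^ (-3:ℝ)) := by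
    intro x _
    rw [enorm_sq_eq_ofReal, fractSum_add_sub, norm_neg, ENNReal.ofReal_mul (sq_nonneg _)]
  rw [setLIntegral_congr_fun measurableSet_Ioi h1, ← ofReal_integral_eq_lintegral_ofReal]
  · refine ENNReal.ofReal_le_ofReal ((integral_norm_sq_sawDiff_le S hS1 b hv hX).trans ?_)
    have : min v (Y:ℝ) * gcdWeight S b * X ^ (-2:ℝ) +
        2 * Y ^ 2 * (∑ m ∈ S, ‖b m‖) ^ 2 * X ^ (-3:ℝ) = ∑ m ∈ S, ∑ n ∈ S, ‖b m‖ * ‖b n‖ *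
        (min v Y / (m.lcm n : ℕ) * X ^ (-2:ℝ) + 2 * Y ^ 2 * X ^ (-3:ℝ)) := by
      rw [gcdWeight, sq (∑ m ∈ S, ‖b m‖), Finset.sum_mul_sum]
      simp only [Finset.mul_sum, Finset.sum_mul]
      rw [← Finset.sum_add_distrib]
      refine Finset.sum_congr rfl fun m _ => ?_
      rw [← Finset.sum_add_distrib]
      exact Finset.sum_congr rfl fun n _ => by ring
    rw [this]
    gcongr with m hm n hn
    · exact_mod_cast (Nat.gcd_le_left n (hS1 m hm)).trans (hSY m hm)
    · have : m.lcm n ≤ Y ^ 2 := (Nat.le_of_dvd (Nat.mul_pos (hS1 m hm) (hS1 n hn))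
        (Nat.lcm_dvd_mul m n)).trans (by rw [sq]; exact Nat.mul_le_mul (hSY m hm) (hSY n hn))
      exact_mod_cast this
  · have hm : Measurable fun x => ‖∑ m ∈ S, b m * (sawDiff v m x : ℂ)‖ ^ 2 := by
      refine (Measurable.norm ?_).pow_const 2
      exact Finset.measurable_sum _ fun m _ =>
        measurable_const.mul (Complex.measurable_ofReal.comp (measurable_sawDiff v m))
    refine integrableOn_mul_rpow_Ioi hm (B := (∑ m ∈ S, ‖b m‖) ^ 2) (fun x => ?_) hX
    rw [abs_pow, abs_norm]
    gcongr
    refine (norm_sum_le _ _).trans (Finset.sum_le_sum fun m _ => ?_)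
    rw [norm_mul, Complex.norm_real, Real.norm_eq_abs]
    exact mul_le_of_le_one_right (norm_nonneg _) (abs_sawDiff_le v m x)
  · refine (ae_restrict_iff' measurableSet_Ioi).2 (ae_of_all _ fun x hx => ?_)
    have : 0 < x := hX.trans hx
    positivity

lemma lintegral_min_div_max_sq_le {Y : ℝ} (hY : 1 ≤ Y) :
    ∫⁻ v in Ioi (0:ℝ), ENNReal.ofReal (min v Y * (max 1 v) ^ (-2:ℝ)) ≤
      ENNReal.ofReal (2 + Real.log Y) := by
  have hY0 : 0 < Y := by linarith
  have hlog := Real.log_nonneg hY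
  rw [show Ioi (0:ℝ) = Ioc 0 1 ∪ (Ioc 1 Y ∪ Ioi Y) by
    rw [Ioc_union_Ioi_eq_Ioi hY, Ioc_union_Ioi_eq_Ioi zero_le_one]]
  refine (lintegral_union_le _ _ _).trans ?_
  have e1 : ∫⁻ v in Ioc (0:ℝ) 1, ENNReal.ofReal (min v Y * (max 1 v) ^ (-2:ℝ)) ≤
      ENNReal.ofReal 1 := by
    calc _ ≤ ∫⁻ v in Ioc (0:ℝ) 1, 1 := by
          refine setLIntegral_mono' measurableSet_Ioc fun v hv => ?_
          rw [max_eq_left hv.2, Real.one_rpow, mul_one, ENNReal.ofReal_le_one]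
          exact (min_le_left _ _).trans hv.2
      _ = _ := by simp
  have e2 : ∫⁻ v in Ioc 1 Y, ENNReal.ofReal (min v Y * (max 1 v) ^ (-2:ℝ)) ≤
      ENNReal.ofReal (Real.log Y) := by
    have : ∀ v ∈ Ioc 1 Y, ENNReal.ofReal (min v Y * (max 1 v) ^ (-2:ℝ)) =
        ENNReal.ofReal v⁻¹ := by
      intro v hv
      have hv0 : 0 < v := by linarith [hv.1]
      rw [max_eq_right hv.1.le, min_eq_left hv.2]
      congr 1
      rw [Real.rpow_neg hv0.le, Real.rpow_two]; field_simp
    rw [setLIntegral_congr_fun measurableSet_Ioc this, ← ofReal_integral_eq_lintegral_ofReal,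
      ← intervalIntegral.integral_of_le hY, integral_inv_of_pos one_pos hY0, div_one]
    · have : IntervalIntegrable (fun v : ℝ => v⁻¹) volume 1 Y :=
        intervalIntegrable_inv_iff.2 (Or.inr (by
          rw [uIcc_of_le hY]; simp))
      rwa [intervalIntegrable_iff_integrableOn_Ioc_of_le hY] at this
    · refine (ae_restrict_iff' measurableSet_Ioc).2 (ae_of_all _ fun v hv => ?_)
      have : 0 < v := by linarith [hv.1]
      positivity
  have e3 : ∫⁻ v in Ioi Y, ENNReal.ofReal (min v Y * (max 1 v) ^ (-2:ℝ)) ≤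
      ENNReal.ofReal 1 := by
    have : ∀ v ∈ Ioi Y, ENNReal.ofReal (min v Y * (max 1 v) ^ (-2:ℝ)) =
        ENNReal.ofReal (Y * v ^ (-2:ℝ)) := by
      intro v hv
      have hv0 : Y < v := hv
      rw [max_eq_right (by linarith), min_eq_right hv0.le]
    rw [setLIntegral_congr_fun measurableSet_Ioi this, ← ofReal_integral_eq_lintegral_ofReal
      ((integrableOn_Ioi_rpow_of_lt (by norm_num) hY0).const_mul Y), integral_const_mul,
      integral_Ioi_rpow_of_lt (by norm_num) hY0]
    · refine ENNReal.ofReal_le_ofReal (le_of_eq ?_)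
      rw [show (-2:ℝ) + 1 = -1 by norm_num, Real.rpow_neg_one]; field_simp
    · refine (ae_restrict_iff' measurableSet_Ioi).2 (ae_of_all _ fun v hv => ?_)
      have : 0 < v := hY0.trans hv
      positivity
  refine (add_le_add e1 ((lintegral_union_le _ _ _).trans (add_le_add e2 e3))).trans ?_
  rw [← ENNReal.ofReal_add hlog zero_le_one, ← ENNReal.ofReal_add zero_le_one (by positivity)]
  exact ENNReal.ofReal_le_ofReal (by linarith)

lemma lintegral_max_rpow_le :
    ∫⁻ v in Ioi (0:ℝ), ENNReal.ofReal ((max 1 v) ^ (-3:ℝ)) ≤ ENNReal.ofReal 2 := by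
  rw [← Ioc_union_Ioi_eq_Ioi (zero_le_one (α := ℝ))]
  refine (lintegral_union_le _ _ _).trans ?_
  have e1 : ∫⁻ v in Ioc (0:ℝ) 1, ENNReal.ofReal ((max 1 v) ^ (-3:ℝ)) ≤ ENNReal.ofReal 1 := by
    calc _ ≤ ∫⁻ v in Ioc (0:ℝ) 1, 1 := by
          refine setLIntegral_mono' measurableSet_Ioc fun v hv => ?_
          rw [max_eq_left hv.2, Real.one_rpow, ENNReal.ofReal_le_one]
      _ = _ := by simp
  have e2 : ∫⁻ v in Ioi (1:ℝ), ENNReal.ofReal ((max 1 v) ^ (-3:ℝ)) ≤ ENNReal.ofReal 1 := by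
    have : ∀ v ∈ Ioi (1:ℝ), ENNReal.ofReal ((max 1 v) ^ (-3:ℝ)) =
        ENNReal.ofReal (v ^ (-3:ℝ)) := by
      intro v hv
      rw [max_eq_right (le_of_lt hv)]
    rw [setLIntegral_congr_fun measurableSet_Ioi this, ← ofReal_integral_eq_lintegral_ofReal
      (integrableOn_Ioi_rpow_of_lt (by norm_num) one_pos),
      integral_Ioi_rpow_of_lt (by norm_num) one_pos]
    · exact ENNReal.ofReal_le_ofReal (by norm_num)
    · refine (ae_restrict_iff' measurableSet_Ioi).2 (ae_of_all _ fun v hv => ?_)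
      have : (0:ℝ) < v := one_pos.trans hv
      positivity
  refine (add_le_add e1 e2).trans ?_
  rw [← ENNReal.ofReal_add zero_le_one zero_le_one]
  exact ENNReal.ofReal_le_ofReal (by norm_num)

/-- Substituting `v = x (exp h - 1)` in an average over `h`. -/
lemma lintegral_comp_mul_exp_sub_one_le {g : ℝ → ENNReal} {x η : ℝ} (hx : 0 < x)
    (h1 : η ≤ 1) :
    ENNReal.ofReal x * ∫⁻ h in Ioc 0 η, g (x * (Real.exp h - 1)) ≤
      ∫⁻ v in Ioc 0 (2 * x * η), g v := by
  set φ : ℝ → ℝ := fun h => x * (Real.exp h - 1) with hφ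
  have hd : ∀ h ∈ Ioc 0 η, HasDerivWithinAt φ (x * Real.exp h) (Ioc 0 η) h := fun h _ =>
    (((Real.hasDerivAt_exp h).sub_const 1).const_mul x).hasDerivWithinAt
  have hinj : InjOn φ (Ioc 0 η) := by
    intro a _ b _ hab
    have : Real.exp a = Real.exp b := by
      have := mul_left_cancel₀ hx.ne' hab; linarith
    exact Real.exp_injective this
  have himg : φ '' Ioc 0 η ⊆ Ioc 0 (2 * x * η) := by
    rintro _ ⟨h, hh, rfl⟩
    have he := exp_sub_one_le hh.1.le (hh.2.trans h1)
    have he1 := Real.add_one_lt_exp hh.1.ne'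
    refine ⟨mul_pos hx (by linarith [hh.1]), ?_⟩
    simp only [hφ]
    nlinarith [mul_le_mul_of_nonneg_left he hx.le, mul_le_mul_of_nonneg_left hh.2 hx.le]
  calc _ = ∫⁻ h in Ioc 0 η, ENNReal.ofReal x * g (φ h) := by
        rw [lintegral_const_mul' _ _ ENNReal.ofReal_ne_top]
    _ ≤ ∫⁻ h in Ioc 0 η, ENNReal.ofReal |x * Real.exp h| * g (φ h) := by
        refine setLIntegral_mono' measurableSet_Ioc fun h hh => ?_
        gcongr
        rw [abs_of_pos (by positivity)]
        exact le_mul_of_one_le_right hx.le (Real.one_le_exp hh.1.le)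
    _ = ∫⁻ v in φ '' Ioc 0 η, g v :=
        (lintegral_image_eq_lintegral_abs_deriv_mul measurableSet_Ioc hd hinj g).symm
    _ ≤ _ := lintegral_mono_set himg

lemma lintegral_lintegral_fractSum_large_le {S : Finset ℕ} {Y : ℕ} (hY : 1 ≤ Y)
    (hS : S ⊆ Finset.Icc 1 Y) (b : ℕ → ℂ) {T η : ℝ} (hT : 1 ≤ T) (h0 : 0 < η)
    (hη : 2 * η * T < 1) :
    ∫⁻ h in Ioc 0 η, ∫⁻ x in Ioi T, ‖fractSum S b (x * Real.exp h) - fractSum S b x‖ₑ ^ 2 *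
        ENNReal.ofReal (x ^ (-2 * (1 / 2) - 1 : ℝ)) ≤
      ENNReal.ofReal ((2 + Real.log Y) * gcdWeight S b * T ^ (-2:ℝ) +
        4 * Y ^ 2 * (∑ m ∈ S, ‖b m‖) ^ 2 * T ^ (-3:ℝ)) := by
  have hT0 : 0 < T := by linarith
  have hη1 : η ≤ 1 := by nlinarith
  have hf := measurable_fractSum S b
  set W := gcdWeight S b
  have hW : 0 ≤ W := gcdWeight_nonneg S b
  set B := (∑ m ∈ S, ‖b m‖) ^ 2
  have hB : 0 ≤ B := sq_nonneg _
  have hlog : 0 ≤ Real.log Y := Real.log_nonneg (by exact_mod_cast hY)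
  have hinner : ∀ x ∈ Ioi T, ∫⁻ h in Ioc 0 η, ‖fractSum S b (x * Real.exp h) - fractSum S b x‖ₑ ^ 2 *
        ENNReal.ofReal (x ^ (-2 * (1 / 2) - 1 : ℝ)) ≤
      ∫⁻ v in Ioi 0, (Ioi (T * max 1 v)).indicator (fun x =>
        ‖fractSum S b (x + v) - fractSum S b x‖ₑ ^ 2 * ENNReal.ofReal (x ^ (-3:ℝ))) x := by
    intro x hx
    have hxT : T < x := hx
    have hx0 : 0 < x := hT0.trans hx
    have h3 : x ^ (-2 * (1 / 2) - 1 : ℝ) = x ^ (-3:ℝ) * x := by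
      nth_rewrite 3 [← Real.rpow_one x]
      rw [← Real.rpow_add hx0]; norm_num
    have h4 := lintegral_comp_mul_exp_sub_one_le
      (g := fun v => ‖fractSum S b (x + v) - fractSum S b x‖ₑ ^ 2) hx0 hη1
    have h5 : ∀ h : ℝ, x + x * (Real.exp h - 1) = x * Real.exp h := fun h => by ring
    simp only [h5] at h4
    rw [lintegral_mul_const' _ _ ENNReal.ofReal_ne_top, h3, ENNReal.ofReal_mul (by positivity)]
    calc _ = ENNReal.ofReal (x ^ (-3:ℝ)) * (ENNReal.ofReal x *
          ∫⁻ h in Ioc 0 η, ‖fractSum S b (x * Real.exp h) - fractSum S b x‖ₑ ^ 2) := by ring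
      _ ≤ ENNReal.ofReal (x ^ (-3:ℝ)) *
          ∫⁻ v in Ioc 0 (2 * x * η), ‖fractSum S b (x + v) - fractSum S b x‖ₑ ^ 2 := by gcongr
      _ = ∫⁻ v in Ioc 0 (2 * x * η), ‖fractSum S b (x + v) - fractSum S b x‖ₑ ^ 2 *
          ENNReal.ofReal (x ^ (-3:ℝ)) := by
          rw [lintegral_mul_const' _ _ ENNReal.ofReal_ne_top, mul_comm]
      _ ≤ ∫⁻ v in Ioc 0 (2 * x * η), (Ioi (T * max 1 v)).indicator (fun x =>
          ‖fractSum S b (x + v) - fractSum S b x‖ₑ ^ 2 * ENNReal.ofReal (x ^ (-3:ℝ))) x := by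
          refine setLIntegral_mono' measurableSet_Ioc fun v hv => ?_
          rw [indicator_of_mem]
          rw [mem_Ioi, mul_max_of_nonneg _ _ hT0.le, max_lt_iff, mul_one]
          refine ⟨hxT, ?_⟩
          have := mul_le_mul_of_nonneg_left hv.2 hT0.le
          nlinarith
      _ ≤ _ := lintegral_mono_set Ioc_subset_Ioi_self
  have hm1 : Measurable (Function.uncurry fun h x : ℝ =>
      ‖fractSum S b (x * Real.exp h) - fractSum S b x‖ₑ ^ 2 *
        ENNReal.ofReal (x ^ (-2 * (1 / 2) - 1 : ℝ))) := by
    unfold Function.uncurry; fun_prop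
  have hm2 : Measurable (Function.uncurry fun x v : ℝ =>
      (Ioi (T * max 1 v)).indicator (fun x => ‖fractSum S b (x + v) - fractSum S b x‖ₑ ^ 2 *
        ENNReal.ofReal (x ^ (-3:ℝ))) x) := by
    have : (Function.uncurry fun x v : ℝ =>
      (Ioi (T * max 1 v)).indicator (fun x => ‖fractSum S b (x + v) - fractSum S b x‖ₑ ^ 2 *
        ENNReal.ofReal (x ^ (-3:ℝ))) x) = {p : ℝ × ℝ | T * max 1 p.2 < p.1}.indicator
        (fun p => ‖fractSum S b (p.1 + p.2) - fractSum S b p.1‖ₑ ^ 2 *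
        ENNReal.ofReal (p.1 ^ (-3:ℝ))) := by
      ext ⟨x, v⟩
      simp [Function.uncurry, indicator]
    rw [this]
    exact Measurable.indicator (by fun_prop) (measurableSet_lt (by fun_prop) (by fun_prop))
  calc _ = ∫⁻ x in Ioi T, ∫⁻ h in Ioc 0 η,
        ‖fractSum S b (x * Real.exp h) - fractSum S b x‖ₑ ^ 2 *
        ENNReal.ofReal (x ^ (-2 * (1 / 2) - 1 : ℝ)) := lintegral_lintegral_swap hm1.aemeasurable
    _ ≤ ∫⁻ x in Ioi T, ∫⁻ v in Ioi 0, (Ioi (T * max 1 v)).indicator (fun x =>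
        ‖fractSum S b (x + v) - fractSum S b x‖ₑ ^ 2 * ENNReal.ofReal (x ^ (-3:ℝ))) x :=
        setLIntegral_mono' measurableSet_Ioi hinner
    _ = ∫⁻ v in Ioi 0, ∫⁻ x in Ioi T, (Ioi (T * max 1 v)).indicator (fun x =>
        ‖fractSum S b (x + v) - fractSum S b x‖ₑ ^ 2 * ENNReal.ofReal (x ^ (-3:ℝ))) x :=
        lintegral_lintegral_swap hm2.aemeasurable
    _ ≤ ∫⁻ v in Ioi (0:ℝ), (ENNReal.ofReal (W * T ^ (-2:ℝ)) *
        ENNReal.ofReal (min v (Y:ℝ) * (max 1 v) ^ (-2:ℝ)) +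
        ENNReal.ofReal (2 * Y ^ 2 * B * T ^ (-3:ℝ)) * ENNReal.ofReal ((max 1 v) ^ (-3:ℝ))) := by
        refine setLIntegral_mono' measurableSet_Ioi fun v hv => ?_
        have hv0 : (0:ℝ) < v := hv
        have hmax : (0:ℝ) < max 1 v := lt_max_of_lt_left one_pos
        rw [lintegral_indicator measurableSet_Ioi, Measure.restrict_restrict measurableSet_Ioi]
        refine (lintegral_mono_set inter_subset_left).trans
          ((lintegral_fractSum_tail_le hS b hv0.le (by positivity)).trans ?_)
        rw [← ENNReal.ofReal_mul (by positivity), ← ENNReal.ofReal_mul (by positivity),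
          ← ENNReal.ofReal_add (by positivity) (by positivity)]
        refine ENNReal.ofReal_le_ofReal (le_of_eq ?_)
        rw [Real.mul_rpow hT0.le hmax.le, Real.mul_rpow hT0.le hmax.le]
        ring
    _ ≤ ENNReal.ofReal (W * T ^ (-2:ℝ)) * ENNReal.ofReal (2 + Real.log Y) +
        ENNReal.ofReal (2 * Y ^ 2 * B * T ^ (-3:ℝ)) * ENNReal.ofReal 2 := by
        rw [lintegral_add_left (by fun_prop), lintegral_const_mul' _ _ ENNReal.ofReal_ne_top,
          lintegral_const_mul' _ _ ENNReal.ofReal_ne_top]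
        gcongr
        · exact lintegral_min_div_max_sq_le (by exact_mod_cast hY)
        · exact lintegral_max_rpow_le
    _ = _ := by
        rw [← ENNReal.ofReal_mul (by positivity), ← ENNReal.ofReal_mul (by positivity),
          ← ENNReal.ofReal_add (by positivity) (by positivity)]
        congr 1; ring

end TwistedLarge

section TwistedMoment
open MeasureTheory Set Filter Topology

lemma continuous_integral_mul_cpow_vertical {f : ℝ → ℂ} (hf : Measurable f) {α : ℝ}
    (hInt : IntegrableOn (fun x : ℝ => f x * (x:ℂ) ^ (-(α:ℂ) - 1)) (Ioi 0)) :
    Continuous fun t : ℝ => ∫ x in Ioi (0:ℝ), f x * (x:ℂ) ^ (-(α + t * I) - 1) := by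
  refine continuous_of_dominated (bound := fun x => ‖f x * (x:ℂ) ^ (-(α:ℂ) - 1)‖) (fun t => ?_)
    (fun t => ?_) hInt.norm ?_
  · exact (by fun_prop : Measurable fun x : ℝ =>
      f x * (x:ℂ) ^ (-(α + t * I) - 1)).aestronglyMeasurable
  · refine (ae_restrict_iff' measurableSet_Ioi).2 (ae_of_all _ fun x hx => ?_)
    have hx0 : (0:ℝ) < x := hx
    rw [norm_mul, norm_mul, Complex.norm_cpow_eq_rpow_re_of_pos hx0,
      Complex.norm_cpow_eq_rpow_re_of_pos hx0]
    simp
  · refine (ae_restrict_iff' measurableSet_Ioi).2 (ae_of_all _ fun x hx => ?_)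
    have hx0 : (x:ℂ) ≠ 0 := by exact_mod_cast (ne_of_gt hx)
    exact continuous_const.mul (Continuous.const_cpow (by fun_prop) (Or.inl hx0))

/-- The second moment of `ζ` on the critical line twisted by a Dirichlet polynomial. -/
theorem integral_norm_sq_zeta_mul_le {S : Finset ℕ} {Y : ℕ} (hY : 1 ≤ Y)
    (hS : S ⊆ Finset.Icc 1 Y) (b : ℕ → ℂ) {T : ℝ} (hT : 2 ≤ T) :
    ∫ t in (1:ℝ)..T, ‖riemannZeta ((1 / 2 : ℝ) + t * I) *
        ∑ m ∈ S, b m * (m:ℂ) ^ (-((1 / 2 : ℝ) + t * I))‖ ^ 2 ≤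
      200000 * (T * (Real.log T + Real.log Y) * gcdWeight S b +
        Y ^ 2 * (∑ m ∈ S, ‖b m‖) ^ 2) := by
  have hS1 : ∀ m ∈ S, 1 ≤ m := fun m hm => (Finset.mem_Icc.1 (hS hm)).1
  have hT0 : 0 < T := by linarith
  have hInt : IntegrableOn (fun x : ℝ => fractSum S b x * (x:ℂ) ^ (-((1 / 2 : ℝ) : ℂ) - 1))
      (Ioi 0) := integrableOn_fractSum_mul_cpow hS1 b (by norm_num) (by norm_num)
  have hfm := measurable_fractSum S b
  set G : ℝ → ℂ := fun t => ((1 / 2 : ℝ) + t * I) *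
    ∫ x in Ioi (0:ℝ), fractSum S b x * (x:ℂ) ^ (-((1 / 2 : ℝ) + t * I) - 1) with hG
  have hGc : Continuous G := Continuous.mul (by fun_prop)
    (continuous_integral_mul_cpow_vertical hfm hInt)
  have hGi : ∀ u v : ℝ, IntervalIntegrable (fun t => ‖G t‖ ^ 2) volume u v := fun u v =>
    (hGc.norm.pow 2).intervalIntegrable _ _
  have h1 : ∫ t in (1:ℝ)..T, ‖riemannZeta ((1 / 2 : ℝ) + t * I) *
        ∑ m ∈ S, b m * (m:ℂ) ^ (-((1 / 2 : ℝ) + t * I))‖ ^ 2 ≤ ∫ t in (-T)..T, ‖G t‖ ^ 2 := by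
    have : ∫ t in (1:ℝ)..T, ‖riemannZeta ((1 / 2 : ℝ) + t * I) *
        ∑ m ∈ S, b m * (m:ℂ) ^ (-((1 / 2 : ℝ) + t * I))‖ ^ 2 = ∫ t in (1:ℝ)..T, ‖G t‖ ^ 2 := by
      refine intervalIntegral.integral_congr fun t ht => ?_
      rw [uIcc_of_le (by linarith)] at ht
      simp only [hG]
      rw [mul_integral_fractSum_mul_cpow hS1 b (by simp) (by norm_num)
        (by simp; linarith [ht.1])]
    rw [this]
    exact intervalIntegral.integral_mono_interval (by linarith) (by linarith) le_rfl
      (ae_of_all _ fun t => by positivity) (hGi _ _)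
  refine h1.trans ?_
  set J := ∫ t in (-T)..T, ‖G t‖ ^ 2
  set W := gcdWeight S b
  have hW : 0 ≤ W := gcdWeight_nonneg S b
  set B := (∑ m ∈ S, ‖b m‖) ^ 2
  have hB : 0 ≤ B := sq_nonneg _
  have hlogY : 0 ≤ Real.log Y := Real.log_nonneg (by exact_mod_cast hY)
  have hlogT : 1 / 2 ≤ Real.log T := by
    have := Real.log_two_gt_d9
    have := Real.log_le_log (by norm_num) hT
    linarith
  set η : ℝ := 1 / (2 * (T + 1)) with hη
  have hη0 : 0 < η := by positivity
  have hη1 : (T + 1) * η = 1 / 2 := by rw [hη]; field_simp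
  have hpt : ∀ h ∈ Ioc 0 η, ENNReal.ofReal (J * h ^ 2) ≤
      80 * ENNReal.ofReal (400 * Real.log T * W * h) +
      80 * ∫⁻ x in Ioi T, ‖fractSum S b (x * Real.exp h) - fractSum S b x‖ₑ ^ 2 *
        ENNReal.ofReal (x ^ (-2 * (1 / 2) - 1 : ℝ)) := by
    intro h hh
    have hh0 := hh.1
    have h2 := ofReal_mul_integral_mellin_sq_le (f := fractSum S b) (α := 1 / 2) (by norm_num)
      hInt hT0 hh0 (by nlinarith [hh.2])
    rw [mul_comm J]
    refine h2.trans ?_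
    rw [← mul_add]
    refine mul_le_mul_right ?_ 80
    rw [← Ioc_union_Ioi_eq_Ioi hT0.le]
    refine (lintegral_union_le _ _ _).trans (add_le_add ?_ le_rfl)
    refine (lintegral_fractSum_small_le hS1 b hT hh0.le (by nlinarith [hh.2])).trans
      (ENNReal.ofReal_le_ofReal (le_of_eq (by ring)))
  have hpow : ∀ (c : ℝ) (k : ℕ), 0 ≤ c → ∫⁻ h in Ioc 0 η, ENNReal.ofReal (c * h ^ k) =
      ENNReal.ofReal (c * (η ^ (k + 1) / (k + 1))) := by
    intro c k hc
    rw [← ofReal_integral_eq_lintegral_ofReal, ← intervalIntegral.integral_of_le hη0.le,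
      intervalIntegral.integral_const_mul, integral_pow]
    · simp
    · have : Continuous fun h : ℝ => c * h ^ k := by fun_prop
      exact (this.integrableOn_Icc).mono_set Ioc_subset_Icc_self
    · refine (ae_restrict_iff' measurableSet_Ioc).2 (ae_of_all _ fun h hh => ?_)
      have := hh.1
      positivity
  have hJ : 0 ≤ J := intervalIntegral.integral_nonneg (by linarith) fun _ _ => sq_nonneg _
  have h3 := setLIntegral_mono' (μ := volume) measurableSet_Ioc hpt
  rw [hpow J 2 hJ, lintegral_add_left (by fun_prop), lintegral_const_mul _ (by fun_prop),
    lintegral_const_mul' _ _ (by simp)] at h3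
  have h4 := hpow (400 * Real.log T * W) 1 (by positivity)
  simp only [pow_one] at h4
  rw [h4] at h3
  have h5 := h3.trans (add_le_add le_rfl (mul_le_mul_right
    (lintegral_lintegral_fractSum_large_le hY hS b (by linarith) hη0 (by nlinarith)) 80))
  rw [show (80:ENNReal) = ENNReal.ofReal 80 by simp, ← ENNReal.ofReal_mul (by norm_num),
    ← ENNReal.ofReal_mul (by norm_num), ← ENNReal.ofReal_add (by positivity) (by positivity),
    ENNReal.ofReal_le_ofReal_iff (by positivity)] at h5
  set r : ℝ := η⁻¹ with hr
  have hr0 : 0 < r := by positivity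
  have hηr : η * r = 1 := mul_inv_cancel₀ hη0.ne'
  have hr1 : r ≤ 3 * T := by rw [hr, hη, one_div, inv_inv]; linarith
  have h6 : J ≤ 240 * (200 * r * Real.log T * W + r ^ 3 * ((2 + Real.log Y) * W * T ^ (-2:ℝ) +
        4 * Y ^ 2 * B * T ^ (-3:ℝ))) := by
    have h7 := mul_le_mul_of_nonneg_left h5 (show 0 ≤ 3 * r ^ 3 by positivity)
    have h8 : 3 * r ^ 3 * (J * (η ^ (2 + 1) / ((2:ℕ) + 1))) = J := by
      have : r ^ 3 * η ^ 3 = 1 := by rw [← mul_pow, mul_comm, hηr, one_pow]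
      push_cast
      linear_combination J * this
    rw [h8] at h7
    refine h7.trans (le_of_eq ?_)
    have : r ^ 3 * η ^ 2 = r := by linear_combination (r ^ 2 * η + r) * hηr
    push_cast
    linear_combination 240 * 200 * Real.log T * W * this
  have hr3 : r ^ 3 ≤ 27 * T ^ 3 := by
    calc r ^ 3 ≤ (3 * T) ^ 3 := by gcongr
      _ = _ := by ring
  have h9 : r ^ 3 * ((2 + Real.log Y) * W * T ^ (-2:ℝ) + 4 * Y ^ 2 * B * T ^ (-3:ℝ)) ≤
      27 * T * (2 + Real.log Y) * W + 108 * Y ^ 2 * B := by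
    refine (mul_le_mul_of_nonneg_right hr3 (by positivity)).trans (le_of_eq ?_)
    have e2 : T ^ (-2:ℝ) = (T ^ 2)⁻¹ := by rw [Real.rpow_neg hT0.le]; norm_cast
    have e3 : T ^ (-3:ℝ) = (T ^ 3)⁻¹ := by rw [Real.rpow_neg hT0.le]; norm_cast
    rw [e2, e3]; field_simp; ring
  have h10 : 200 * r * Real.log T * W ≤ 600 * (T * Real.log T * W) := by
    have := mul_le_mul_of_nonneg_right hr1 (show 0 ≤ Real.log T * W by positivity)
    linarith
  have h11 : T * W * 2 ≤ 4 * (T * Real.log T * W) := by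
    have := mul_le_mul_of_nonneg_left hlogT (show 0 ≤ T * W by positivity)
    linarith
  have h12 : 0 ≤ T * Real.log T * W := by positivity
  have h13 : 0 ≤ T * Real.log Y * W := by positivity
  have h14 : 0 ≤ (Y:ℝ) ^ 2 * B := by positivity
  linarith

end TwistedMoment

section Subconvexity
open MeasureTheory Set Filter Topology

lemma gcdWeight_Icc_le {Y : ℕ} {b : ℕ → ℂ} (hb : ∀ m ∈ Finset.Icc 1 Y, ‖b m‖ ≤ 1) :
    gcdWeight (Finset.Icc 1 Y) b ≤ (1 + Real.log Y) ^ 3 := by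
  have hl : 0 ≤ Real.log Y := Real.log_natCast_nonneg Y
  have hpair : ∀ m ∈ Finset.Icc 1 Y, ∀ n ∈ Finset.Icc 1 Y,
      ‖b m‖ * ‖b n‖ / (m.lcm n : ℕ) ≤
        ∑ d ∈ Finset.Icc 1 Y, (d:ℝ) * ((if d ∣ m then (m:ℝ)⁻¹ else 0) *
          (if d ∣ n then (n:ℝ)⁻¹ else 0)) := by
    intro m hm n hn
    obtain ⟨hm1, hm2⟩ := Finset.mem_Icc.1 hm
    obtain ⟨hn1, hn2⟩ := Finset.mem_Icc.1 hn
    have hg : m.gcd n ∈ Finset.Icc 1 Y :=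
      Finset.mem_Icc.2 ⟨Nat.gcd_pos_of_pos_left _ hm1, (Nat.gcd_le_left _ hm1).trans hm2⟩
    have hm0 : (0:ℝ) < m := by exact_mod_cast hm1
    have hn0 : (0:ℝ) < n := by exact_mod_cast hn1
    have hl0 : (0:ℝ) < (m.lcm n : ℕ) := by exact_mod_cast Nat.lcm_pos hm1 hn1
    have hgl : ((m.gcd n : ℕ) : ℝ) * (m.lcm n : ℕ) = m * n := by exact_mod_cast Nat.gcd_mul_lcm m n
    calc ‖b m‖ * ‖b n‖ / (m.lcm n : ℕ) ≤ 1 * 1 / (m.lcm n : ℕ) := by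
          gcongr
          · exact hb m hm
          · exact hb n hn
      _ = ((m.gcd n : ℕ) : ℝ) * ((if m.gcd n ∣ m then (m:ℝ)⁻¹ else 0) *
          (if m.gcd n ∣ n then (n:ℝ)⁻¹ else 0)) := by
          rw [if_pos (Nat.gcd_dvd_left m n), if_pos (Nat.gcd_dvd_right m n)]
          field_simp
          linarith
      _ ≤ _ := Finset.single_le_sum (f := fun d : ℕ => (d:ℝ) * ((if d ∣ m then (m:ℝ)⁻¹ else 0) *
          (if d ∣ n then (n:ℝ)⁻¹ else 0))) (fun d _ => by positivity) hg
  calc gcdWeight (Finset.Icc 1 Y) b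
      ≤ ∑ m ∈ Finset.Icc 1 Y, ∑ n ∈ Finset.Icc 1 Y, ∑ d ∈ Finset.Icc 1 Y,
        (d:ℝ) * ((if d ∣ m then (m:ℝ)⁻¹ else 0) * (if d ∣ n then (n:ℝ)⁻¹ else 0)) :=
        Finset.sum_le_sum fun m hm => Finset.sum_le_sum fun n hn => hpair m hm n hn
    _ = ∑ d ∈ Finset.Icc 1 Y, (d:ℝ) * (∑ m ∈ Finset.Icc 1 Y, if d ∣ m then (m:ℝ)⁻¹ else 0) ^ 2 := by
        rw [Finset.sum_congr rfl fun m _ => Finset.sum_comm, Finset.sum_comm]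
        refine Finset.sum_congr rfl fun d _ => ?_
        rw [sq, Finset.sum_mul_sum, Finset.mul_sum]
        exact Finset.sum_congr rfl fun m _ => (Finset.mul_sum _ _ _).symm
    _ ≤ ∑ d ∈ Finset.Icc 1 Y, (1 + Real.log Y) ^ 2 * (d:ℝ)⁻¹ := by
        refine Finset.sum_le_sum fun d hd => ?_
        have hd1 := (Finset.mem_Icc.1 hd).1
        have hd0 : (0:ℝ) < d := by exact_mod_cast hd1
        rw [← Finset.sum_filter]
        calc (d:ℝ) * (∑ m ∈ (Finset.Icc 1 Y).filter (fun n => d ∣ n), (m:ℝ)⁻¹) ^ 2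
            ≤ d * ((1 + Real.log Y) / d) ^ 2 := by gcongr; exact sum_Icc_dvd_inv_le hd1
          _ = _ := by field_simp
    _ ≤ (1 + Real.log Y) ^ 2 * (1 + Real.log Y) := by
        rw [← Finset.mul_sum]; gcongr; exact sum_Icc_inv_le Y
    _ = _ := by ring

lemma norm_natCast_cpow_mul_I_sub_one_le {m : ℕ} (hm : 1 ≤ m) (u : ℝ) :
    ‖(m:ℂ) ^ (-(u * I)) - 1‖ ≤ |u| * Real.log m := by
  have hm0 : (m:ℂ) ≠ 0 := by exact_mod_cast (by omega : m ≠ 0)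
  have h : (m:ℂ) ^ (-(u * I)) = Complex.exp (I * ((-(u * Real.log m) : ℝ) : ℂ)) := by
    rw [Complex.cpow_def_of_ne_zero hm0, ← Complex.natCast_log]
    congr 1; push_cast; ring
  rw [h]
  refine (Real.norm_exp_I_mul_ofReal_sub_one_le).trans ?_
  rw [Real.norm_eq_abs, abs_neg, abs_mul, abs_of_nonneg (Real.log_natCast_nonneg m)]

/-- A short amplifier resonating at height `t₀` has size at least `√Y / 2` close to `t₀`. -/
lemma sqrt_le_norm_amplifier {Y : ℕ} (hY : 1 ≤ Y) {t₀ t : ℝ}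
    (ht : |t - t₀| * Real.log Y ≤ 1 / 2) :
    Real.sqrt Y / 2 ≤ ‖∑ m ∈ Finset.Icc 1 Y, (m:ℂ) ^ (t₀ * I) *
      (m:ℂ) ^ (-((1 / 2 : ℝ) + t * I))‖ := by
  have hterm : ∀ m ∈ Finset.Icc 1 Y, (m:ℂ) ^ (t₀ * I) * (m:ℂ) ^ (-((1 / 2 : ℝ) + t * I)) =
      ((m:ℝ) ^ (-(1/2) : ℝ) : ℝ) + ((m:ℝ) ^ (-(1/2) : ℝ) : ℝ) *
        ((m:ℂ) ^ (-(((t - t₀ : ℝ) : ℂ) * I)) - 1) := by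
    intro m hm
    have hm0 : (m:ℂ) ≠ 0 := by
      have := (Finset.mem_Icc.1 hm).1
      exact_mod_cast (by omega : m ≠ 0)
    rw [Complex.ofReal_cpow (Nat.cast_nonneg m), mul_sub, mul_one, add_sub_cancel,
      ← Complex.cpow_add _ _ hm0, Complex.ofReal_natCast, ← Complex.cpow_add _ _ hm0]
    congr 1; push_cast; ring
  set R : ℝ := ∑ m ∈ Finset.Icc 1 Y, (m:ℝ) ^ (-(1/2) : ℝ) with hR
  have hR1 : Real.sqrt Y ≤ R := by
    have hY0 : (0:ℝ) < Y := by exact_mod_cast hY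
    calc Real.sqrt Y = ∑ m ∈ Finset.Icc 1 Y, (Y:ℝ) ^ (-(1/2) : ℝ) := by
          rw [Finset.sum_const, Nat.card_Icc, nsmul_eq_mul, Real.sqrt_eq_rpow, Nat.add_sub_cancel]
          nth_rewrite 2 [← Real.rpow_one (Y:ℝ)]
          rw [← Real.rpow_add hY0]; norm_num
      _ ≤ R := by
          refine Finset.sum_le_sum fun m hm => ?_
          obtain ⟨h1, h2⟩ := Finset.mem_Icc.1 hm
          exact Real.rpow_le_rpow_of_nonpos (by exact_mod_cast h1) (by exact_mod_cast h2)
            (by norm_num)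
  rw [Finset.sum_congr rfl hterm, Finset.sum_add_distrib, ← Complex.ofReal_sum, ← hR]
  have herr : ‖∑ m ∈ Finset.Icc 1 Y, (((m:ℝ) ^ (-(1/2) : ℝ) : ℝ) : ℂ) *
        ((m:ℂ) ^ (-(((t - t₀ : ℝ) : ℂ) * I)) - 1)‖ ≤ R / 2 := by
    rw [hR, Finset.sum_div]
    refine norm_sum_le_of_le _ fun m hm => ?_
    obtain ⟨h1, h2⟩ := Finset.mem_Icc.1 hm
    rw [norm_mul, Complex.norm_real, Real.norm_of_nonneg (by positivity)]
    have hm : ‖(m:ℂ) ^ (-(((t - t₀ : ℝ) : ℂ) * I)) - 1‖ ≤ 1 / 2 := by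
      refine (norm_natCast_cpow_mul_I_sub_one_le h1 _).trans (le_trans ?_ ht)
      gcongr
    exact (mul_le_mul_of_nonneg_left hm (by positivity)).trans (le_of_eq (by ring))
  have hR0 : 0 ≤ R := (Real.sqrt_nonneg _).trans hR1
  have := norm_sub_le_norm_add (R:ℂ) (∑ m ∈ Finset.Icc 1 Y, (((m:ℝ) ^ (-(1/2) : ℝ) : ℝ) : ℂ) *
        ((m:ℂ) ^ (-(((t - t₀ : ℝ) : ℂ) * I)) - 1))
  rw [Complex.norm_real, Real.norm_of_nonneg hR0] at this
  linarith

lemma one_add_log_pow_le {κ : ℝ} (hκ : 0 < κ) (k : ℕ) :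
    ∃ C : ℝ, 0 < C ∧ ∀ T : ℝ, 1 ≤ T → (1 + Real.log T) ^ k ≤ C * T ^ κ := by
  rcases Nat.eq_zero_or_pos k with rfl | hk
  · refine ⟨1, one_pos, fun T hT => ?_⟩
    simpa using Real.one_le_rpow hT hκ.le
  have hk0 : (0:ℝ) < k := by exact_mod_cast hk
  refine ⟨(1 + k / κ) ^ k, by positivity, fun T hT => ?_⟩
  have hT0 : 0 ≤ T := by linarith
  have h1 : 1 + Real.log T ≤ (1 + k / κ) * T ^ (κ / k) := by
    have ha := Real.log_le_rpow_div hT0 (div_pos hκ hk0)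
    have hb : 1 ≤ T ^ (κ / k) := Real.one_le_rpow hT (by positivity)
    calc 1 + Real.log T ≤ T ^ (κ / k) + T ^ (κ / k) / (κ / k) := by linarith
      _ = _ := by field_simp
  calc (1 + Real.log T) ^ k ≤ ((1 + k / κ) * T ^ (κ / k)) ^ k := by
        have := Real.log_nonneg hT
        gcongr
    _ = _ := by
        rw [mul_pow, ← Real.rpow_natCast (T ^ (κ / k)), ← Real.rpow_mul hT0]
        congr 2; field_simp

/-- A subconvex bound for `ζ` on the critical line. -/
theorem norm_riemannZeta_half_le : ∃ C : ℝ, 0 < C ∧ ∀ t : ℝ, 2 ≤ t →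
    ‖riemannZeta ((1 / 2 : ℝ) + t * I)‖ ≤ C * t ^ (11 / 24 : ℝ) := by
  obtain ⟨C₁, hC₁, hlip⟩ := charSeries_riemannZeta.norm_sub_le (α := 1/2) (κ := 1/16)
    (by norm_num) (by norm_num) (by norm_num)
  obtain ⟨C₂, hC₂, hsup⟩ := charSeries_riemannZeta.norm_le_rpow (α := 1/2) (κ := 1/16)
    (by norm_num) (by norm_num) (by norm_num)
  obtain ⟨C₃, hC₃, hlog⟩ := one_add_log_pow_le (κ := 1/16) (by norm_num) 5
  set A : ℝ := 2 * (1 + C₁ + C₂) with hA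
  have hA0 : 0 < A := by positivity
  set B : ℝ := (16 * A * 200000 * 3 * 2 * C₃ + 1) with hB
  have hB1 : 1 ≤ B := by have : 0 ≤ 16 * A * 200000 * 3 * 2 * C₃ := by positivity
                         linarith
  have key : ∀ t : ℝ, 2 ≤ t → ‖riemannZeta ((1 / 2 : ℝ) + t * I)‖ ^ 3 ≤
      B * (2 * t) ^ (11 / 8 : ℝ) := by
    intro t₀ ht₀
    set T := 2 * t₀ with hT
    have hT4 : 4 ≤ T := by linarith
    have hT0 : 0 < T := by linarith
    have hLT : 0 ≤ Real.log T := Real.log_nonneg (by linarith)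
    set V := ‖riemannZeta ((1 / 2 : ℝ) + t₀ * I)‖ with hV
    have hV0 : 0 ≤ V := norm_nonneg _
    set Y := ⌊T ^ (1/4 : ℝ)⌋₊ with hYdef
    have hT14 : 1 ≤ T ^ (1/4 : ℝ) := Real.one_le_rpow (by linarith) (by norm_num)
    have hY : 1 ≤ Y := Nat.one_le_floor_iff _ |>.2 hT14
    have hYT : (Y:ℝ) ≤ T ^ (1/4 : ℝ) := Nat.floor_le (by positivity)
    have hY0 : (1:ℝ) ≤ Y := by exact_mod_cast hY
    have hYT2 : T ^ (1/4 : ℝ) ≤ 2 * Y := by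
      have := Nat.lt_floor_add_one (T ^ (1/4 : ℝ))
      linarith
    have hY4 : (Y:ℝ) ^ 4 ≤ T := by
      calc (Y:ℝ) ^ 4 ≤ (T ^ (1/4 : ℝ)) ^ 4 := by gcongr
        _ = T := by rw [← Real.rpow_natCast, ← Real.rpow_mul hT0.le]; norm_num
    have hYleT : (Y:ℝ) ≤ T := le_trans (by nlinarith [pow_le_pow_right₀ hY0 (show 1 ≤ 4 by norm_num)]) hY4
    have hLY0 : 0 ≤ Real.log Y := Real.log_natCast_nonneg Y
    have hLY : Real.log Y ≤ Real.log T := Real.log_le_log (by linarith) hYleT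
    set P := T ^ (1 - 1/2 + 1/16 : ℝ) with hP
    have hP0 : 0 < P := by positivity
    set Λ := A * P * (1 + Real.log T) with hΛ
    have hΛ0 : 0 < Λ := by positivity
    set δ := V / Λ with hδ
    have hδ0 : 0 ≤ δ := by positivity
    have hVle : V ≤ C₂ * P := by
      have := hsup ((1/2 : ℝ) + t₀ * I) (by simp) (by simp; norm_num) (by simp; linarith)
      refine this.trans ?_
      simp only [add_im, ofReal_im, mul_im, ofReal_re, I_im, mul_one, I_re, mul_zero, add_zero,
        zero_add]
      exact mul_le_mul_of_nonneg_left
        (Real.rpow_le_rpow (by linarith) (by linarith) (by norm_num)) hC₂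
    have hδle : δ * (1 + Real.log T) ≤ 1/2 := by
      have : δ * (1 + Real.log T) = V / (A * P) := by rw [hδ, hΛ]; field_simp
      rw [this, div_le_iff₀ (by positivity), hA]
      nlinarith
    have hδhalf : δ ≤ 1/2 := by nlinarith
    have hδV : C₁ * P * δ ≤ V / 2 := by
      have : δ ≤ V / (A * P) := by
        rw [hδ, hΛ]
        exact div_le_div_of_nonneg_left hV0 (by positivity)
          (le_mul_of_one_le_right (by positivity) (by linarith))
      calc C₁ * P * δ ≤ C₁ * P * (V / (A * P)) := by gcongr
        _ = (C₁ / A) * V := by field_simp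
        _ ≤ (1/2) * V := by
            refine mul_le_mul_of_nonneg_right ?_ hV0
            rw [div_le_iff₀ hA0, hA]; linarith
        _ = V / 2 := by ring
    set G : ℝ → ℝ := fun t => ‖riemannZeta ((1 / 2 : ℝ) + t * I) *
        ∑ m ∈ Finset.Icc 1 Y, (fun m : ℕ => (m:ℂ) ^ (t₀ * I)) m *
          (m:ℂ) ^ (-((1 / 2 : ℝ) + t * I))‖ ^ 2 with hG
    have hGc : Continuous G := by
      refine ((Continuous.mul ?_ ?_).norm).pow 2
      · refine continuous_iff_continuousAt.2 fun t => ?_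
        refine ContinuousAt.comp (f := fun t : ℝ => (((1 / 2 : ℝ) : ℂ) + t * I)) ?_ (by fun_prop)
        refine (differentiableAt_riemannZeta ?_).continuousAt
        intro h
        have := congrArg Complex.re h
        norm_num at this
      · refine continuous_finsetSum _ fun m hm => continuous_const.mul ?_
        refine Continuous.const_cpow (by fun_prop) (Or.inl ?_)
        have := (Finset.mem_Icc.1 hm).1
        exact_mod_cast (by omega : m ≠ 0)
    have hlow : ∀ t ∈ Icc t₀ (t₀ + δ), V ^ 2 * Y / 16 ≤ G t := by
      intro t ht
      have h1 : V / 2 ≤ ‖riemannZeta ((1 / 2 : ℝ) + t * I)‖ := by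
        have hh := hlip T ((1/2 : ℝ) + t₀ * I) ((1/2 : ℝ) + t * I) (by simp) (by simp; norm_num)
          (by simpa using ht₀) (by simp; linarith) (by simp) (by simp; norm_num)
          (by simp; linarith [ht.1]) (by simp; linarith [ht.2])
        have hd : ‖(((1/2 : ℝ) : ℂ) + t * I) - (((1/2 : ℝ) : ℂ) + t₀ * I)‖ = t - t₀ := by
          rw [show (((1/2 : ℝ) : ℂ) + t * I) - (((1/2 : ℝ) : ℂ) + t₀ * I) = ((t - t₀ : ℝ) : ℂ) * I by
            push_cast; ring, norm_mul, norm_I, mul_one, Complex.norm_real,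
            Real.norm_of_nonneg (by linarith [ht.1])]
        rw [hd] at hh
        have h3 : C₁ * P * (t - t₀) ≤ V / 2 :=
          le_trans (by have := ht.2; gcongr; linarith) hδV
        have h4 := norm_sub_norm_le (riemannZeta ((1 / 2 : ℝ) + t₀ * I))
          (riemannZeta ((1 / 2 : ℝ) + t * I))
        rw [norm_sub_rev] at h4
        rw [← hP] at hh
        linarith
      have h2 := sqrt_le_norm_amplifier hY (t₀ := t₀) (t := t) (by
        rw [abs_of_nonneg (by linarith [ht.1])]
        have := ht.2
        calc (t - t₀) * Real.log Y ≤ δ * (1 + Real.log T) := by gcongr <;> linarith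
          _ ≤ 1/2 := hδle)
      calc V ^ 2 * Y / 16 = (V / 2 * (Real.sqrt Y / 2)) ^ 2 := by
            rw [mul_pow, div_pow, div_pow, Real.sq_sqrt (by positivity)]; ring
        _ ≤ G t := by
            simp only [hG, norm_mul]
            gcongr
    have hInt : δ * (V ^ 2 * Y / 16) ≤ ∫ t in (1:ℝ)..T, G t := by
      calc δ * (V ^ 2 * Y / 16) = ∫ t in t₀..(t₀ + δ), V ^ 2 * Y / 16 := by
              rw [intervalIntegral.integral_const, smul_eq_mul, add_sub_cancel_left]
        _ ≤ ∫ t in t₀..(t₀ + δ), G t :=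
            intervalIntegral.integral_mono_on (by linarith) (by simp)
              (hGc.intervalIntegrable _ _) hlow
        _ ≤ _ := intervalIntegral.integral_mono_interval (by linarith) (by linarith) (by linarith)
              (ae_of_all _ fun t => by positivity) (hGc.intervalIntegrable _ _)
    have hb : ∀ m ∈ Finset.Icc 1 Y, ‖(m:ℂ) ^ (t₀ * I)‖ = 1 := fun m hm => by
      have := (Finset.mem_Icc.1 hm).1
      rw [Complex.norm_natCast_cpow_of_pos (by omega)]
      simp
    have hmom := integral_norm_sq_zeta_mul_le hY (Finset.Subset.refl (Finset.Icc 1 Y))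
      (fun m : ℕ => (m:ℂ) ^ (t₀ * I)) (T := T) (by linarith)
    have hW := gcdWeight_Icc_le (Y := Y) (b := fun m : ℕ => (m:ℂ) ^ (t₀ * I)) fun m hm => (hb m hm).le
    rw [Finset.sum_congr rfl hb] at hmom
    simp only [Finset.sum_const, Nat.card_Icc, Nat.add_sub_cancel, nsmul_eq_mul, mul_one] at hmom
    have hL1 : 1 ≤ 1 + Real.log T := by linarith
    have hup : δ * (V ^ 2 * Y / 16) ≤ 200000 * (3 * T * (1 + Real.log T) ^ 4) := by
      refine hInt.trans (hmom.trans ?_)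
      refine mul_le_mul_of_nonneg_left ?_ (by norm_num)
      have e1 : T * (Real.log T + Real.log Y) * gcdWeight (Finset.Icc 1 Y) (fun m : ℕ => (m:ℂ) ^ (t₀ * I))
          ≤ T * (2 * (1 + Real.log T)) * (1 + Real.log T) ^ 3 := by
        have : gcdWeight (Finset.Icc 1 Y) (fun m : ℕ => (m:ℂ) ^ (t₀ * I)) ≤ (1 + Real.log T) ^ 3 :=
          hW.trans (by gcongr)
        have h0 := gcdWeight_nonneg (Finset.Icc 1 Y) (fun m : ℕ => (m:ℂ) ^ (t₀ * I))
        gcongr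
        linarith
      have e2 : T ≤ T * (1 + Real.log T) ^ 4 :=
        le_mul_of_one_le_right hT0.le (one_le_pow₀ hL1)
      calc _ ≤ T * (2 * (1 + Real.log T)) * (1 + Real.log T) ^ 3 + T * (1 + Real.log T) ^ 4 := by
            refine add_le_add e1 (le_trans (le_of_eq (by ring)) (hY4.trans e2))
        _ = _ := by ring
    have hV3 : V ^ 3 * Y ≤ 16 * Λ * (200000 * (3 * T * (1 + Real.log T) ^ 4)) := by
      have : V ^ 3 * Y = 16 * Λ * (δ * (V ^ 2 * Y / 16)) := by rw [hδ]; field_simp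
      rw [this]; gcongr
    have hfin : V ^ 3 * T ^ (1/4 : ℝ) ≤ (16 * A * 200000 * 3 * 2 * C₃) * T ^ (11/8 : ℝ) * T ^ (1/4 : ℝ) := by
      have hp : P * T * T ^ (1/16 : ℝ) = T ^ (11/8 : ℝ) * T ^ (1/4 : ℝ) := by
        rw [hP]; nth_rewrite 2 [← Real.rpow_one T]
        rw [← Real.rpow_add hT0, ← Real.rpow_add hT0, ← Real.rpow_add hT0]; norm_num
      calc V ^ 3 * T ^ (1/4 : ℝ) ≤ V ^ 3 * (2 * Y) := by gcongr
        _ = 2 * (V ^ 3 * Y) := by ring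
        _ ≤ 2 * (16 * Λ * (200000 * (3 * T * (1 + Real.log T) ^ 4))) := by gcongr
        _ = (16 * A * 200000 * 3 * 2) * (P * T) * (1 + Real.log T) ^ 5 := by rw [hΛ]; ring
        _ ≤ (16 * A * 200000 * 3 * 2) * (P * T) * (C₃ * T ^ (1/16 : ℝ)) := by
            gcongr
            exact hlog T (by linarith)
        _ = (16 * A * 200000 * 3 * 2 * C₃) * (P * T * T ^ (1/16 : ℝ)) := by ring
        _ = _ := by rw [hp]; ring
    refine (le_of_mul_le_mul_right hfin (by positivity)).trans ?_
    gcongr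
    linarith
  refine ⟨B * 2, by positivity, fun t ht => ?_⟩
  have h := key t ht
  have ht0 : 0 ≤ t := by linarith
  refine le_of_pow_le_pow_left₀ (n := 3) (by norm_num) (by positivity) (h.trans ?_)
  have e1 : (t ^ (11 / 24 : ℝ)) ^ 3 = t ^ (11 / 8 : ℝ) := by
    rw [← Real.rpow_natCast, ← Real.rpow_mul ht0]; norm_num
  have e2 : (2:ℝ) ^ (11/8 : ℝ) ≤ 2 ^ 3 := by
    rw [← Real.rpow_natCast]; exact Real.rpow_le_rpow_of_exponent_le (by norm_num) (by norm_num)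
  rw [mul_pow, mul_pow, e1, Real.mul_rpow (by norm_num) ht0]
  calc B * (2 ^ (11/8 : ℝ) * t ^ (11/8 : ℝ)) = B ^ 1 * 2 ^ (11/8 : ℝ) * t ^ (11/8 : ℝ) := by ring
    _ ≤ B ^ 3 * 2 ^ 3 * t ^ (11/8 : ℝ) := by
        gcongr <;> norm_num [hB1]

end Subconvexity

section DirichletPolynomials
open MeasureTheory Set Filter Topology

lemma exists_card_divisors_le {ε : ℝ} (hε : 0 < ε) :
    ∃ C : ℝ, 1 ≤ C ∧ ∀ n : ℕ, (n.divisors.card : ℝ) ≤ C * (n:ℝ) ^ ε := by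
  set B : ℕ := ⌈(2:ℝ) ^ (1 / ε)⌉₊ with hB
  have hl2 : 0 < Real.log 2 := Real.log_pos (by norm_num)
  set K : ℝ := 1 + 1 / (ε * Real.log 2) with hK
  have hK1 : 1 ≤ K := by rw [hK]; have : 0 < 1 / (ε * Real.log 2) := by positivity
                         linarith
  have hprime : ∀ p : ℕ, p.Prime → ∀ v : ℕ,
      ((v + 1 : ℕ) : ℝ) ≤ (if p < B then K else 1) * ((p:ℝ) ^ v) ^ ε := by
    intro p hp v
    have hp0 : (0:ℝ) < p := by exact_mod_cast hp.pos
    have hswap : ((p:ℝ) ^ v) ^ ε = ((p:ℝ) ^ ε) ^ v := by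
      rw [← Real.rpow_natCast, ← Real.rpow_natCast, ← Real.rpow_mul hp0.le,
        ← Real.rpow_mul hp0.le, mul_comm]
    split_ifs with h
    · have h2 : (2:ℝ) ≤ p := by exact_mod_cast hp.two_le
      have h3 : 1 + v * (ε * Real.log 2) ≤ ((p:ℝ) ^ v) ^ ε := by
        calc 1 + v * (ε * Real.log 2) ≤ Real.exp (v * (ε * Real.log 2)) := by
              linarith [Real.add_one_le_exp (v * (ε * Real.log 2))]
          _ = ((2:ℝ) ^ ε) ^ v := by
              rw [Real.rpow_def_of_pos (by norm_num), ← Real.exp_nat_mul]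
              ring_nf
          _ ≤ ((p:ℝ) ^ ε) ^ v := by gcongr
          _ = _ := hswap.symm
      have h4 : ((v + 1 : ℕ) : ℝ) ≤ K * (1 + v * (ε * Real.log 2)) := by
        have e : K * (1 + v * (ε * Real.log 2)) =
            v + 1 + v * (ε * Real.log 2) + 1 / (ε * Real.log 2) := by
          rw [hK]; field_simp; ring
        rw [e]; push_cast
        have : 0 ≤ v * (ε * Real.log 2) + 1 / (ε * Real.log 2) := by positivity
        linarith
      exact h4.trans (mul_le_mul_of_nonneg_left h3 (by linarith))
    · have h2 : (2:ℝ) ≤ (p:ℝ) ^ ε := by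
        have h3 : (2:ℝ) ^ (1 / ε) ≤ p := (Nat.le_ceil _).trans (by exact_mod_cast not_lt.1 h)
        calc (2:ℝ) = ((2:ℝ) ^ (1 / ε)) ^ ε := by
              rw [← Real.rpow_mul (by norm_num), one_div_mul_cancel hε.ne', Real.rpow_one]
          _ ≤ _ := Real.rpow_le_rpow (by positivity) h3 hε.le
      rw [one_mul, hswap]
      calc ((v + 1 : ℕ) : ℝ) ≤ ((2 ^ v : ℕ) : ℝ) := by
            exact_mod_cast Nat.lt_two_pow_self
        _ ≤ _ := by push_cast; gcongr
  refine ⟨K ^ B, one_le_pow₀ hK1, fun n => ?_⟩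
  rcases eq_or_ne n 0 with rfl | hn
  · simp only [Nat.divisors_zero, Finset.card_empty, Nat.cast_zero]; positivity
  rw [Nat.card_divisors hn]
  push_cast
  calc ∏ p ∈ n.primeFactors, ((n.factorization p : ℝ) + 1)
      ≤ ∏ p ∈ n.primeFactors, (if p < B then K else 1) * ((p:ℝ) ^ n.factorization p) ^ ε := by
        refine Finset.prod_le_prod (fun p _ => by positivity) fun p hp => ?_
        exact_mod_cast hprime p (Nat.prime_of_mem_primeFactors hp) _
    _ = (∏ p ∈ n.primeFactors, if p < B then K else 1) * (n:ℝ) ^ ε := by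
        rw [Finset.prod_mul_distrib, Real.finsetProd_rpow _ _ fun p _ => by positivity]
        congr 2
        exact_mod_cast Nat.prod_factorization_pow_eq_self hn
    _ ≤ K ^ B * (n:ℝ) ^ ε := by
        gcongr
        rw [← Finset.prod_filter, Finset.prod_const]
        refine pow_le_pow_right₀ hK1 ?_
        calc _ ≤ (Finset.range B).card := Finset.card_le_card fun p hp => by
              simpa using (Finset.mem_filter.1 hp).2
          _ = B := Finset.card_range B

open ArithmeticFunction in
lemma exists_zeta_pow_le {ε : ℝ} (hε : 0 < ε) (j : ℕ) :
    ∃ C : ℝ, 1 ≤ C ∧ ∀ n : ℕ, ((((zeta : ArithmeticFunction ℕ) ^ j) n : ℕ) : ℝ) ≤ C * (n:ℝ) ^ ε := by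
  induction j generalizing ε with
  | zero =>
    refine ⟨1, le_rfl, fun n => ?_⟩
    rw [pow_zero, one_apply]
    split_ifs with h
    · simp [h]
    · simp only [Nat.cast_zero]; positivity
  | succ j ih =>
    obtain ⟨C, hC, h⟩ := ih (half_pos hε)
    obtain ⟨D, hD, hd⟩ := exists_card_divisors_le (half_pos hε)
    refine ⟨C * D, by nlinarith, fun n => ?_⟩
    rcases eq_or_ne n 0 with rfl | hn
    · simp only [ArithmeticFunction.map_zero, Nat.cast_zero]; positivity
    have hn0 : (0:ℝ) < n := by exact_mod_cast Nat.pos_of_ne_zero hn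
    rw [pow_succ', zeta_mul_apply]
    push_cast
    calc ∑ d ∈ n.divisors, ((((zeta : ArithmeticFunction ℕ) ^ j) d : ℕ) : ℝ)
        ≤ ∑ d ∈ n.divisors, C * (n:ℝ) ^ (ε / 2) := by
          refine Finset.sum_le_sum fun d hd => (h d).trans ?_
          have : (d:ℝ) ≤ n := by exact_mod_cast Nat.divisor_le hd
          gcongr
      _ = n.divisors.card * (C * (n:ℝ) ^ (ε / 2)) := by rw [Finset.sum_const, nsmul_eq_mul]
      _ ≤ (D * (n:ℝ) ^ (ε / 2)) * (C * (n:ℝ) ^ (ε / 2)) := by gcongr; exact hd n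
      _ = C * D * ((n:ℝ) ^ (ε / 2) * (n:ℝ) ^ (ε / 2)) := by ring
      _ = _ := by rw [← Real.rpow_add hn0, add_halves]

/-- `f` is supported in `(A, X]` and dominated by the `j`-fold divisor function. -/
structure DivisorBounded (j : ℕ) (f : ArithmeticFunction ℂ) (A X : ℕ) : Prop where
  supp : ∀ n, f n ≠ 0 → A < n ∧ n ≤ X
  norm_le : ∀ n, ‖f n‖ ≤ (((ArithmeticFunction.zeta : ArithmeticFunction ℕ) ^ j) n : ℕ)

lemma DivisorBounded.one : DivisorBounded 0 1 0 1 where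
  supp n hn := by
    rw [ArithmeticFunction.one_apply] at hn
    split_ifs at hn with h
    · omega
    · exact absurd rfl hn
  norm_le n := by
    rw [pow_zero, ArithmeticFunction.one_apply, ArithmeticFunction.one_apply]
    split_ifs <;> simp

lemma DivisorBounded.mul {j l : ℕ} {f g : ArithmeticFunction ℂ} {A B X Z : ℕ}
    (hf : DivisorBounded j f A X) (hg : DivisorBounded l g B Z) :
    DivisorBounded (j + l) (f * g) (A * B) (X * Z) where
  supp n hn := by
    rw [ArithmeticFunction.mul_apply] at hn
    obtain ⟨⟨d, e⟩, hde, h⟩ := Finset.exists_ne_zero_of_sum_ne_zero hn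
    obtain ⟨hd1, hd2⟩ := hf.supp d (left_ne_zero_of_mul h)
    obtain ⟨he1, he2⟩ := hg.supp e (right_ne_zero_of_mul h)
    rw [← (Nat.mem_divisorsAntidiagonal.1 hde).1]
    exact ⟨Nat.mul_lt_mul'' hd1 he1, Nat.mul_le_mul hd2 he2⟩
  norm_le n := by
    rw [pow_add, ArithmeticFunction.mul_apply, ArithmeticFunction.mul_apply]
    push_cast
    refine norm_sum_le_of_le _ fun p _ => ?_
    rw [norm_mul]
    exact mul_le_mul (hf.norm_le _) (hg.norm_le _) (norm_nonneg _) (by positivity)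

lemma DivisorBounded.pow {j : ℕ} {f : ArithmeticFunction ℂ} {A X : ℕ}
    (hf : DivisorBounded j f A X) {k : ℕ} (hk : 1 ≤ k) :
    DivisorBounded (j * k) (f ^ k) (A ^ k) (X ^ k) := by
  induction k, hk using Nat.le_induction with
  | base => simpa using hf
  | succ k _ ih => simpa only [pow_succ, mul_add, mul_one] using ih.mul hf

/-- The value at `1 + it` of the Dirichlet series with coefficients `f`. -/
noncomputable def oneLineSeries (f : ArithmeticFunction ℂ) (t : ℝ) : ℂ :=
  LSeries (fun n => f n) (1 + t * I)

lemma DivisorBounded.oneLineSeries_eq {j : ℕ} {f : ArithmeticFunction ℂ} {A X : ℕ}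
    (hf : DivisorBounded j f A X) (t : ℝ) :
    oneLineSeries f t = ∑ n ∈ Finset.Ioc A X, f n * (n:ℂ) ^ (-(1 + t * I)) := by
  rw [oneLineSeries, LSeries, tsum_eq_sum (s := Finset.Ioc A X)]
  · exact Finset.sum_congr rfl fun n _ => LSeries.term_def₀ (by simp) _ _
  · intro n hn
    rw [LSeries.term_def₀ (by simp)]
    by_contra h
    exact hn (Finset.mem_Ioc.2 (hf.supp n (left_ne_zero_of_mul h)))

lemma DivisorBounded.lseriesSummable {j : ℕ} {f : ArithmeticFunction ℂ} {A X : ℕ}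
    (hf : DivisorBounded j f A X) (s : ℂ) : LSeriesSummable (fun n => f n) s := by
  refine summable_of_ne_finset_zero (s := Finset.Ioc A X) fun n hn => ?_
  rw [LSeries.term_def₀ (by simp)]
  by_contra h
  exact hn (Finset.mem_Ioc.2 (hf.supp n (left_ne_zero_of_mul h)))

lemma DivisorBounded.oneLineSeries_mul {j l : ℕ} {f g : ArithmeticFunction ℂ} {A B X Z : ℕ}
    (hf : DivisorBounded j f A X) (hg : DivisorBounded l g B Z) (t : ℝ) :
    oneLineSeries (f * g) t = oneLineSeries f t * oneLineSeries g t :=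
  ArithmeticFunction.LSeries_mul' (hf.lseriesSummable _) (hg.lseriesSummable _)

lemma DivisorBounded.oneLineSeries_pow {j : ℕ} {f : ArithmeticFunction ℂ} {A X : ℕ}
    (hf : DivisorBounded j f A X) {k : ℕ} (hk : 1 ≤ k) (t : ℝ) :
    oneLineSeries (f ^ k) t = oneLineSeries f t ^ k := by
  induction k, hk using Nat.le_induction with
  | base => simp
  | succ k hk ih => rw [pow_succ, (hf.pow hk).oneLineSeries_mul hf, ih, pow_succ]

lemma DivisorBounded.continuous {j : ℕ} {f : ArithmeticFunction ℂ} {A X : ℕ}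
    (hf : DivisorBounded j f A X) : Continuous (oneLineSeries f) := by
  rw [funext hf.oneLineSeries_eq]
  refine continuous_finsetSum _ fun n hn => continuous_const.mul ?_
  refine Continuous.const_cpow (by fun_prop) (Or.inl ?_)
  have := (Finset.mem_Ioc.1 hn).1
  exact_mod_cast (by omega : n ≠ 0)

/-- Mean square of a Dirichlet polynomial all of whose frequencies exceed the length of
integration. -/
theorem DivisorBounded.exists_integral_norm_sq_le (j m : ℕ) {κ : ℝ} (hκ : 0 < κ) :
    ∃ C : ℝ, 0 ≤ C ∧ ∀ (f : ArithmeticFunction ℂ) (A X : ℕ), DivisorBounded j f A X →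
      ∀ T : ℝ, 2 ≤ T → T ≤ A → (X:ℝ) ≤ T ^ m →
        ∫ t in (-T)..T, ‖oneLineSeries f t‖ ^ 2 ≤ C * T ^ κ := by
  set ε : ℝ := κ / (4 * (m + 1)) with hε
  have hε0 : 0 < ε := by positivity
  obtain ⟨D, hD, hd⟩ := exists_zeta_pow_le hε0 j
  obtain ⟨E, hE, he⟩ := one_add_log_pow_le (half_pos hκ) 1
  refine ⟨320 * Real.exp 3 * (2 * D ^ 2 * ((m + 1) * E)), by positivity,
    fun f A X hf T hT hTA hXT => ?_⟩
  have hT0 : 0 < T := by linarith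
  have hT1 : 1 ≤ T := by linarith
  have hLT := Real.log_nonneg hT1
  have hT2 : 1 ≤ T ^ (κ / 2) := Real.one_le_rpow hT1 (by positivity)
  simp only [hf.oneLineSeries_eq]
  refine (integral_norm_sq_dirichletPoly_le _ (fun n hn => by
    have := (Finset.mem_Ioc.1 hn).1; omega) _ hT1).trans ?_
  rw [mul_assoc (320 * Real.exp 3)]
  refine mul_le_mul_of_nonneg_left ?_ (by positivity)
  have hterm : ∀ n ∈ Finset.Ioc A X, ‖f n‖ ^ 2 * (n:ℝ) ^ (-2:ℝ) * (T + n) ≤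
      2 * D ^ 2 * T ^ (κ / 2) * (n:ℝ)⁻¹ := by
    intro n hn
    obtain ⟨h1, h2⟩ := Finset.mem_Ioc.1 hn
    have hn0 : (0:ℝ) < n := by exact_mod_cast (by omega : 0 < n)
    have hTn : T ≤ n := hTA.trans (by exact_mod_cast h1.le)
    have hnX : (n:ℝ) ≤ T ^ m := le_trans (by exact_mod_cast h2) hXT
    have hnε : ((n:ℝ) ^ ε) ^ 2 ≤ T ^ (κ / 2) := by
      calc ((n:ℝ) ^ ε) ^ 2 ≤ ((T ^ m) ^ ε) ^ 2 := by gcongr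
        _ = T ^ (m * ε * 2) := by
            rw [← Real.rpow_natCast T m, ← Real.rpow_mul hT0.le, ← Real.rpow_natCast,
              ← Real.rpow_mul hT0.le]; norm_num
        _ ≤ T ^ (κ / 2) := by
            refine Real.rpow_le_rpow_of_exponent_le hT1 ?_
            have : (m + 1) * ε * 2 = κ / 2 := by rw [hε]; field_simp; norm_num
            nlinarith
    have hfn : ‖f n‖ ^ 2 ≤ D ^ 2 * T ^ (κ / 2) := by
      calc ‖f n‖ ^ 2 ≤ (D * (n:ℝ) ^ ε) ^ 2 := by
            gcongr; exact (hf.norm_le n).trans (hd n)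
        _ = D ^ 2 * ((n:ℝ) ^ ε) ^ 2 := by ring
        _ ≤ _ := by gcongr
    calc ‖f n‖ ^ 2 * (n:ℝ) ^ (-2:ℝ) * (T + n)
        ≤ D ^ 2 * T ^ (κ / 2) * (n:ℝ) ^ (-2:ℝ) * (2 * n) := by gcongr; linarith
      _ = _ := by
          rw [Real.rpow_neg hn0.le, Real.rpow_two]; field_simp
  refine (Finset.sum_le_sum hterm).trans ?_
  rw [← Finset.mul_sum]
  have hX0 : 0 ≤ Real.log X := Real.log_natCast_nonneg X
  have hlogX : 1 + Real.log X ≤ (m + 1) * (1 + Real.log T) := by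
    have : Real.log X ≤ m * Real.log T := by
      rcases Nat.eq_zero_or_pos X with rfl | hX
      · simp; positivity
      · rw [← Real.log_pow]
        exact Real.log_le_log (by exact_mod_cast hX) hXT
    have hm : (0:ℝ) ≤ m := Nat.cast_nonneg m
    nlinarith
  have hsum : ∑ n ∈ Finset.Ioc A X, (n:ℝ)⁻¹ ≤ (m + 1) * (E * T ^ (κ / 2)) := by
    calc ∑ n ∈ Finset.Ioc A X, (n:ℝ)⁻¹ ≤ ∑ n ∈ Finset.Icc 1 X, (n:ℝ)⁻¹ :=
          Finset.sum_le_sum_of_subset_of_nonneg (fun n hn => by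
            have := Finset.mem_Ioc.1 hn
            exact Finset.mem_Icc.2 ⟨by omega, this.2⟩) fun _ _ _ => by positivity
      _ ≤ 1 + Real.log X := sum_Icc_inv_le X
      _ ≤ (m + 1) * (1 + Real.log T) := hlogX
      _ ≤ (m + 1) * (E * T ^ (κ / 2)) := by
          gcongr
          simpa using he T hT1
  calc 2 * D ^ 2 * T ^ (κ / 2) * ∑ n ∈ Finset.Ioc A X, (n:ℝ)⁻¹
      ≤ 2 * D ^ 2 * T ^ (κ / 2) * ((m + 1) * (E * T ^ (κ / 2))) := by gcongr
    _ = 2 * D ^ 2 * ((m + 1) * E) * (T ^ (κ / 2) * T ^ (κ / 2)) := by ring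
    _ = _ := by rw [← Real.rpow_add hT0, add_halves];

end DirichletPolynomials

section Mollifier
open MeasureTheory Set Filter Topology

/-- The coefficients `a n` truncated to `n ≤ N`. -/
noncomputable def truncatedSeries (a : ℕ → ℂ) (N : ℕ) : ArithmeticFunction ℂ :=
  ⟨fun n => if n ≠ 0 ∧ n ≤ N then a n else 0, by simp⟩

/-- The truncated Dirichlet inverse `μ(n) a(n)`, `n ≤ Y`. -/
noncomputable def mollifier (a : ℕ → ℂ) (Y : ℕ) : ArithmeticFunction ℂ :=
  ⟨fun n => if n ≤ Y then (ArithmeticFunction.moebius n : ℂ) * a n else 0, by simp⟩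

/-- The defect of `mollifier a Y` from being a Dirichlet inverse of `truncatedSeries a N`. -/
noncomputable def mollifierDefect (a : ℕ → ℂ) (N Y : ℕ) : ArithmeticFunction ℂ :=
  truncatedSeries a N * mollifier a Y - 1

lemma CharSeries.divisorBounded_truncatedSeries {a F ρ} (h : CharSeries a F ρ) (N : ℕ) :
    DivisorBounded 1 (truncatedSeries a N) 0 N where
  supp n hn := by
    simp only [truncatedSeries, ArithmeticFunction.coe_mk] at hn
    split_ifs at hn with h
    · omega
    · exact absurd rfl hn
  norm_le n := by
    rw [pow_one, ArithmeticFunction.zeta_apply]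
    simp only [truncatedSeries, ArithmeticFunction.coe_mk]
    split_ifs with h1 h2
    · omega
    · simpa using h.norm_le n
    · simp
    · simp

lemma CharSeries.divisorBounded_mollifier {a F ρ} (h : CharSeries a F ρ) (Y : ℕ) :
    DivisorBounded 1 (mollifier a Y) 0 Y where
  supp n hn := by
    rcases Nat.eq_zero_or_pos n with rfl | h0
    · exact absurd (ArithmeticFunction.map_zero) hn
    simp only [mollifier, ArithmeticFunction.coe_mk] at hn
    split_ifs at hn with h
    · omega
    · exact absurd rfl hn
  norm_le n := by
    rcases Nat.eq_zero_or_pos n with rfl | h0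
    · simp
    rw [pow_one, ArithmeticFunction.zeta_apply_ne h0.ne']
    simp only [mollifier, ArithmeticFunction.coe_mk]
    split_ifs
    · rw [norm_mul, Complex.norm_intCast, Nat.cast_one]
      have h1 : |((ArithmeticFunction.moebius n : ℤ) : ℝ)| ≤ 1 := by
        exact_mod_cast ArithmeticFunction.abs_moebius_le_one
      exact mul_le_one₀ h1 (norm_nonneg _) (h.norm_le n)
    · simp

lemma CharSeries.mollifierDefect_eq_zero {a F ρ} (h : CharSeries a F ρ) {N Y n : ℕ} (hYN : Y ≤ N)
    (hn : n ≤ Y) : mollifierDefect a N Y n = 0 := by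
  have key : (truncatedSeries a N * mollifier a Y) n = a n * (1 : ArithmeticFunction ℂ) n := by
    rw [← ArithmeticFunction.coe_zeta_mul_coe_moebius (R := ℂ), ArithmeticFunction.mul_apply,
      ArithmeticFunction.mul_apply, Finset.mul_sum]
    refine Finset.sum_congr rfl fun p hp => ?_
    obtain ⟨hp1, hp2⟩ := Nat.mem_divisorsAntidiagonal.1 hp
    have h1 : p.1 ≠ 0 := by rintro h; simp [h] at hp1; omega
    have h2 : p.2 ≠ 0 := by rintro h; simp [h] at hp1; omega
    have h3 : p.1 ≤ n := hp1 ▸ Nat.le_mul_of_pos_right _ (Nat.pos_of_ne_zero h2)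
    have h4 : p.2 ≤ n := hp1 ▸ Nat.le_mul_of_pos_left _ (Nat.pos_of_ne_zero h1)
    simp only [truncatedSeries, mollifier, ArithmeticFunction.coe_mk,
      ArithmeticFunction.natCoe_apply, ArithmeticFunction.intCoe_apply]
    rw [if_pos ⟨h1, by omega⟩, if_pos (by omega), ArithmeticFunction.zeta_apply_ne h1, ← hp1,
      h.map_mul]
    push_cast
    ring
  rw [mollifierDefect, sub_eq_add_neg, ArithmeticFunction.add_apply, key]
  rw [ArithmeticFunction.neg_apply, ArithmeticFunction.one_apply]
  split_ifs with h1
  · simp [h1, h.map_one]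
  · simp

lemma CharSeries.mollifierDefect_of_lt {a : ℕ → ℂ} {N Y n : ℕ} (hY : 1 ≤ Y)
    (hn : Y < n) : mollifierDefect a N Y n = (truncatedSeries a N * mollifier a Y) n := by
  rw [mollifierDefect, sub_eq_add_neg, ArithmeticFunction.add_apply, ArithmeticFunction.neg_apply,
    ArithmeticFunction.one_apply_ne (by omega), neg_zero, add_zero]

lemma CharSeries.divisorBounded_mollifierDefect {a F ρ} (h : CharSeries a F ρ) {N Y : ℕ}
    (hY : 1 ≤ Y) (hYN : Y ≤ N) : DivisorBounded 2 (mollifierDefect a N Y) Y (N * Y) where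
  supp n hn := by
    have h1 : Y < n := by
      by_contra h1
      exact hn (h.mollifierDefect_eq_zero hYN (not_lt.1 h1))
    rw [mollifierDefect_of_lt hY h1] at hn
    exact ⟨h1, (((h.divisorBounded_truncatedSeries N).mul (h.divisorBounded_mollifier Y)).supp n hn).2⟩
  norm_le n := by
    rcases le_or_gt n Y with h1 | h1
    · rw [h.mollifierDefect_eq_zero hYN h1]; simp
    · rw [mollifierDefect_of_lt hY h1]
      exact ((h.divisorBounded_truncatedSeries N).mul (h.divisorBounded_mollifier Y)).norm_le n

lemma CharSeries.oneLineSeries_mollifierDefect {a F ρ} (h : CharSeries a F ρ) (N Y : ℕ) (t : ℝ) :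
    oneLineSeries (mollifierDefect a N Y) t =
      oneLineSeries (truncatedSeries a N) t * oneLineSeries (mollifier a Y) t - 1 := by
  have hA := h.divisorBounded_truncatedSeries N
  have hM := h.divisorBounded_mollifier Y
  rw [← hA.oneLineSeries_mul hM]
  have h1 : oneLineSeries 1 t = 1 := by
    rw [DivisorBounded.one.oneLineSeries_eq]; simp
  conv_rhs => rw [← h1]
  exact LSeries_sub ((hA.mul hM).lseriesSummable _) (DivisorBounded.one.lseriesSummable _)

lemma CharSeries.norm_oneLineSeries_mollifier_le {a F ρ} (h : CharSeries a F ρ) (Y : ℕ) (t : ℝ) :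
    ‖oneLineSeries (mollifier a Y) t‖ ≤ 1 + Real.log Y := by
  have hM := h.divisorBounded_mollifier Y
  rw [hM.oneLineSeries_eq]
  refine le_trans (norm_sum_le_of_le _ fun n hn => ?_) (sum_Icc_inv_le Y)
  have hn1 := (Finset.mem_Ioc.1 hn).1
  rw [norm_mul, norm_natCast_cpow_neg n hn1]
  have hb := hM.norm_le n
  rw [pow_one, ArithmeticFunction.zeta_apply_ne (by omega), Nat.cast_one] at hb
  have : (n:ℝ) ^ (-(1 + t * I : ℂ).re) = (n:ℝ)⁻¹ := by
    rw [← Real.rpow_neg_one]; simp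
  rw [this]
  exact mul_le_of_le_one_left (by positivity) hb

/-- On the one-line, either the mollifier controls the inverse, or the defect is not small. -/
theorem CharSeries.norm_inv_le_or {a F ρ} (h : CharSeries a F ρ) {T : ℝ} (hT : 2 ^ 28 ≤ T) {Y : ℕ}
    (hYT : (Y:ℝ) ≤ T) {t : ℝ} (ht1 : Real.sqrt T ≤ t) (ht2 : t ≤ 2 * T) :
    ‖(F (1 + t * I))⁻¹‖ ≤ 2 * ‖oneLineSeries (mollifier a Y) t‖ ∨
      1 / 4 ≤ ‖oneLineSeries (mollifierDefect a ⌈T ^ 2⌉₊ Y) t‖ := by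
  set M := oneLineSeries (mollifier a Y) t with hM
  set Q := oneLineSeries (mollifierDefect a ⌈T ^ 2⌉₊ Y) t with hQ
  set N := ⌈T ^ 2⌉₊ with hN
  by_contra! hcon
  obtain ⟨hc1, hc2⟩ := hcon
  have hT0 : 0 < T := by linarith [show (0:ℝ) < 2 ^ 28 by norm_num]
  have hT1 : 1 ≤ T := by linarith [show (1:ℝ) ≤ 2 ^ 28 by norm_num]
  have hN0 : T ^ 2 ≤ N := Nat.le_ceil _
  have hN1 : 1 ≤ N := by
    have : (1:ℝ) ≤ N := by nlinarith
    exact_mod_cast this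
  set r := T ^ (1 / 4 : ℝ) with hr
  have hr4 : r ^ 4 = T := by rw [hr, ← Real.rpow_natCast, ← Real.rpow_mul hT0.le]; norm_num
  have hr0 : 0 < r := by positivity
  have hr128 : 128 ≤ r := by
    refine le_of_pow_le_pow_left₀ (n := 4) (by norm_num) hr0.le ?_
    rw [hr4]; norm_num at hT ⊢; exact hT
  have hsq : Real.sqrt T = r ^ 2 := by
    rw [← hr4, show r ^ 4 = (r ^ 2) ^ 2 by ring, Real.sqrt_sq (by positivity)]
  rw [hsq] at ht1
  have ht0 : 1 ≤ t := by nlinarith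
  have herr := h.norm_one_line_sub_sum_le hN1 ht0
  have hA : oneLineSeries (truncatedSeries a N) t =
      ∑ n ∈ Finset.Icc 1 N, a n * (n:ℂ) ^ (-(1 + t * I : ℂ)) := by
    rw [(h.divisorBounded_truncatedSeries N).oneLineSeries_eq]
    refine Finset.sum_congr (by ext; simp [Finset.mem_Ioc, Finset.mem_Icc, Nat.succ_le_iff]) fun n hn => ?_
    have := Finset.mem_Icc.1 hn
    simp only [truncatedSeries, ArithmeticFunction.coe_mk]
    rw [if_pos ⟨by omega, this.2⟩]
  rw [← hA] at herr
  set A := oneLineSeries (truncatedSeries a N) t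
  have herr2 : ‖F (1 + t * I) - A‖ ≤ 4 / r ^ 2 := by
    refine herr.trans ?_
    have e1 : 1 / t ≤ 1 / r ^ 2 := one_div_le_one_div_of_le (by positivity) ht1
    have e2 : (1 + t) / N ≤ 3 / r ^ 2 := by
      calc (1 + t) / N ≤ (3 * T) / T ^ 2 := by
            gcongr; linarith
        _ = 3 / r ^ 4 := by rw [hr4]; field_simp
        _ ≤ 3 / r ^ 2 := by
            gcongr
            · linarith
            · norm_num
    calc _ ≤ 1 / r ^ 2 + 3 / r ^ 2 := add_le_add e1 e2
      _ = _ := by ring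
  have hMle : ‖M‖ ≤ 5 * r := by
    refine (h.norm_oneLineSeries_mollifier_le Y t).trans ?_
    have h1 : Real.log Y ≤ Real.log T := by
      rcases Nat.eq_zero_or_pos Y with rfl | hY
      · simpa using Real.log_nonneg hT1
      · exact Real.log_le_log (by exact_mod_cast hY) hYT
    have h2 := Real.log_le_rpow_div hT0.le (show (0:ℝ) < 1/4 by norm_num)
    rw [← hr] at h2
    linarith
  have hFM : F (1 + t * I) * M = 1 + (Q + (F (1 + t * I) - A) * M) := by
    rw [hQ, h.oneLineSeries_mollifierDefect]; ring
  have hsmall : ‖Q + (F (1 + t * I) - A) * M‖ ≤ 1 / 2 := by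
    have : ‖(F (1 + t * I) - A) * M‖ ≤ 1 / 4 := by
      rw [norm_mul]
      calc ‖F (1 + t * I) - A‖ * ‖M‖ ≤ 4 / r ^ 2 * (5 * r) := by gcongr
        _ = 20 / r := by field_simp; norm_num
        _ ≤ 1 / 4 := by rw [div_le_div_iff₀ hr0 (by norm_num)]; linarith
    linarith [norm_add_le Q ((F (1 + t * I) - A) * M)]
  have hlow : 1 / 2 ≤ ‖F (1 + t * I)‖ * ‖M‖ := by
    rw [← norm_mul, hFM]
    have := norm_sub_le_norm_add (1:ℂ) (Q + (F (1 + t * I) - A) * M)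
    rw [norm_one] at this
    linarith
  have hF0 : 0 < ‖F (1 + t * I)‖ := by
    rcases (norm_nonneg (F (1 + t * I))).eq_or_lt with h0 | h0
    · rw [← h0] at hlow; norm_num at hlow
    · exact h0
  have hM0 : 0 < ‖M‖ := by
    rcases (norm_nonneg M).eq_or_lt with h0 | h0
    · rw [← h0] at hlow; norm_num at hlow
    · exact h0
  rw [norm_inv, lt_inv_comm₀ (by positivity) hF0] at hc1
  have : ‖F (1 + t * I)‖ * ‖M‖ < (2 * ‖M‖)⁻¹ * ‖M‖ := by gcongr
  rw [mul_inv, mul_assoc, inv_mul_cancel₀ hM0.ne'] at this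
  linarith

/-- High moments of the mollifier defect. -/
theorem CharSeries.exists_integral_norm_defect_le {k : ℕ} (hk : 1 ≤ k) {κ : ℝ} (hκ : 0 < κ) :
    ∃ C : ℝ, 0 ≤ C ∧ ∀ (a : ℕ → ℂ) (F : ℂ → ℂ) (ρ : ℂ), CharSeries a F ρ → ∀ T : ℝ, 2 ≤ T → ∀ Y : ℕ,
      (Y:ℝ) ≤ T → 2 * T ≤ (Y:ℝ) ^ k →
      ∫ t in (-(2 * T))..(2 * T), (‖oneLineSeries (mollifierDefect a ⌈T ^ 2⌉₊ Y) t‖ ^ k) ^ 2 ≤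
        C * T ^ κ := by
  obtain ⟨C, hC, h⟩ := DivisorBounded.exists_integral_norm_sq_le (2 * k) (4 * k) hκ
  refine ⟨C * 2 ^ κ, by positivity, fun a F ρ hF T hT Y hYT hTY => ?_⟩
  have hY : 1 ≤ Y := by
    rcases Nat.eq_zero_or_pos Y with rfl | hY
    · rw [Nat.cast_zero, zero_pow (by omega)] at hTY; linarith
    · exact hY
  have hN : T ^ 2 ≤ (⌈T ^ 2⌉₊ : ℝ) := Nat.le_ceil _
  have hN2 : (⌈T ^ 2⌉₊ : ℝ) ≤ 2 * T ^ 2 := by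
    have := (Nat.ceil_lt_add_one (show 0 ≤ T ^ 2 by positivity)).le
    nlinarith
  have hYN : Y ≤ ⌈T ^ 2⌉₊ := by
    have : (Y:ℝ) ≤ ⌈T ^ 2⌉₊ := by nlinarith
    exact_mod_cast this
  have hb := hF.divisorBounded_mollifierDefect hY hYN
  have hmain := h _ _ _ (hb.pow hk) (2 * T) (by linarith) (by push_cast; exact hTY) (by
    push_cast
    rw [pow_mul]
    refine pow_le_pow_left₀ (by positivity) ?_ k
    calc (⌈T ^ 2⌉₊ : ℝ) * Y ≤ 2 * T ^ 2 * T := by gcongr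
      _ ≤ (2 * T) ^ 4 := by nlinarith [show 0 < T ^ 3 by positivity])
  simp only [hb.oneLineSeries_pow hk, norm_pow] at hmain
  refine hmain.trans (le_of_eq ?_)
  rw [Real.mul_rpow (by norm_num) (by linarith)]; ring

end Mollifier

section TwistedMollifier
open MeasureTheory Set Filter Topology

lemma sum_dvd_rpow_le {X d : ℕ} (hd : 1 ≤ d) {α : ℝ} (hα : 1 < α) :
    ∑ n ∈ (Finset.Ioc 0 X).filter (fun n => d ∣ n), (n:ℝ) ^ (-α) ≤
      (d:ℝ) ^ (-α) * ∑' k : ℕ, (k:ℝ) ^ (-α) := by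
  have h1 : ∑ n ∈ (Finset.Ioc 0 X).filter (fun n => d ∣ n), (n:ℝ) ^ (-α) ≤
      ∑ n ∈ (Finset.Icc 1 X).image (fun k => d * k), (n:ℝ) ^ (-α) := by
    refine Finset.sum_le_sum_of_subset_of_nonneg ?_ fun _ _ _ => by positivity
    intro n hn
    obtain ⟨hn1, c, rfl⟩ := Finset.mem_filter.1 hn
    obtain ⟨h0, hX⟩ := Finset.mem_Ioc.1 hn1
    refine Finset.mem_image.2 ⟨c, Finset.mem_Icc.2 ⟨Nat.pos_of_mul_pos_left h0, ?_⟩, rfl⟩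
    exact (Nat.le_mul_of_pos_left c hd).trans hX
  refine h1.trans ?_
  rw [Finset.sum_image fun x _ y _ hxy => Nat.eq_of_mul_eq_mul_left hd hxy]
  simp only [Nat.cast_mul, Real.mul_rpow (Nat.cast_nonneg d) (Nat.cast_nonneg _)]
  rw [← Finset.mul_sum]
  gcongr
  exact (Real.summable_nat_rpow.2 (by linarith)).sum_le_tsum _ fun _ _ => by positivity

lemma exists_sum_sum_div_lcm_sq_le (D : ℝ) :
    ∃ C : ℝ, 0 ≤ C ∧ ∀ (X : ℕ) (g : ℕ → ℂ), (∀ n, ‖g n‖ ≤ D * (n:ℝ) ^ (1 / 8 : ℝ)) →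
      ∑ m ∈ Finset.Ioc 0 X, ∑ n ∈ Finset.Ioc 0 X,
        ‖g m‖ * ‖g n‖ / ((m ^ 2).lcm (n ^ 2) : ℕ) ≤ C := by
  set Z : ℝ := ∑' k : ℕ, (k:ℝ) ^ (-(15/8) : ℝ) with hZ
  set Z' : ℝ := ∑' k : ℕ, (k:ℝ) ^ (-(7/4) : ℝ) with hZ'
  have hZ0 : 0 ≤ Z := tsum_nonneg fun k => by positivity
  have hZ0' : 0 ≤ Z' := tsum_nonneg fun k => by positivity
  refine ⟨D ^ 2 * Z ^ 2 * Z', by positivity, fun X g hg => ?_⟩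
  have hD : 0 ≤ D := by
    have := (norm_nonneg _).trans (hg 1)
    simpa using this
  have hpair : ∀ m ∈ Finset.Ioc 0 X, ∀ n ∈ Finset.Ioc 0 X,
      ‖g m‖ * ‖g n‖ / ((m ^ 2).lcm (n ^ 2) : ℕ) ≤
        ∑ d ∈ Finset.Ioc 0 X, D ^ 2 * ((d:ℝ) ^ 2 * ((if d ∣ m then (m:ℝ) ^ (-(15/8) : ℝ) else 0) *
          (if d ∣ n then (n:ℝ) ^ (-(15/8) : ℝ) else 0))) := by
    intro m hm n hn
    obtain ⟨hm1, hm2⟩ := Finset.mem_Ioc.1 hm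
    obtain ⟨hn1, hn2⟩ := Finset.mem_Ioc.1 hn
    have hg' : m.gcd n ∈ Finset.Ioc 0 X :=
      Finset.mem_Ioc.2 ⟨Nat.gcd_pos_of_pos_left _ hm1, (Nat.gcd_le_left _ hm1).trans hm2⟩
    have hm0 : (0:ℝ) < m := by exact_mod_cast hm1
    have hn0 : (0:ℝ) < n := by exact_mod_cast hn1
    have hl0 : (0:ℝ) < ((m ^ 2).lcm (n ^ 2) : ℕ) := by
      exact_mod_cast Nat.lcm_pos (by positivity) (by positivity)
    have hgl : ((m.gcd n : ℕ) : ℝ) ^ 2 * ((m ^ 2).lcm (n ^ 2) : ℕ) = (m:ℝ) ^ 2 * (n:ℝ) ^ 2 := by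
      have := Nat.gcd_mul_lcm (m ^ 2) (n ^ 2)
      rw [Nat.pow_gcd_pow] at this
      exact_mod_cast this
    have hinv : (((m ^ 2).lcm (n ^ 2) : ℕ) : ℝ)⁻¹ =
        ((m.gcd n : ℕ) : ℝ) ^ 2 * ((m:ℝ) ^ (-2:ℝ) * (n:ℝ) ^ (-2:ℝ)) := by
      rw [Real.rpow_neg hm0.le, Real.rpow_neg hn0.le, Real.rpow_two, Real.rpow_two]
      field_simp
      linarith
    have hpow : ∀ x : ℝ, 0 < x → x ^ (1/8 : ℝ) * x ^ (-2:ℝ) = x ^ (-(15/8) : ℝ) := fun x hx => by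
      rw [← Real.rpow_add hx]; norm_num
    calc ‖g m‖ * ‖g n‖ / ((m ^ 2).lcm (n ^ 2) : ℕ)
        ≤ (D * (m:ℝ) ^ (1/8 : ℝ)) * (D * (n:ℝ) ^ (1/8 : ℝ)) / ((m ^ 2).lcm (n ^ 2) : ℕ) := by
          gcongr
          · exact hg m
          · exact hg n
      _ = D ^ 2 * (((m.gcd n : ℕ) : ℝ) ^ 2 * (((m:ℝ) ^ (1/8 : ℝ) * (m:ℝ) ^ (-2:ℝ)) *
          ((n:ℝ) ^ (1/8 : ℝ) * (n:ℝ) ^ (-2:ℝ)))) := by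
          rw [div_eq_mul_inv, hinv]; ring
      _ = D ^ 2 * (((m.gcd n : ℕ) : ℝ) ^ 2 * ((if m.gcd n ∣ m then (m:ℝ) ^ (-(15/8) : ℝ) else 0) *
          (if m.gcd n ∣ n then (n:ℝ) ^ (-(15/8) : ℝ) else 0))) := by
          rw [if_pos (Nat.gcd_dvd_left m n), if_pos (Nat.gcd_dvd_right m n), hpow _ hm0, hpow _ hn0]
      _ ≤ _ := Finset.single_le_sum (f := fun d : ℕ => D ^ 2 * ((d:ℝ) ^ 2 *
          ((if d ∣ m then (m:ℝ) ^ (-(15/8) : ℝ) else 0) *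
          (if d ∣ n then (n:ℝ) ^ (-(15/8) : ℝ) else 0)))) (fun d _ => by positivity) hg'
  calc _ ≤ ∑ m ∈ Finset.Ioc 0 X, ∑ n ∈ Finset.Ioc 0 X, ∑ d ∈ Finset.Ioc 0 X,
        D ^ 2 * ((d:ℝ) ^ 2 * ((if d ∣ m then (m:ℝ) ^ (-(15/8) : ℝ) else 0) *
          (if d ∣ n then (n:ℝ) ^ (-(15/8) : ℝ) else 0))) :=
        Finset.sum_le_sum fun m hm => Finset.sum_le_sum fun n hn => hpair m hm n hn
    _ = ∑ d ∈ Finset.Ioc 0 X, D ^ 2 * ((d:ℝ) ^ 2 *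
          (∑ m ∈ Finset.Ioc 0 X, if d ∣ m then (m:ℝ) ^ (-(15/8) : ℝ) else 0) ^ 2) := by
        rw [Finset.sum_congr rfl fun m _ => Finset.sum_comm, Finset.sum_comm]
        refine Finset.sum_congr rfl fun d _ => ?_
        rw [sq (∑ m ∈ Finset.Ioc 0 X, _), Finset.sum_mul_sum, Finset.mul_sum, Finset.mul_sum]
        refine Finset.sum_congr rfl fun m _ => ?_
        rw [Finset.mul_sum, Finset.mul_sum]
    _ ≤ ∑ d ∈ Finset.Ioc 0 X, D ^ 2 * Z ^ 2 * (d:ℝ) ^ (-(7/4) : ℝ) := by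
        refine Finset.sum_le_sum fun d hd => ?_
        have hd1 := (Finset.mem_Ioc.1 hd).1
        have hd0 : (0:ℝ) < d := by exact_mod_cast hd1
        rw [← Finset.sum_filter]
        calc D ^ 2 * ((d:ℝ) ^ 2 *
              (∑ m ∈ (Finset.Ioc 0 X).filter (fun n => d ∣ n), (m:ℝ) ^ (-(15/8) : ℝ)) ^ 2)
            ≤ D ^ 2 * ((d:ℝ) ^ 2 * ((d:ℝ) ^ (-(15/8) : ℝ) * Z) ^ 2) := by
              gcongr; exact sum_dvd_rpow_le hd1 (by norm_num)
          _ = D ^ 2 * Z ^ 2 * ((d:ℝ) ^ (2:ℝ) * ((d:ℝ) ^ (-(15/8) : ℝ) * (d:ℝ) ^ (-(15/8) : ℝ))) := by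
              rw [Real.rpow_two]; ring
          _ = _ := by rw [← Real.rpow_add hd0, ← Real.rpow_add hd0]; norm_num
    _ ≤ D ^ 2 * Z ^ 2 * Z' := by
        rw [← Finset.mul_sum]
        gcongr
        exact (Real.summable_nat_rpow.2 (by norm_num)).sum_le_tsum _ fun _ _ => by positivity

/-- Second moment of `ζ` on the critical line against a short Dirichlet polynomial in `2s`. -/
theorem exists_integral_norm_sq_zeta_mul_oneLineSeries_le :
    ∃ C : ℝ, 0 ≤ C ∧ ∀ (g : ArithmeticFunction ℂ) (Y : ℕ), 1 ≤ Y → DivisorBounded 5 g 0 (Y ^ 5) →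
      ∀ T : ℝ, 2 ≤ T → (Y:ℝ) ^ 40 ≤ T →
        ∫ u in (1:ℝ)..T, ‖riemannZeta ((1 / 2 : ℝ) + u * I) * oneLineSeries g (2 * u)‖ ^ 2 ≤
          C * (T * Real.log T) := by
  obtain ⟨D, hD, hd⟩ := exists_zeta_pow_le (show (0:ℝ) < 1/8 by norm_num) 5
  obtain ⟨W, hW, hw⟩ := exists_sum_sum_div_lcm_sq_le D
  refine ⟨200000 * (2 * W + 2 * D ^ 2), by positivity, fun g Y hY hg T hT hYT => ?_⟩
  have hgD : ∀ n, ‖g n‖ ≤ D * (n:ℝ) ^ (1/8 : ℝ) := fun n => (hg.norm_le n).trans (hd n)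
  have hY1 : (1:ℝ) ≤ Y := by exact_mod_cast hY
  set S : Finset ℕ := (Finset.Ioc 0 (Y ^ 5)).image (fun n => n ^ 2) with hS
  have hinj : ∀ x ∈ Finset.Ioc 0 (Y ^ 5), ∀ y ∈ Finset.Ioc 0 (Y ^ 5), x ^ 2 = y ^ 2 → x = y :=
    fun x _ y _ h => Nat.pow_left_injective (n := 2) (by norm_num) h
  have hSsub : S ⊆ Finset.Icc 1 (Y ^ 10) := by
    intro m hm
    obtain ⟨n, hn, rfl⟩ := Finset.mem_image.1 hm
    obtain ⟨h1, h2⟩ := Finset.mem_Ioc.1 hn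
    refine Finset.mem_Icc.2 ⟨Nat.one_le_pow _ _ h1, ?_⟩
    calc n ^ 2 ≤ (Y ^ 5) ^ 2 := by gcongr
      _ = Y ^ 10 := by ring
  have hmain := integral_norm_sq_zeta_mul_le (Nat.one_le_pow 10 Y hY) hSsub
    (fun m => g (Nat.sqrt m)) hT
  have hpoly : ∀ u : ℝ, ∑ m ∈ S, g (Nat.sqrt m) * (m:ℂ) ^ (-((1 / 2 : ℝ) + u * I)) =
      oneLineSeries g (2 * u) := by
    intro u
    rw [hg.oneLineSeries_eq, hS, Finset.sum_image hinj]
    refine Finset.sum_congr rfl fun n hn => ?_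
    rw [Nat.sqrt_eq', Nat.cast_pow, ← Complex.natCast_cpow_natCast_mul]
    congr 2
    push_cast; ring
  simp only [hpoly] at hmain
  refine hmain.trans ?_
  have hgw : gcdWeight S (fun m => g (Nat.sqrt m)) ≤ W := by
    rw [gcdWeight, hS, Finset.sum_image hinj]
    simp only [Finset.sum_image hinj, Nat.sqrt_eq']
    exact hw _ _ hgD
  have hsum : ∑ m ∈ S, ‖g (Nat.sqrt m)‖ ≤ D * (Y:ℝ) ^ 10 := by
    rw [hS, Finset.sum_image hinj]
    simp only [Nat.sqrt_eq']
    calc ∑ n ∈ Finset.Ioc 0 (Y ^ 5), ‖g n‖ ≤ ∑ n ∈ Finset.Ioc 0 (Y ^ 5), D * (Y:ℝ) ^ 5 := by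
          refine Finset.sum_le_sum fun n hn => (hgD n).trans ?_
          obtain ⟨h1, h2⟩ := Finset.mem_Ioc.1 hn
          have h3 : (1:ℝ) ≤ n := by exact_mod_cast h1
          gcongr
          calc (n:ℝ) ^ (1/8 : ℝ) ≤ (n:ℝ) ^ (1:ℝ) :=
                Real.rpow_le_rpow_of_exponent_le h3 (by norm_num)
            _ ≤ _ := by rw [Real.rpow_one]; exact_mod_cast h2
      _ = _ := by rw [Finset.sum_const, Nat.card_Ioc, nsmul_eq_mul, Nat.sub_zero]; push_cast; ring
  have hlogT : 1 / 2 ≤ Real.log T :=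
    (by linarith [Real.log_two_gt_d9] : (1:ℝ) / 2 ≤ Real.log 2).trans
      (Real.log_le_log (by norm_num) hT)
  have hlogY : Real.log ((Y ^ 10 : ℕ) : ℝ) ≤ Real.log T := by
    push_cast
    refine Real.log_le_log (by positivity) (le_trans ?_ hYT)
    exact pow_le_pow_right₀ hY1 (by norm_num)
  have h0 := gcdWeight_nonneg S (fun m => g (Nat.sqrt m))
  have hT0 : 0 ≤ T := by linarith
  have e1 : T * (Real.log T + Real.log ((Y ^ 10 : ℕ) : ℝ)) * gcdWeight S (fun m => g (Nat.sqrt m)) ≤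
      T * (2 * Real.log T) * W := by
    gcongr
    linarith
  have e2 : ((Y ^ 10 : ℕ) : ℝ) ^ 2 * (∑ m ∈ S, ‖g (Nat.sqrt m)‖) ^ 2 ≤ 2 * D ^ 2 * (T * Real.log T) := by
    calc ((Y ^ 10 : ℕ) : ℝ) ^ 2 * (∑ m ∈ S, ‖g (Nat.sqrt m)‖) ^ 2
        ≤ ((Y ^ 10 : ℕ) : ℝ) ^ 2 * (D * (Y:ℝ) ^ 10) ^ 2 := by gcongr
      _ = D ^ 2 * (Y:ℝ) ^ 40 := by push_cast; ring
      _ ≤ D ^ 2 * T := by gcongr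
      _ ≤ D ^ 2 * (2 * (T * Real.log T)) := by gcongr; nlinarith
      _ = _ := by ring
  calc _ ≤ 200000 * (T * (2 * Real.log T) * W + 2 * D ^ 2 * (T * Real.log T)) := by
        gcongr
    _ = _ := by ring

end TwistedMollifier

section CriticalLine
open MeasureTheory Set Filter Topology

/-- The Dirichlet `L`-function of the quadratic character modulo `3`. -/
noncomputable abbrev lThree : ℂ → ℂ := DirichletCharacter.LFunction chiThree

lemma CharSeries.exists_norm_inv_one_line_le {a F ρ} (h : CharSeries a F ρ)
    (h341 : ∀ κ : ℝ, 0 < κ → ∃ C : ℝ, 0 ≤ C ∧ ∀ x : ℝ, 0 < x → x ≤ 1 / 2 → ∀ t : ℝ, 2 ≤ t →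
      x ^ 3 ≤ C * ‖F (1 + x + t * I)‖ ^ 4 * t ^ κ) {κ : ℝ} (hκ : 0 < κ) :
    ∃ C : ℝ, 0 < C ∧ ∀ t : ℝ, 2 ≤ t → F (1 + t * I) ≠ 0 ∧ ‖(F (1 + t * I))⁻¹‖ ≤ C * t ^ κ := by
  obtain ⟨C, hC, hb⟩ := h.one_le_norm_one_line h341 hκ
  refine ⟨C, hC, fun t ht => ?_⟩
  have h1 := hb t ht
  have h0 : F (1 + t * I) ≠ 0 := by
    intro h0
    rw [h0] at h1; norm_num at h1
  refine ⟨h0, ?_⟩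
  rw [norm_inv]
  exact (inv_le_iff_one_le_mul₀ (norm_pos_iff.2 h0)).2 h1

/-- The integrand on the critical line, with `s = (1/2 + iu)`. -/
noncomputable def criticalIntegrand (u : ℝ) : ℝ :=
  ‖riemannZeta ((1 / 2 : ℝ) + u * I)‖ * ‖lThree ((1 / 2 : ℝ) + u * I)‖ *
    (‖(riemannZeta (1 + (2 * u : ℝ) * I))⁻¹‖ ^ 3 * ‖(lThree (1 + (2 * u : ℝ) * I))⁻¹‖ ^ 2)

lemma CharSeries.continuous_half_line {a F ρ} (h : CharSeries a F ρ) :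
    Continuous fun u : ℝ => F ((1 / 2 : ℝ) + u * I) := by
  refine continuous_iff_continuousAt.2 fun u => ?_
  refine ContinuousAt.comp (f := fun u : ℝ => (((1 / 2 : ℝ) : ℂ) + u * I)) ?_ (by fun_prop)
  refine (h.differentiableAt _ fun h => ?_).continuousAt
  have := congrArg Complex.re h
  norm_num at this

lemma CharSeries.continuousOn_inv_one_line {a F ρ} (h : CharSeries a F ρ)
    (h341 : ∀ κ : ℝ, 0 < κ → ∃ C : ℝ, 0 ≤ C ∧ ∀ x : ℝ, 0 < x → x ≤ 1 / 2 → ∀ t : ℝ, 2 ≤ t →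
      x ^ 3 ≤ C * ‖F (1 + x + t * I)‖ ^ 4 * t ^ κ) :
    ContinuousOn (fun u : ℝ => (F (1 + (2 * u : ℝ) * I))⁻¹) (Ici 1) := by
  obtain ⟨C, hC, hb⟩ := h.exists_norm_inv_one_line_le h341 one_pos
  refine ContinuousOn.inv₀ (fun u hu => ContinuousAt.continuousWithinAt ?_) fun u hu =>
    (hb (2 * u) (by have : 1 ≤ u := hu; linarith)).1
  refine ContinuousAt.comp (f := fun u : ℝ => ((1 : ℂ) + (2 * u : ℝ) * I)) ?_ (by fun_prop)
  refine (h.differentiableAt _ fun h => ?_).continuousAt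
  have h1 := congrArg Complex.im h
  have : 1 ≤ u := hu
  simp at h1
  linarith

lemma continuousOn_criticalIntegrand : ContinuousOn criticalIntegrand (Ici 1) := by
  unfold criticalIntegrand
  refine ContinuousOn.mul ?_ (ContinuousOn.mul ?_ ?_)
  · exact (charSeries_riemannZeta.continuous_half_line.norm.mul
      charSeries_chiThree.continuous_half_line.norm).continuousOn
  · exact (charSeries_riemannZeta.continuousOn_inv_one_line
      fun _ hκ => riemannZeta_three_four_one hκ).norm.pow 3
  · exact (charSeries_chiThree.continuousOn_inv_one_line
      fun _ hκ => chiThree_three_four_one hκ).norm.pow 2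

lemma intervalIntegrable_criticalIntegrand {a b : ℝ} (ha : 1 ≤ a) (hb : 1 ≤ b) :
    IntervalIntegrable criticalIntegrand volume a b :=
  (continuousOn_criticalIntegrand.mono fun _ hx =>
    (le_min ha hb).trans (Set.mem_Icc.1 hx).1).intervalIntegrable

lemma exists_integral_norm_zeta_mul_lThree_le :
    ∃ C : ℝ, 0 ≤ C ∧ ∀ T : ℝ, 2 ≤ T → ∫ u in (1:ℝ)..T, ‖riemannZeta ((1 / 2 : ℝ) + u * I)‖ *
      ‖lThree ((1 / 2 : ℝ) + u * I)‖ ≤ C * (T * Real.log T) := by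
  obtain ⟨C₁, hC₁, h1⟩ := charSeries_riemannZeta.integral_norm_sq_le (α := 1/2) le_rfl
  obtain ⟨C₂, hC₂, h2⟩ := charSeries_chiThree.integral_norm_sq_le (α := 1/2) le_rfl
  refine ⟨C₁ + C₂, by positivity, fun T hT => ?_⟩
  have hc1 := charSeries_riemannZeta.continuous_half_line.norm
  have hc2 := charSeries_chiThree.continuous_half_line.norm
  calc _ ≤ ∫ u in (1:ℝ)..T, (‖riemannZeta ((1 / 2 : ℝ) + u * I)‖ ^ 2 +
        ‖lThree ((1 / 2 : ℝ) + u * I)‖ ^ 2) := by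
        refine intervalIntegral.integral_mono_on (by linarith)
          ((hc1.mul hc2).intervalIntegrable _ _)
          (((hc1.pow 2).add (hc2.pow 2)).intervalIntegrable _ _) fun u _ => ?_
        nlinarith [sq_nonneg (‖riemannZeta ((1 / 2 : ℝ) + u * I)‖ - ‖lThree ((1 / 2 : ℝ) + u * I)‖),
          norm_nonneg (riemannZeta ((1 / 2 : ℝ) + u * I)), norm_nonneg (lThree ((1 / 2 : ℝ) + u * I)),
          mul_nonneg (norm_nonneg (riemannZeta ((1 / 2 : ℝ) + u * I)))
            (norm_nonneg (lThree ((1 / 2 : ℝ) + u * I)))]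
    _ ≤ C₁ * (T * Real.log T) + C₂ * (T * Real.log T) := by
        have hi1 : IntervalIntegrable (fun u : ℝ => ‖riemannZeta ((1 / 2 : ℝ) + u * I)‖ ^ 2)
          volume 1 T := (hc1.pow 2).intervalIntegrable _ _
        have hi2 : IntervalIntegrable (fun u : ℝ => ‖lThree ((1 / 2 : ℝ) + u * I)‖ ^ 2)
          volume 1 T := (hc2.pow 2).intervalIntegrable _ _
        rw [intervalIntegral.integral_add hi1 hi2]
        exact add_le_add (h1 T hT) (h2 T hT)
    _ = _ := by ring

lemma exists_inv_factor_le {κ : ℝ} (hκ : 0 < κ) : ∃ C : ℝ, 0 < C ∧ ∀ u : ℝ, 1 ≤ u →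
    ‖(riemannZeta (1 + (2 * u : ℝ) * I))⁻¹‖ ^ 3 * ‖(lThree (1 + (2 * u : ℝ) * I))⁻¹‖ ^ 2 ≤
      C * u ^ κ := by
  obtain ⟨C₁, hC₁, h1⟩ := charSeries_riemannZeta.exists_norm_inv_one_line_le
      (fun _ hκ => riemannZeta_three_four_one hκ) (show 0 < κ / 5 by positivity)
  obtain ⟨C₂, hC₂, h2⟩ := charSeries_chiThree.exists_norm_inv_one_line_le
      (fun _ hκ => chiThree_three_four_one hκ) (show 0 < κ / 5 by positivity)
  refine ⟨C₁ ^ 3 * C₂ ^ 2 * 2 ^ κ, by positivity, fun u hu => ?_⟩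
  have hu0 : 0 ≤ u := by linarith
  have e : ((2 * u) ^ (κ / 5)) ^ 5 = 2 ^ κ * u ^ κ := by
    rw [← Real.rpow_natCast, ← Real.rpow_mul (by positivity), ← Real.mul_rpow (by norm_num) hu0]
    norm_num
  calc _ ≤ (C₁ * (2 * u) ^ (κ / 5)) ^ 3 * (C₂ * (2 * u) ^ (κ / 5)) ^ 2 := by
        gcongr
        · exact (h1 (2 * u) (by linarith)).2
        · exact (h2 (2 * u) (by linarith)).2
    _ = C₁ ^ 3 * C₂ ^ 2 * ((2 * u) ^ (κ / 5)) ^ 5 := by ring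
    _ = _ := by rw [e]; ring

lemma exists_integral_criticalIntegrand_le_rpow {κ : ℝ} (hκ : 0 < κ) :
    ∃ C : ℝ, 0 ≤ C ∧ ∀ T : ℝ, 2 ≤ T →
      ∫ u in (1:ℝ)..T, criticalIntegrand u ≤ C * T ^ κ * (T * Real.log T) := by
  obtain ⟨C₁, hC₁, h1⟩ := exists_integral_norm_zeta_mul_lThree_le
  obtain ⟨C₂, hC₂, h2⟩ := exists_inv_factor_le hκ
  refine ⟨C₂ * C₁, by positivity, fun T hT => ?_⟩
  have hc1 := charSeries_riemannZeta.continuous_half_line.norm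
  have hc2 := charSeries_chiThree.continuous_half_line.norm
  calc _ ≤ ∫ u in (1:ℝ)..T, C₂ * T ^ κ * (‖riemannZeta ((1 / 2 : ℝ) + u * I)‖ *
      ‖lThree ((1 / 2 : ℝ) + u * I)‖) := by
        refine intervalIntegral.integral_mono_on (by linarith)
          (intervalIntegrable_criticalIntegrand le_rfl (by linarith))
          ((continuous_const.mul (hc1.mul hc2)).intervalIntegrable _ _) fun u hu => ?_
        rw [criticalIntegrand, mul_comm]
        refine mul_le_mul_of_nonneg_right ((h2 u hu.1).trans ?_) (by positivity)
        have := hu.1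
        have := hu.2
        gcongr
    _ ≤ C₂ * T ^ κ * (C₁ * (T * Real.log T)) := by
        rw [intervalIntegral.integral_const_mul]
        gcongr
        exact h1 T hT
    _ = _ := by ring

end CriticalLine

section CriticalLineMean
open MeasureTheory Set Filter Topology

lemma one_le_pow_of_quarter_le {x : ℝ} (hx : 1 / 4 ≤ x) (k : ℕ) :
    1 ≤ 16 ^ k * (x ^ k) ^ 2 := by
  have h : (16:ℝ) ^ k * (x ^ k) ^ 2 = ((4 * x) ^ 2) ^ k := by
    rw [← pow_mul x, mul_comm k 2, pow_mul x, ← mul_pow]; ring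
  rw [h]
  exact one_le_pow₀ (by nlinarith)

/-- Pointwise bound for the critical integrand in terms of mollified values, apart from
heights where the mollifier fails. -/
lemma exists_criticalIntegrand_le (k : ℕ) : ∃ B : ℝ, 0 ≤ B ∧ ∀ T : ℝ, 2 ^ 28 ≤ T → ∀ Y : ℕ,
    (Y:ℝ) ≤ T → ∀ u : ℝ, Real.sqrt T ≤ u → u ≤ T →
    criticalIntegrand u ≤
      16 * (‖riemannZeta ((1 / 2 : ℝ) + u * I) * oneLineSeries
        (mollifier (fun _ => 1) Y ^ 3 * mollifier (fun n => chiThree (n : ZMod 3)) Y ^ 2) (2 * u)‖ ^ 2 +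
        ‖lThree ((1 / 2 : ℝ) + u * I)‖ ^ 2) +
      B * T ^ (47 / 48 : ℝ) *
        ((‖oneLineSeries (mollifierDefect (fun _ => 1) ⌈T ^ 2⌉₊ Y) (2 * u)‖ ^ k) ^ 2 +
         (‖oneLineSeries (mollifierDefect (fun n => chiThree (n : ZMod 3)) ⌈T ^ 2⌉₊ Y) (2 * u)‖ ^ k) ^ 2) := by
  obtain ⟨C₁, hC₁, h1⟩ := norm_riemannZeta_half_le
  obtain ⟨C₂, hC₂, h2⟩ := charSeries_chiThree.norm_le_rpow (α := 1/2) (κ := 1/96)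
    (by norm_num) (by norm_num) (by norm_num)
  obtain ⟨C₃, hC₃, h3⟩ := exists_inv_factor_le (κ := 1/96) (by norm_num)
  refine ⟨C₁ * C₂ * C₃ * 16 ^ k, by positivity, fun T hT Y hYT u hu1 hu2 => ?_⟩
  have hu2' : 2 ≤ u := by
    refine le_trans ?_ hu1
    rw [Real.le_sqrt (by norm_num) (by linarith [show (0:ℝ) < 2 ^ 28 by norm_num])]
    exact le_trans (by norm_num) hT
  have hu0 : 0 < u := by linarith
  have hT0 : 0 < T := by linarith
  set q₁ := ‖oneLineSeries (mollifierDefect (fun _ => 1) ⌈T ^ 2⌉₊ Y) (2 * u)‖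
  set q₂ := ‖oneLineSeries (mollifierDefect (fun n => chiThree (n : ZMod 3)) ⌈T ^ 2⌉₊ Y) (2 * u)‖
  set z := ‖riemannZeta ((1 / 2 : ℝ) + u * I)‖ with hz
  set l := ‖lThree ((1 / 2 : ℝ) + u * I)‖ with hl
  have hb1 := charSeries_riemannZeta.divisorBounded_mollifier Y
  have hb2 := charSeries_chiThree.divisorBounded_mollifier Y
  have hM : oneLineSeries (mollifier (fun _ => 1) Y ^ 3 *
      mollifier (fun n => chiThree (n : ZMod 3)) Y ^ 2) (2 * u) =
      oneLineSeries (mollifier (fun _ => 1) Y) (2 * u) ^ 3 *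
        oneLineSeries (mollifier (fun n => chiThree (n : ZMod 3)) Y) (2 * u) ^ 2 := by
    rw [(hb1.pow (k := 3) (by norm_num)).oneLineSeries_mul (hb2.pow (k := 2) (by norm_num)),
      hb1.oneLineSeries_pow (by norm_num), hb2.oneLineSeries_pow (by norm_num)]
  have hbad : 1 ≤ 16 ^ k * ((q₁ ^ k) ^ 2 + (q₂ ^ k) ^ 2) → criticalIntegrand u ≤
      C₁ * C₂ * C₃ * 16 ^ k * T ^ (47 / 48 : ℝ) * ((q₁ ^ k) ^ 2 + (q₂ ^ k) ^ 2) := by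
    intro hq
    have e1 : criticalIntegrand u ≤ C₁ * u ^ (11/24 : ℝ) * (C₂ * u ^ (1 - 1/2 + 1/96 : ℝ)) *
        (C₃ * u ^ (1/96 : ℝ)) := by
      rw [criticalIntegrand]
      have g1 := h1 u hu2'
      have g2 := h2 ((1 / 2 : ℝ) + u * I) (by simp) (by simp; norm_num) (by simp; linarith)
      have g3 := h3 u (by linarith)
      simp only [add_im, ofReal_im, mul_im, ofReal_re, I_im, mul_one, I_re, mul_zero, add_zero,
        zero_add] at g2
      gcongr
    have e2 : C₁ * u ^ (11/24 : ℝ) * (C₂ * u ^ (1 - 1/2 + 1/96 : ℝ)) * (C₃ * u ^ (1/96 : ℝ)) =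
        C₁ * C₂ * C₃ * u ^ (47/48 : ℝ) := by
      have : u ^ (47/48 : ℝ) = u ^ (11/24 : ℝ) * u ^ (1 - 1/2 + 1/96 : ℝ) * u ^ (1/96 : ℝ) := by
        rw [← Real.rpow_add hu0, ← Real.rpow_add hu0]; norm_num
      rw [this]; ring
    calc criticalIntegrand u ≤ C₁ * C₂ * C₃ * u ^ (47/48 : ℝ) := e1.trans e2.le
      _ ≤ C₁ * C₂ * C₃ * T ^ (47/48 : ℝ) * 1 := by rw [mul_one]; gcongr
      _ ≤ C₁ * C₂ * C₃ * T ^ (47/48 : ℝ) * (16 ^ k * ((q₁ ^ k) ^ 2 + (q₂ ^ k) ^ 2)) := by gcongr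
      _ = _ := by ring
  have hpos1 : 0 ≤ 16 * (‖riemannZeta ((1 / 2 : ℝ) + u * I) * oneLineSeries
        (mollifier (fun _ => 1) Y ^ 3 * mollifier (fun n => chiThree (n : ZMod 3)) Y ^ 2) (2 * u)‖ ^ 2 +
        l ^ 2) := by positivity
  have hpos2 : 0 ≤ C₁ * C₂ * C₃ * 16 ^ k * T ^ (47 / 48 : ℝ) * ((q₁ ^ k) ^ 2 + (q₂ ^ k) ^ 2) := by
    positivity
  have hs1 : Real.sqrt T ≤ 2 * u := by linarith
  rcases charSeries_riemannZeta.norm_inv_le_or hT hYT hs1 (by linarith) with ha | ha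
  · rcases charSeries_chiThree.norm_inv_le_or hT hYT hs1 (by linarith) with hc | hc
    · refine le_add_of_le_of_nonneg ?_ hpos2
      rw [hM]
      set m₁ := oneLineSeries (mollifier (fun _ => 1) Y) (2 * u)
      set m₂ := oneLineSeries (mollifier (fun n => chiThree (n : ZMod 3)) Y) (2 * u)
      calc criticalIntegrand u ≤ z * l * ((2 * ‖m₁‖) ^ 3 * (2 * ‖m₂‖) ^ 2) := by
            rw [criticalIntegrand]
            gcongr
        _ = 16 * (2 * (z * (‖m₁‖ ^ 3 * ‖m₂‖ ^ 2)) * l) := by ring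
        _ ≤ 16 * ((z * (‖m₁‖ ^ 3 * ‖m₂‖ ^ 2)) ^ 2 + l ^ 2) := by
            gcongr
            exact two_mul_le_add_sq _ _
        _ = _ := by rw [norm_mul, norm_mul, norm_pow, norm_pow]
    · refine le_add_of_nonneg_of_le hpos1 (hbad ?_)
      have := one_le_pow_of_quarter_le hc k
      have h0 : 0 ≤ (16:ℝ) ^ k * (q₁ ^ k) ^ 2 := by positivity
      rw [mul_add]; linarith
  · refine le_add_of_nonneg_of_le hpos1 (hbad ?_)
    have := one_le_pow_of_quarter_le ha k
    have h0 : 0 ≤ (16:ℝ) ^ k * (q₂ ^ k) ^ 2 := by positivity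
    rw [mul_add]; linarith

lemma integral_comp_two_mul_le {f : ℝ → ℝ} (hf : Continuous f) (h0 : ∀ t, 0 ≤ f t) {a T : ℝ}
    (ha : 0 ≤ a) (haT : a ≤ T) :
    ∫ u in a..T, f (2 * u) ≤ ∫ t in (-(2 * T))..(2 * T), f t := by
  rw [intervalIntegral.integral_comp_mul_left f (two_ne_zero), smul_eq_mul]
  have h1 : ∫ t in (2 * a)..(2 * T), f t ≤ ∫ t in (-(2 * T))..(2 * T), f t :=
    intervalIntegral.integral_mono_interval (by linarith) (by linarith) le_rfl
      (ae_of_all _ h0) (hf.intervalIntegrable _ _)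
  have h2 : 0 ≤ ∫ t in (2 * a)..(2 * T), f t :=
    intervalIntegral.integral_nonneg (by linarith) fun t _ => h0 t
  linarith

lemma exists_integral_criticalIntegrand_tail_le : ∃ C : ℝ, 0 ≤ C ∧ ∀ T : ℝ, 2 ^ 90 ≤ T →
    ∫ u in (Real.sqrt T)..T, criticalIntegrand u ≤ C * (T * Real.log T) := by
  obtain ⟨B, hB, hpt⟩ := exists_criticalIntegrand_le 80
  obtain ⟨C₁, hC₁, h1⟩ := exists_integral_norm_sq_zeta_mul_oneLineSeries_le
  obtain ⟨C₂, hC₂, h2⟩ := charSeries_chiThree.integral_norm_sq_le (α := 1/2) le_rfl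
  obtain ⟨C₃, hC₃, h3⟩ := CharSeries.exists_integral_norm_defect_le (k := 80) (by norm_num)
    (show (0:ℝ) < 1/48 by norm_num)
  refine ⟨16 * (C₁ + C₂) + B * (4 * C₃), by positivity, fun T hT => ?_⟩
  have hT28 : (2:ℝ) ^ 28 ≤ T := le_trans (by norm_num) hT
  have hT2 : 2 ≤ T := le_trans (by norm_num) hT
  have hT0 : 0 < T := by linarith
  have hsq1 : 1 ≤ Real.sqrt T := Real.one_le_sqrt.2 (by linarith)
  have hsqT : Real.sqrt T ≤ T := by
    rw [Real.sqrt_le_left (by linarith)]; nlinarith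
  set Y := ⌊T ^ (1/40 : ℝ)⌋₊ with hY
  have hT40 : (T ^ (1/40 : ℝ)) ^ 40 = T := by
    rw [← Real.rpow_natCast, ← Real.rpow_mul hT0.le]; norm_num
  have hr1 : 1 ≤ T ^ (1/40 : ℝ) := Real.one_le_rpow (by linarith) (by norm_num)
  have hY1 : 1 ≤ Y := (Nat.one_le_floor_iff _).2 hr1
  have hYr : (Y:ℝ) ≤ T ^ (1/40 : ℝ) := Nat.floor_le (by positivity)
  have hY1' : (1:ℝ) ≤ Y := by exact_mod_cast hY1
  have hY40 : (Y:ℝ) ^ 40 ≤ T := by rw [← hT40]; gcongr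
  have hYT : (Y:ℝ) ≤ T := (le_self_pow₀ hY1' (by norm_num)).trans hY40
  have hY80 : 2 * T ≤ (Y:ℝ) ^ 80 := by
    have h2Y : T ^ (1/40 : ℝ) ≤ 2 * Y := by
      have := Nat.lt_floor_add_one (T ^ (1/40 : ℝ)); linarith
    have : T ≤ (2 * Y) ^ 40 := by rw [← hT40]; gcongr
    have h4 : T ^ 2 ≤ 2 ^ 80 * (Y:ℝ) ^ 80 := by
      calc T ^ 2 ≤ ((2 * Y) ^ 40) ^ 2 := by gcongr
        _ = _ := by ring
    have h5 : (2:ℝ) ^ 80 * (2 * T) ≤ T ^ 2 := by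
      calc (2:ℝ) ^ 80 * (2 * T) = 2 ^ 81 * T := by ring
        _ ≤ T * T := by gcongr; exact le_trans (by norm_num) hT
        _ = _ := by ring
    have := h5.trans h4
    exact le_of_mul_le_mul_left this (by positivity)
  set g := mollifier (fun _ => 1) Y ^ 3 * mollifier (fun n => chiThree (n : ZMod 3)) Y ^ 2 with hg
  have hb1 := charSeries_riemannZeta.divisorBounded_mollifier Y
  have hb2 := charSeries_chiThree.divisorBounded_mollifier Y
  have hgb : DivisorBounded 5 g 0 (Y ^ 5) := by
    have := (hb1.pow (k := 3) (by norm_num)).mul (hb2.pow (k := 2) (by norm_num))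
    norm_num [← pow_add] at this
    exact this
  have hYN : Y ≤ ⌈T ^ 2⌉₊ := by
    have h5 : (Y:ℝ) ≤ ⌈T ^ 2⌉₊ := by
      refine le_trans ?_ (Nat.le_ceil _)
      nlinarith
    exact_mod_cast h5
  set Q₁ := oneLineSeries (mollifierDefect (fun _ => 1) ⌈T ^ 2⌉₊ Y) with hQ₁
  set Q₂ := oneLineSeries (mollifierDefect (fun n => chiThree (n : ZMod 3)) ⌈T ^ 2⌉₊ Y) with hQ₂
  have hQc₁ : Continuous fun t => (‖Q₁ t‖ ^ 80) ^ 2 :=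
    ((charSeries_riemannZeta.divisorBounded_mollifierDefect hY1 hYN).continuous.norm.pow 80).pow 2
  have hQc₂ : Continuous fun t => (‖Q₂ t‖ ^ 80) ^ 2 :=
    ((charSeries_chiThree.divisorBounded_mollifierDefect hY1 hYN).continuous.norm.pow 80).pow 2
  have hQi₁ : ∫ u in (Real.sqrt T)..T, (‖Q₁ (2 * u)‖ ^ 80) ^ 2 ≤ C₃ * T ^ (1/48 : ℝ) :=
    (integral_comp_two_mul_le hQc₁ (fun t => sq_nonneg _) (by linarith) hsqT).trans
      (h3 _ _ _ charSeries_riemannZeta T hT2 Y hYT hY80)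
  have hQi₂ : ∫ u in (Real.sqrt T)..T, (‖Q₂ (2 * u)‖ ^ 80) ^ 2 ≤ C₃ * T ^ (1/48 : ℝ) :=
    (integral_comp_two_mul_le hQc₂ (fun t => sq_nonneg _) (by linarith) hsqT).trans
      (h3 _ _ _ charSeries_chiThree T hT2 Y hYT hY80)
  have hzc : Continuous fun u : ℝ => ‖riemannZeta ((1 / 2 : ℝ) + u * I) * oneLineSeries g (2 * u)‖ ^ 2 :=
    ((charSeries_riemannZeta.continuous_half_line.mul
      (hgb.continuous.comp (continuous_const.mul continuous_id))).norm.pow 2)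
  have hlc : Continuous fun u : ℝ => ‖lThree ((1 / 2 : ℝ) + u * I)‖ ^ 2 :=
    charSeries_chiThree.continuous_half_line.norm.pow 2
  have hzi : ∫ u in (Real.sqrt T)..T, ‖riemannZeta ((1 / 2 : ℝ) + u * I) * oneLineSeries g (2 * u)‖ ^ 2
      ≤ C₁ * (T * Real.log T) :=
    (intervalIntegral.integral_mono_interval hsq1 hsqT le_rfl (ae_of_all _ fun u => by positivity)
      (hzc.intervalIntegrable _ _)).trans (h1 g Y hY1 hgb T hT2 hY40)
  have hli : ∫ u in (Real.sqrt T)..T, ‖lThree ((1 / 2 : ℝ) + u * I)‖ ^ 2 ≤ C₂ * (T * Real.log T) :=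
    (intervalIntegral.integral_mono_interval hsq1 hsqT le_rfl (ae_of_all _ fun u => by positivity)
      (hlc.intervalIntegrable _ _)).trans (h2 T hT2)
  have hq1c : Continuous fun u : ℝ => (‖Q₁ (2 * u)‖ ^ 80) ^ 2 :=
    hQc₁.comp (continuous_const.mul continuous_id)
  have hq2c : Continuous fun u : ℝ => (‖Q₂ (2 * u)‖ ^ 80) ^ 2 :=
    hQc₂.comp (continuous_const.mul continuous_id)
  have hlogT : 1 / 2 ≤ Real.log T :=
    (by linarith [Real.log_two_gt_d9] : (1:ℝ) / 2 ≤ Real.log 2).trans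
      (Real.log_le_log (by norm_num) hT2)
  have hi₁ : IntervalIntegrable (fun u : ℝ =>
      16 * (‖riemannZeta ((1 / 2 : ℝ) + u * I) * oneLineSeries g (2 * u)‖ ^ 2 +
        ‖lThree ((1 / 2 : ℝ) + u * I)‖ ^ 2)) volume (Real.sqrt T) T :=
    (continuous_const.mul (hzc.add hlc)).intervalIntegrable _ _
  have hi₂ : IntervalIntegrable (fun u : ℝ => B * T ^ (47 / 48 : ℝ) *
      ((‖Q₁ (2 * u)‖ ^ 80) ^ 2 + (‖Q₂ (2 * u)‖ ^ 80) ^ 2)) volume (Real.sqrt T) T :=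
    (continuous_const.mul (hq1c.add hq2c)).intervalIntegrable _ _
  calc ∫ u in (Real.sqrt T)..T, criticalIntegrand u
      ≤ ∫ u in (Real.sqrt T)..T, (16 * (‖riemannZeta ((1 / 2 : ℝ) + u * I) * oneLineSeries g (2 * u)‖ ^ 2 +
        ‖lThree ((1 / 2 : ℝ) + u * I)‖ ^ 2) + B * T ^ (47 / 48 : ℝ) *
          ((‖Q₁ (2 * u)‖ ^ 80) ^ 2 + (‖Q₂ (2 * u)‖ ^ 80) ^ 2)) :=
        intervalIntegral.integral_mono_on hsqT
          (intervalIntegrable_criticalIntegrand hsq1 (by linarith))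
          (hi₁.add hi₂)
          fun u hu => hpt T hT28 Y hYT u hu.1 hu.2
    _ = 16 * ((∫ u in (Real.sqrt T)..T, ‖riemannZeta ((1 / 2 : ℝ) + u * I) * oneLineSeries g (2 * u)‖ ^ 2)
          + ∫ u in (Real.sqrt T)..T, ‖lThree ((1 / 2 : ℝ) + u * I)‖ ^ 2) + B * T ^ (47 / 48 : ℝ) *
          ((∫ u in (Real.sqrt T)..T, (‖Q₁ (2 * u)‖ ^ 80) ^ 2) +
            ∫ u in (Real.sqrt T)..T, (‖Q₂ (2 * u)‖ ^ 80) ^ 2) := by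
        rw [intervalIntegral.integral_add hi₁ hi₂,
          intervalIntegral.integral_const_mul, intervalIntegral.integral_const_mul,
          intervalIntegral.integral_add (hzc.intervalIntegrable _ _) (hlc.intervalIntegrable _ _),
          intervalIntegral.integral_add (hq1c.intervalIntegrable _ _) (hq2c.intervalIntegrable _ _)]
    _ ≤ 16 * (C₁ * (T * Real.log T) + C₂ * (T * Real.log T)) + B * T ^ (47 / 48 : ℝ) *
          (C₃ * T ^ (1/48 : ℝ) + C₃ * T ^ (1/48 : ℝ)) := by gcongr
    _ = 16 * (C₁ + C₂) * (T * Real.log T) + B * (2 * C₃) * (T ^ (47/48 : ℝ) * T ^ (1/48 : ℝ)) := by ring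
    _ = 16 * (C₁ + C₂) * (T * Real.log T) + B * (2 * C₃) * T := by
        rw [← Real.rpow_add hT0]; norm_num
    _ ≤ 16 * (C₁ + C₂) * (T * Real.log T) + B * (2 * C₃) * (2 * (T * Real.log T)) := by
        gcongr; nlinarith
    _ = _ := by ring

theorem exists_integral_criticalIntegrand_le : ∃ C : ℝ, 0 ≤ C ∧ ∀ T : ℝ, 2 ≤ T →
    ∫ u in (1:ℝ)..T, criticalIntegrand u ≤ C * (T * Real.log T) := by
  obtain ⟨C₁, hC₁, h1⟩ := exists_integral_criticalIntegrand_le_rpow one_pos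
  obtain ⟨C₂, hC₂, h2⟩ := exists_integral_criticalIntegrand_tail_le
  refine ⟨C₁ * 2 ^ 90 + C₂, by positivity, fun T hT => ?_⟩
  have hT0 : 0 < T := by linarith
  have hL : 0 < Real.log T := Real.log_pos (by linarith)
  rcases le_or_gt T (2 ^ 90) with hsmall | hlarge
  · refine (h1 T hT).trans ?_
    gcongr
    rw [Real.rpow_one]
    refine le_add_of_le_of_nonneg ?_ hC₂
    gcongr
  · have hs2 : 2 ≤ Real.sqrt T := by
      rw [Real.le_sqrt (by norm_num) hT0.le]
      exact le_trans (by norm_num) hlarge.le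
    have hsT : Real.sqrt T ≤ T := by
      rw [Real.sqrt_le_left (by linarith)]; nlinarith
    rw [← intervalIntegral.integral_add_adjacent_intervals
      (intervalIntegrable_criticalIntegrand le_rfl (show 1 ≤ Real.sqrt T by linarith))
      (intervalIntegrable_criticalIntegrand (by linarith) (by linarith)), add_mul]
    refine add_le_add ?_ (h2 T hlarge.le)
    refine (h1 _ hs2).trans ?_
    rw [Real.rpow_one]
    have hlog : Real.log (Real.sqrt T) ≤ Real.log T := Real.log_le_log (by linarith) hsT
    calc C₁ * Real.sqrt T * (Real.sqrt T * Real.log (Real.sqrt T))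
        ≤ C₁ * Real.sqrt T * (Real.sqrt T * Real.log T) := by gcongr
      _ = C₁ * 1 * ((Real.sqrt T * Real.sqrt T) * Real.log T) := by ring
      _ = C₁ * 1 * (T * Real.log T) := by rw [Real.mul_self_sqrt hT0.le]
      _ ≤ C₁ * 2 ^ 90 * (T * Real.log T) := by gcongr; norm_num

end CriticalLineMean

section VerticalLineMean
open MeasureTheory Set Filter Topology

/-- The norm of `ζ(2s) L(2s, χ) ζ(4s)⁻³ L(4s, χ)⁻²` on the line `Re s = σ`, at height `u / 2`. -/
noncomputable def verticalIntegrand (σ u : ℝ) : ℝ :=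
  ‖riemannZeta ((2 * σ : ℝ) + u * I)‖ * ‖lThree ((2 * σ : ℝ) + u * I)‖ *
    (‖(riemannZeta ((4 * σ : ℝ) + (2 * u : ℝ) * I))⁻¹‖ ^ 3 *
      ‖(lThree ((4 * σ : ℝ) + (2 * u : ℝ) * I))⁻¹‖ ^ 2)

lemma verticalIntegrand_quarter (u : ℝ) : verticalIntegrand (1 / 4) u = criticalIntegrand u := by
  norm_num [verticalIntegrand, criticalIntegrand]

lemma CharSeries.continuousOn_vertical {a F ρ} (h : CharSeries a F ρ) (α : ℝ) {k : ℝ} (hk : 0 < k) :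
    ContinuousOn (fun u : ℝ => F (α + (k * u : ℝ) * I)) (Ici 1) := by
  intro u hu
  refine ContinuousAt.continuousWithinAt ?_
  refine ContinuousAt.comp (f := fun u : ℝ => (α : ℂ) + (k * u : ℝ) * I) ?_ (by fun_prop)
  refine (h.differentiableAt _ fun h => ?_).continuousAt
  have h2 := congrArg Complex.im h
  have h3 : 0 < k * u := mul_pos hk (lt_of_lt_of_le one_pos hu)
  simp at h2
  rcases h2 with h2 | h2 <;> simp [h2] at h3

lemma norm_inv_LFunction_le {N : ℕ} [NeZero N] (χ : DirichletCharacter ℂ N) {s : ℂ} (hs : 1 < s.re) :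
    ‖(χ.LFunction s)⁻¹‖ ≤ ∑' n : ℕ, ‖LSeries.term (fun _ => 1) s.re n‖ := by
  have h := DirichletCharacter.LSeries.mul_mu_eq_one χ hs
  rw [χ.LFunction_eq_LSeries hs, inv_eq_of_mul_eq_one_right h, LSeries]
  have hsum : Summable fun n : ℕ => ‖LSeries.term (fun _ => (1:ℂ)) s.re n‖ :=
    (LSeriesSummable_one_iff.2 (by simpa using hs) : LSeriesSummable 1 (s.re : ℂ)).norm
  refine tsum_of_norm_bounded hsum.hasSum fun n => ?_
  refine (LSeries.norm_term_le s (g := fun _ => 1) ?_).trans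
    (LSeries.norm_term_le_of_re_le_re _ (by simp) n)
  simp only [Pi.mul_apply, norm_mul, norm_one]
  refine mul_le_one₀ (χ.norm_le_one _) (norm_nonneg _) ?_
  rw [Complex.norm_intCast]
  exact_mod_cast ArithmeticFunction.abs_moebius_le_one

lemma continuousOn_verticalIntegrand {σ : ℝ} (hσ : 1 / 4 ≤ σ) :
    ContinuousOn (verticalIntegrand σ) (Ici 1) := by
  have h1 (α : ℝ) := charSeries_riemannZeta.continuousOn_vertical α one_pos
  have h2 (α : ℝ) := charSeries_chiThree.continuousOn_vertical α one_pos
  simp only [one_mul] at h1 h2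
  have h3 (α : ℝ) := charSeries_riemannZeta.continuousOn_vertical α two_pos
  have h4 (α : ℝ) := charSeries_chiThree.continuousOn_vertical α two_pos
  have hre (u : ℝ) : 1 ≤ (((4 * σ : ℝ) : ℂ) + (2 * u : ℝ) * I).re := by
    simp; linarith
  refine ((h1 _).norm.mul (h2 _).norm).mul ((((h3 _).inv₀ fun u _ => ?_).norm.pow 3).mul
    (((h4 _).inv₀ fun u _ => ?_).norm.pow 2))
  · exact riemannZeta_ne_zero_of_one_le_re (hre u)
  · exact DirichletCharacter.LFunction_ne_zero_of_one_le_re _ (Or.inl chiThree_ne_one) (hre u)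

lemma intervalIntegrable_verticalIntegrand {σ : ℝ} (hσ : 1 / 4 ≤ σ) {a b : ℝ} (ha : 1 ≤ a)
    (hb : 1 ≤ b) : IntervalIntegrable (verticalIntegrand σ) volume a b :=
  ((continuousOn_verticalIntegrand hσ).mono fun _ hx =>
    (le_min ha hb).trans (Set.mem_Icc.1 hx).1).intervalIntegrable

theorem exists_integral_verticalIntegrand_le {σ : ℝ} (hσ : 1 / 4 ≤ σ) :
    ∃ C : ℝ, 0 ≤ C ∧ ∀ T : ℝ, 2 ≤ T →
      ∫ u in (1:ℝ)..T, verticalIntegrand σ u ≤ C * (T * Real.log T) := by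
  rcases hσ.eq_or_lt with rfl | hlt
  · simpa only [verticalIntegrand_quarter] using exists_integral_criticalIntegrand_le
  obtain ⟨C₁, hC₁, h1⟩ := charSeries_riemannZeta.integral_norm_sq_le (α := 2 * σ) (by linarith)
  obtain ⟨C₂, hC₂, h2⟩ := charSeries_chiThree.integral_norm_sq_le (α := 2 * σ) (by linarith)
  set B := ∑' n : ℕ, ‖LSeries.term (fun _ => 1) (4 * σ : ℝ) n‖ with hB
  have hB0 : 0 ≤ B := tsum_nonneg fun _ => norm_nonneg _
  refine ⟨B ^ 5 * (C₁ + C₂), by positivity, fun T hT => ?_⟩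
  have hc1 : ContinuousOn (fun u : ℝ => ‖riemannZeta ((2 * σ : ℝ) + u * I)‖ ^ 2) (Ici 1) := by
    have := charSeries_riemannZeta.continuousOn_vertical (2 * σ) one_pos
    simp only [one_mul] at this
    exact this.norm.pow 2
  have hc2 : ContinuousOn (fun u : ℝ => ‖lThree ((2 * σ : ℝ) + u * I)‖ ^ 2) (Ici 1) := by
    have := charSeries_chiThree.continuousOn_vertical (2 * σ) one_pos
    simp only [one_mul] at this
    exact this.norm.pow 2
  have hsub : uIcc 1 T ⊆ Ici 1 := by
    rw [uIcc_of_le (by linarith)]; exact Icc_subset_Ici_self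
  have hi1 := (hc1.mono hsub).intervalIntegrable (μ := volume)
  have hi2 := (hc2.mono hsub).intervalIntegrable (μ := volume)
  have hinv (u : ℝ) : ‖(riemannZeta ((4 * σ : ℝ) + (2 * u : ℝ) * I))⁻¹‖ ≤ B ∧
      ‖(lThree ((4 * σ : ℝ) + (2 * u : ℝ) * I))⁻¹‖ ≤ B := by
    have hre : (((4 * σ : ℝ) : ℂ) + (2 * u : ℝ) * I).re = 4 * σ := by simp
    have hre1 : 1 < (((4 * σ : ℝ) : ℂ) + (2 * u : ℝ) * I).re := by rw [hre]; linarith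
    constructor
    · have := norm_inv_LFunction_le (1 : DirichletCharacter ℂ 1) hre1
      rwa [DirichletCharacter.LFunction_modOne_eq, hre] at this
    · have := norm_inv_LFunction_le chiThree hre1
      rwa [hre] at this
  calc ∫ u in (1:ℝ)..T, verticalIntegrand σ u
      ≤ ∫ u in (1:ℝ)..T, B ^ 5 * (‖riemannZeta ((2 * σ : ℝ) + u * I)‖ ^ 2 +
          ‖lThree ((2 * σ : ℝ) + u * I)‖ ^ 2) := by
        refine intervalIntegral.integral_mono_on (by linarith)
          (intervalIntegrable_verticalIntegrand hσ le_rfl (by linarith))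
          ((hi1.add hi2).const_mul _) fun u _ => ?_
        obtain ⟨hz, hl⟩ := hinv u
        rw [verticalIntegrand, mul_comm, show B ^ 5 = B ^ 3 * B ^ 2 by ring]
        gcongr
        nlinarith [sq_nonneg (‖riemannZeta ((2 * σ : ℝ) + u * I)‖ -
          ‖lThree ((2 * σ : ℝ) + u * I)‖), sq_nonneg ‖riemannZeta ((2 * σ : ℝ) + u * I)‖,
          sq_nonneg ‖lThree ((2 * σ : ℝ) + u * I)‖]
    _ = B ^ 5 * ((∫ u in (1:ℝ)..T, ‖riemannZeta ((2 * σ : ℝ) + u * I)‖ ^ 2) +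
          ∫ u in (1:ℝ)..T, ‖lThree ((2 * σ : ℝ) + u * I)‖ ^ 2) := by
        rw [intervalIntegral.integral_const_mul, intervalIntegral.integral_add hi1 hi2]
    _ ≤ B ^ 5 * (C₁ * (T * Real.log T) + C₂ * (T * Real.log T)) := by
        gcongr
        · exact h1 T hT
        · exact h2 T hT
    _ = _ := by ring

/-- A function dominated by `verticalIntegrand` at height `2t` for `t ≥ 1/2` has mean `≪ T log T`,
with no assumption on its behaviour near `t = 0`. -/
theorem exists_integral_le_of_le_verticalIntegrand {σ M : ℝ} (hσ : 1 / 4 ≤ σ) (hM : 0 ≤ M) {f : ℝ → ℝ}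
    (hf : ∀ t : ℝ, 1 / 2 ≤ t → f t ≤ M * verticalIntegrand σ (2 * t)) :
    ∃ C : ℝ, ∀ T : ℝ, 2 ≤ T → ∫ t in (0:ℝ)..T, f t ≤ C * (T * Real.log T) := by
  obtain ⟨C, hC, h⟩ := exists_integral_verticalIntegrand_le hσ
  refine ⟨|∫ t in (0:ℝ)..(1 / 2), f t| + M * (2 * C), fun T hT => ?_⟩
  have hlog : 1 / 2 ≤ Real.log T :=
    (by linarith [Real.log_two_gt_d9] : (1:ℝ) / 2 ≤ Real.log 2).trans
      (Real.log_le_log (by norm_num) hT)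
  have hTlog : 1 ≤ T * Real.log T := by nlinarith
  by_cases hi : IntervalIntegrable f volume 0 T
  swap
  · rw [intervalIntegral.integral_undef hi]; positivity
  have hi1 : IntervalIntegrable f volume 0 (1 / 2) :=
    hi.mono_set (by
      rw [uIcc_of_le (by norm_num), uIcc_of_le (by linarith)]
      exact Icc_subset_Icc le_rfl (by linarith))
  have hi2 : IntervalIntegrable f volume (1 / 2) T :=
    hi.mono_set (by
      rw [uIcc_of_le (by linarith), uIcc_of_le (by linarith)]
      exact Icc_subset_Icc (by norm_num) le_rfl)
  have hv : IntervalIntegrable (fun t => verticalIntegrand σ (2 * t)) volume (1 / 2) T := by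
    refine ContinuousOn.intervalIntegrable ?_
    rw [uIcc_of_le (by linarith)]
    refine (continuousOn_verticalIntegrand hσ).comp (by fun_prop) fun t ht => ?_
    have := ht.1
    simp only [mem_Ici]; linarith
  rw [← intervalIntegral.integral_add_adjacent_intervals hi1 hi2, add_mul]
  refine add_le_add ?_ ?_
  · exact (le_abs_self _).trans (le_mul_of_one_le_right (abs_nonneg _) hTlog)
  calc ∫ t in (1 / 2)..T, f t ≤ ∫ t in (1 / 2)..T, M * verticalIntegrand σ (2 * t) :=
        intervalIntegral.integral_mono_on (by linarith) hi2 (hv.const_mul _) fun t ht => hf t ht.1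
    _ = M * (1 / 2 * ∫ u in (1:ℝ)..(2 * T), verticalIntegrand σ u) := by
        rw [intervalIntegral.integral_const_mul, intervalIntegral.integral_comp_mul_left _ two_ne_zero]
        norm_num
    _ ≤ M * (1 / 2 * (C * (2 * T * Real.log (2 * T)))) := by
        gcongr
        exact h _ (by linarith)
    _ ≤ M * (1 / 2 * (C * (2 * T * (2 * Real.log T)))) := by
        gcongr
        rw [Real.log_mul two_ne_zero (by linarith), two_mul]
        gcongr
    _ = _ := by ring

end VerticalLineMean

section IdealCount
open NumberField Ideal

variable (K : Type*) [Field K] [NumberField K]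

/-- The number of integral ideals of norm `n`. -/
noncomputable def idealCount (n : ℕ) : ℕ := Nat.card {I : Ideal (𝓞 K) // absNorm I = n}

lemma idealCount_one : idealCount K 1 = 1 := by
  rw [idealCount, Nat.card_eq_one_iff_unique]
  refine ⟨⟨fun I J => Subtype.ext ?_⟩, ⟨⟨⊤, absNorm_top⟩⟩⟩
  rw [absNorm_eq_one_iff.1 I.2, absNorm_eq_one_iff.1 J.2]

variable {K}

lemma isCoprime_of_absNorm_coprime {I J : Ideal (𝓞 K)} (h : (absNorm I).Coprime (absNorm J)) :
    IsCoprime I J := by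
  rw [Ideal.isCoprime_iff_exists]
  obtain ⟨a, b, hab⟩ := Nat.isCoprime_iff_coprime.2 h
  refine ⟨(a : 𝓞 K) * absNorm I, I.mul_mem_left _ (absNorm_mem I), (b : 𝓞 K) * absNorm J,
    J.mul_mem_left _ (absNorm_mem J), ?_⟩
  exact_mod_cast congrArg (Int.cast : ℤ → 𝓞 K) hab

lemma sup_span_mul_sup_span {L : Ideal (𝓞 K)} {m n : ℕ} (hmn : m.Coprime n)
    (hL : absNorm L = m * n) : (L ⊔ span {(m : 𝓞 K)}) * (L ⊔ span {(n : 𝓞 K)}) = L := by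
  apply le_antisymm
  · rw [Ideal.sup_mul, Ideal.mul_sup, Ideal.mul_sup]
    refine sup_le (sup_le Ideal.mul_le_left Ideal.mul_le_left) (sup_le Ideal.mul_le_right ?_)
    rw [Ideal.span_singleton_mul_span_singleton, Ideal.span_singleton_le_iff_mem, ← Nat.cast_mul,
      ← hL]
    exact absNorm_mem L
  · intro x hx
    obtain ⟨a, b, hab⟩ := Nat.isCoprime_iff_coprime.2 hmn
    have h1 : (a : 𝓞 K) * m + b * n = 1 := by
      exact_mod_cast congrArg (Int.cast : ℤ → 𝓞 K) hab
    have hm : (m : 𝓞 K) ∈ L ⊔ span {(m : 𝓞 K)} :=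
      Ideal.mem_sup_right (Ideal.mem_span_singleton_self _)
    have hn : (n : 𝓞 K) ∈ L ⊔ span {(n : 𝓞 K)} :=
      Ideal.mem_sup_right (Ideal.mem_span_singleton_self _)
    have : x = a * ((m : 𝓞 K) * x) + b * (x * n) := by linear_combination -x * h1
    rw [this]
    exact Ideal.add_mem _
      (Ideal.mul_mem_left _ _ (Ideal.mul_mem_mul hm (Ideal.mem_sup_left hx)))
      (Ideal.mul_mem_left _ _ (Ideal.mul_mem_mul (Ideal.mem_sup_left hx) hn))

lemma absNorm_sup_span_dvd (L : Ideal (𝓞 K)) (m : ℕ) :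
    absNorm (L ⊔ span {(m : 𝓞 K)}) ∣ m ^ Module.finrank ℤ (𝓞 K) := by
  rw [← absNorm_span_natCast]
  exact map_dvd absNorm (Ideal.dvd_iff_le.2 le_sup_right)

lemma idealCount_mul {m n : ℕ} (hm : m ≠ 0) (hn : n ≠ 0) (hmn : m.Coprime n) :
    idealCount K (m * n) = idealCount K m * idealCount K n := by
  rw [idealCount, idealCount, idealCount, ← Nat.card_prod]
  symm
  refine Nat.card_congr (Equiv.ofBijective
    (fun x => ⟨x.1.1 * x.2.1, by rw [map_mul, x.1.2, x.2.2]⟩) ⟨?_, ?_⟩)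
  · rintro ⟨⟨I, hI⟩, ⟨J, hJ⟩⟩ ⟨⟨I', hI'⟩, ⟨J', hJ'⟩⟩ h
    simp only [Subtype.mk.injEq] at h
    have dvd_of {A B C D : Ideal (𝓞 K)} (h : A * B = C * D)
        (hAD : (absNorm A).Coprime (absNorm D)) : A ∣ C :=
      (isCoprime_of_absNorm_coprime hAD).dvd_of_dvd_mul_right (h ▸ dvd_mul_right A B)
    have h1 : I = I' := le_antisymm
      (Ideal.dvd_iff_le.1 (dvd_of h.symm (by rwa [hI', hJ])))
      (Ideal.dvd_iff_le.1 (dvd_of h (by rwa [hI, hJ'])))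
    rw [mul_comm I, mul_comm I'] at h
    have h2 : J = J' := le_antisymm
      (Ideal.dvd_iff_le.1 (dvd_of h.symm (by rw [hJ', hI]; exact hmn.symm)))
      (Ideal.dvd_iff_le.1 (dvd_of h (by rw [hJ, hI']; exact hmn.symm)))
    simp [h1, h2]
  · rintro ⟨L, hL⟩
    set A := L ⊔ span {(m : 𝓞 K)} with hA
    set B := L ⊔ span {(n : 𝓞 K)} with hB
    have hAB : A * B = L := sup_span_mul_sup_span hmn hL
    have hN : absNorm A * absNorm B = m * n := by rw [← map_mul, hAB, hL]
    have hAm : absNorm A ∣ m := by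
      have : (absNorm A).Coprime n := Nat.Coprime.coprime_dvd_left (absNorm_sup_span_dvd L m)
        (hmn.pow_left _)
      exact this.dvd_of_dvd_mul_right (hN ▸ dvd_mul_right _ _)
    have hBn : absNorm B ∣ n := by
      have : (absNorm B).Coprime m := Nat.Coprime.coprime_dvd_left (absNorm_sup_span_dvd L n)
        (hmn.symm.pow_left _)
      exact this.dvd_of_dvd_mul_left (hN ▸ dvd_mul_left _ _)
    have hle1 := Nat.le_of_dvd (Nat.pos_of_ne_zero hm) hAm
    have hle2 := Nat.le_of_dvd (Nat.pos_of_ne_zero hn) hBn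
    have hA' : absNorm A = m := by
      by_contra hne
      have : absNorm A * absNorm B < m * n :=
        Nat.mul_lt_mul_of_lt_of_le (lt_of_le_of_ne hle1 hne) hle2 (Nat.pos_of_ne_zero hn)
      omega
    have hB' : absNorm B = n := by
      rw [hA'] at hN
      exact Nat.eq_of_mul_eq_mul_left (Nat.pos_of_ne_zero hm) hN
    exact ⟨⟨⟨A, hA'⟩, ⟨B, hB'⟩⟩, Subtype.ext hAB⟩

lemma liesOver_span_of_mem {p : ℕ} (hp : p.Prime) {R : Ideal (𝓞 K)} (hR : R.IsPrime)
    (hpR : (p : 𝓞 K) ∈ R) : R.LiesOver (span {(p : ℤ)}) := by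
  rw [Ideal.liesOver_iff]
  have hmax : (span {(p : ℤ)}).IsMaximal :=
    PrincipalIdealRing.isMaximal_of_irreducible (Nat.prime_iff_prime_int.1 hp).irreducible
  refine hmax.eq_of_le (Ideal.IsPrime.under ℤ R).ne_top ?_
  rw [Ideal.span_singleton_le_iff_mem, Ideal.under_def, Ideal.mem_comap]
  simpa using hpR

lemma exists_eq_pow_mul_pow_of_absNorm {p : ℕ} (hp : p.Prime) {P Q : Ideal (𝓞 K)}
    (hPQ : primesOver (span {(p : ℤ)}) (𝓞 K) ⊆ {P, Q}) (I : Ideal (𝓞 K)) :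
    ∀ k, absNorm I = p ^ k → ∃ i j, I = P ^ i * Q ^ j := by
  induction I using UniqueFactorizationMonoid.induction_on_prime with
  | h₁ =>
    intro k hk
    rw [Ideal.zero_eq_bot, absNorm_bot] at hk
    exact absurd hk.symm (pow_ne_zero _ hp.ne_zero)
  | h₂ I hI =>
    intro k _
    exact ⟨0, 0, by simpa using hI⟩
  | h₃ J R hJ hR ih =>
    intro k hk
    rw [map_mul] at hk
    obtain ⟨m, -, hm⟩ := (Nat.dvd_prime_pow hp).1 (Dvd.intro_left _ hk)
    obtain ⟨l, -, hl⟩ := (Nat.dvd_prime_pow hp).1 (Dvd.intro _ hk)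
    obtain ⟨i, j, hij⟩ := ih m hm
    have hRp : R.IsPrime := Ideal.isPrime_of_prime hR
    have hpR : (p : 𝓞 K) ∈ R := by
      have := absNorm_mem R
      rw [hl, Nat.cast_pow] at this
      exact hRp.mem_of_pow_mem _ this
    have : R ∈ primesOver (span {(p : ℤ)}) (𝓞 K) := ⟨hRp, liesOver_span_of_mem hp hRp hpR⟩
    rcases hPQ this with h | h
    · exact ⟨i + 1, j, by rw [hij, h]; ring⟩
    · exact ⟨i, j + 1, by rw [hij, (h : R = Q)]; ring⟩

lemma idealCount_prime_pow_of_primesOver_eq_singleton {p f : ℕ} (hp : p.Prime) (hf : f ≠ 0)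
    {P : Ideal (𝓞 K)} (hP : primesOver (span {(p : ℤ)}) (𝓞 K) = {P}) (hN : absNorm P = p ^ f)
    (k : ℕ) : idealCount K (p ^ k) = if f ∣ k then 1 else 0 := by
  have key (I : Ideal (𝓞 K)) (hI : absNorm I = p ^ k) : ∃ i, I = P ^ i ∧ f * i = k := by
    obtain ⟨i, j, h⟩ := exists_eq_pow_mul_pow_of_absNorm hp (P := P) (Q := P) (by rw [hP]; simp) I k hI
    refine ⟨i + j, by rw [h, pow_add], ?_⟩
    rw [h, ← pow_add, map_pow, hN, ← pow_mul] at hI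
    exact Nat.pow_right_injective hp.two_le hI
  rw [idealCount]
  split_ifs with h
  · obtain ⟨m, rfl⟩ := h
    rw [Nat.card_eq_one_iff_unique]
    refine ⟨⟨fun I J => Subtype.ext ?_⟩, ⟨⟨P ^ m, by rw [map_pow, hN, pow_mul]⟩⟩⟩
    obtain ⟨i, hi, hi'⟩ := key I I.2
    obtain ⟨j, hj, hj'⟩ := key J J.2
    rw [hi, hj, Nat.eq_of_mul_eq_mul_left (Nat.pos_of_ne_zero hf) (hi'.trans hj'.symm)]
  · have : IsEmpty {I : Ideal (𝓞 K) // absNorm I = p ^ k} := ⟨fun I => by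
      obtain ⟨i, -, hi⟩ := key I I.2
      exact h ⟨i, hi.symm⟩⟩
    simp

lemma idealCount_prime_pow_of_primesOver_eq_pair {p : ℕ} (hp : p.Prime) {P Q : Ideal (𝓞 K)}
    (hne : P ≠ Q) (hPQ : primesOver (span {(p : ℤ)}) (𝓞 K) = {P, Q}) (hP : absNorm P = p)
    (hQ : absNorm Q = p) (k : ℕ) : idealCount K (p ^ k) = k + 1 := by
  have hP0 : P ≠ ⊥ := fun h => hp.ne_zero (by rw [← hP, h, absNorm_bot])
  have hQ0 : Q ≠ ⊥ := fun h => hp.ne_zero (by rw [← hQ, h, absNorm_bot])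
  have hPp : Prime P := Ideal.prime_of_isPrime hP0 (hPQ.symm ▸ Set.mem_insert P {Q} :
    P ∈ primesOver (span {(p : ℤ)}) (𝓞 K)).1
  have hQp : Prime Q := Ideal.prime_of_isPrime hQ0 (hPQ.symm ▸ Set.mem_insert_of_mem P rfl :
    Q ∈ primesOver (span {(p : ℤ)}) (𝓞 K)).1
  have hlt {i j l m : ℕ} (h : P ^ i * Q ^ j = P ^ l * Q ^ m) : ¬ i < l := by
    intro hil
    obtain ⟨d, rfl⟩ := Nat.exists_eq_add_of_lt hil
    rw [show i + d + 1 = i + (d + 1) by ring, pow_add, mul_assoc] at h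
    have h2 := mul_left_cancel₀ (pow_ne_zero i hPp.ne_zero) h
    have h3 : P ∣ Q ^ j := h2 ▸ (dvd_pow_self P d.succ_ne_zero).mul_right _
    exact hne (associated_iff_eq.1 ((hPp.dvd_prime_iff_associated hQp).1 (hPp.dvd_of_dvd_pow h3)))
  rw [idealCount, ← Nat.card_fin (k + 1)]
  symm
  refine Nat.card_congr (Equiv.ofBijective (fun i => ⟨P ^ (i : ℕ) * Q ^ (k - i : ℕ), ?_⟩) ⟨?_, ?_⟩)
  · rw [map_mul, map_pow, map_pow, hP, hQ, ← pow_add, Nat.add_sub_cancel' (Nat.lt_succ_iff.1 i.2)]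
  · intro i j hij
    simp only [Subtype.mk.injEq] at hij
    have h1 := hlt hij
    have h2 := hlt hij.symm
    exact Fin.ext (by omega)
  · rintro ⟨I, hI⟩
    obtain ⟨i, j, h⟩ := exists_eq_pow_mul_pow_of_absNorm hp hPQ.le I k hI
    have hk : i + j = k := by
      rw [h, map_mul, map_pow, map_pow, hP, hQ, ← pow_add] at hI
      exact Nat.pow_right_injective hp.two_le hI
    refine ⟨⟨i, by omega⟩, Subtype.ext ?_⟩
    simp only [h]
    rw [show k - i = j by omega]

end IdealCount

section DedekindZetaThree
open NumberField Ideal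

variable (K : Type*) [Field K] [NumberField K]

lemma ncard_primesOver_mul_inertiaDegIn_three [IsCyclotomicExtension {3} ℚ K] {p : ℕ}
    [hp : Fact p.Prime] (h3 : p ≠ 3) :
    (primesOver (span {(p : ℤ)}) (𝓞 K)).ncard * orderOf (p : ZMod 3) = 2 := by
  have hdvd : ¬ p ∣ 3 := fun h => h3 ((Nat.prime_dvd_prime_iff_eq hp.out Nat.prime_three).1 h)
  have : IsGalois ℚ K := IsCyclotomicExtension.isGalois {3} ℚ K
  have h := ncard_primesOver_mul_ramificationIdxIn_mul_inertiaDegIn (span {(p : ℤ)}) (𝓞 K)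
    Gal(K/ℚ)
  rw [IsCyclotomicExtension.Rat.ramificationIdxIn_eq_of_not_dvd p K hdvd, one_mul,
    IsCyclotomicExtension.Rat.inertiaDegIn_eq_of_not_dvd p K hdvd,
    IsGalois.card_aut_eq_finrank, IsCyclotomicExtension.finrank K
      (Polynomial.cyclotomic.irreducible_rat (n := 3) (by norm_num))] at h
  simpa [Nat.totient_prime Nat.prime_three] using h

lemma absNorm_eq_pow_orderOf [IsCyclotomicExtension {3} ℚ K] {p : ℕ} [hp : Fact p.Prime]
    (h3 : p ≠ 3) {P : Ideal (𝓞 K)} (hP : P ∈ primesOver (span {(p : ℤ)}) (𝓞 K)) :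
    absNorm P = p ^ orderOf (p : ZMod 3) := by
  have hdvd : ¬ p ∣ 3 := fun h => h3 ((Nat.prime_dvd_prime_iff_eq hp.out Nat.prime_three).1 h)
  have := hP.1
  have := hP.2
  have hmax : (span {(p : ℤ)}).IsMaximal :=
    PrincipalIdealRing.isMaximal_of_irreducible (Nat.prime_iff_prime_int.1 hp.out).irreducible
  have hPmax : P.IsMaximal := .of_liesOver_isMaximal P (span {(p : ℤ)})
  rw [absNorm_eq_pow_inertiaDeg' P hp.out, inertiaDeg'_eq_inertiaDeg,
    IsCyclotomicExtension.Rat.inertiaDeg_eq_of_not_dvd p K P hdvd]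

lemma zetaMul_chiThree_prime_pow {p : ℕ} (hp : p.Prime) (k : ℕ) :
    chiThree.zetaMul (p ^ k) = ∑ j ∈ Finset.range (k + 1), chiThree (p : ZMod 3) ^ j := by
  rw [DirichletCharacter.zetaMul, ArithmeticFunction.coe_zeta_mul_apply,
    Nat.sum_divisors_prime_pow hp]
  refine Finset.sum_congr rfl fun j _ => ?_
  rw [← chiThree.apply_eq_toArithmeticFunction_apply (pow_ne_zero j hp.ne_zero)]
  simp

lemma idealCount_prime_pow [IsCyclotomicExtension {3} ℚ K] {p : ℕ} (hp : p.Prime) (k : ℕ) :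
    (idealCount K (p ^ k) : ℂ) = chiThree.zetaMul (p ^ k) := by
  have := Fact.mk hp
  rw [zetaMul_chiThree_prime_pow hp]
  by_cases h3 : p = 3
  · subst h3
    obtain ⟨P, hP⟩ := Set.ncard_eq_one.1 (IsCyclotomicExtension.Rat.ncard_primesOver_of_prime 3 K)
    have hN : absNorm P = 3 ^ 1 := by
      have hPm : P ∈ primesOver (span {((3 : ℕ) : ℤ)}) (𝓞 K) := hP ▸ rfl
      have := hPm.1
      have := hPm.2
      have hmax : (span {((3 : ℕ) : ℤ)}).IsMaximal :=
        PrincipalIdealRing.isMaximal_of_irreducible (Nat.prime_iff_prime_int.1 hp).irreducible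
      have hPmax : P.IsMaximal := .of_liesOver_isMaximal P (span {((3 : ℕ) : ℤ)})
      rw [absNorm_eq_pow_inertiaDeg' P hp, inertiaDeg'_eq_inertiaDeg,
        IsCyclotomicExtension.Rat.inertiaDeg_eq_of_prime 3 K P]
    have h0 : chiThree ((3 : ℕ) : ZMod 3) = 0 := by
      rw [show ((3 : ℕ) : ZMod 3) = 0 from rfl, chiThree_zero]
    rw [idealCount_prime_pow_of_primesOver_eq_singleton hp one_ne_zero hP hN, h0,
      Finset.sum_range_succ']
    simp
  have hmul := ncard_primesOver_mul_inertiaDegIn_three K h3 (p := p)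
  have hcases : (p : ZMod 3) = 1 ∨ (p : ZMod 3) = 2 := by
    have h0 : (p : ZMod 3) ≠ 0 := by
      rw [Ne, ZMod.natCast_eq_zero_iff]
      exact fun h => h3 ((Nat.prime_dvd_prime_iff_eq Nat.prime_three hp).1 h).symm
    revert h0
    generalize (p : ZMod 3) = x
    revert x
    decide
  rcases hcases with h | h
  · have ho : orderOf (p : ZMod 3) = 1 := by rw [h, orderOf_one]
    rw [ho, mul_one] at hmul
    obtain ⟨P, Q, hne, hPQ⟩ := Set.ncard_eq_two.1 hmul
    have hP := absNorm_eq_pow_orderOf K h3 (P := P) (p := p) (by rw [hPQ]; simp)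
    have hQ := absNorm_eq_pow_orderOf K h3 (P := Q) (p := p) (by rw [hPQ]; simp)
    rw [ho, pow_one] at hP hQ
    rw [idealCount_prime_pow_of_primesOver_eq_pair hp hne hPQ hP hQ, h, map_one]
    simp
  · have ho : orderOf (p : ZMod 3) = 2 := by
      rw [h]
      exact orderOf_eq_prime (by decide) (by decide)
    rw [ho] at hmul
    obtain ⟨P, hP⟩ := Set.ncard_eq_one.1 (by omega :
      (primesOver (span {(p : ℤ)}) (𝓞 K)).ncard = 1)
    have hN := absNorm_eq_pow_orderOf K h3 (P := P) (p := p) (by rw [hP]; simp)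
    rw [ho] at hN
    rw [idealCount_prime_pow_of_primesOver_eq_singleton hp two_ne_zero hP hN, h, chiThree_two,
      neg_one_geom_sum]
    rcases Nat.even_or_odd k with hk | hk
    · rw [if_pos hk.two_dvd, if_neg (by simp [Nat.even_add_one, hk]), Nat.cast_one]
    · have hk' := Nat.not_even_iff_odd.2 hk
      rw [if_neg (mt even_iff_two_dvd.2 hk'), if_pos (Nat.even_add_one.2 hk'), Nat.cast_zero]

lemma idealCount_eq_zetaMul [IsCyclotomicExtension {3} ℚ K] {n : ℕ} (hn : n ≠ 0) :
    (idealCount K n : ℂ) = chiThree.zetaMul n := by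
  set f : ArithmeticFunction ℂ := ⟨fun n => if n = 0 then 0 else (idealCount K n : ℂ), by simp⟩
  have hf : f.IsMultiplicative := by
    rw [ArithmeticFunction.IsMultiplicative.iff_ne_zero]
    refine ⟨by simp [f, idealCount_one], fun {m n} hm hn hmn => ?_⟩
    simp [f, hm, hn, idealCount_mul hm hn hmn]
  have := (ArithmeticFunction.IsMultiplicative.eq_iff_eq_on_prime_powers f hf _
    chiThree.isMultiplicative_zetaMul).2 fun p k hp => by
      simp [f, hp.ne_zero, ← idealCount_prime_pow K hp]
  rw [← this]
  simp [f, hn]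

lemma LSeries_zetaMul {N : ℕ} [NeZero N] (χ : DirichletCharacter ℂ N) {s : ℂ} (hs : 1 < s.re) :
    LSeries χ.zetaMul s = riemannZeta s * χ.LFunction s := by
  have h1 : LSeriesSummable (fun n => (ArithmeticFunction.zeta : ArithmeticFunction ℂ) n) s := by
    simpa using ArithmeticFunction.LSeriesSummable_zeta_iff.2 hs
  have h2 : LSeries (toArithmeticFunction (χ ·)) s = LSeries (χ ·) s :=
    LSeries_congr (fun {n} hn => (χ.apply_eq_toArithmeticFunction_apply hn).symm) s
  have h3 : LSeriesSummable (toArithmeticFunction (χ ·)) s :=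
    (LSeriesSummable_congr s fun {n} hn => (χ.apply_eq_toArithmeticFunction_apply hn).symm).2
      (χ.LSeriesSummable_of_one_lt_re hs)
  rw [DirichletCharacter.zetaMul, ArithmeticFunction.LSeries_mul' h1 h3, h2,
    χ.LFunction_eq_LSeries hs, ← ArithmeticFunction.LSeries_zeta_eq_riemannZeta hs]
  rfl

/-- The Dedekind zeta series of the third cyclotomic field is `ζ(s) L(s, χ)`. -/
theorem dedekindZetaSeries_eq_mul [IsCyclotomicExtension {3} ℚ K] {s : ℂ} (hs : 1 < s.re) :
    dedekindZetaSeries K s = riemannZeta s * chiThree.LFunction s := by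
  have hs0 : s ≠ 0 := fun h => by norm_num [h] at hs
  rw [← LSeries_zetaMul chiThree hs, LSeries, dedekindZetaSeries]
  set g : Ideal (𝓞 K) → ℂ := fun I => (absNorm I : ℂ) ^ (-s) with hg
  let e := Equiv.sigmaFiberEquiv (fun I : Ideal (𝓞 K) => absNorm I)
  have hge (x : Σ n : ℕ, {I : Ideal (𝓞 K) // absNorm I = n}) : g (e x) = (x.1 : ℂ) ^ (-s) := by
    rw [← x.2.2]; rfl
  have hfin (n : ℕ) (hn : n ≠ 0) : Finite {I : Ideal (𝓞 K) // absNorm I = n} :=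
    (finite_setOfPred_absNorm_eq n).to_subtype
  have hzero (n : ℕ) : n = 0 → (n : ℂ) ^ (-s) = 0 := by
    rintro rfl; simp [hs0]
  have hfib (n : ℕ) : HasSum (fun _ : {I : Ideal (𝓞 K) // absNorm I = n} => (n : ℂ) ^ (-s))
      (LSeries.term chiThree.zetaMul s n) := by
    rcases eq_or_ne n 0 with rfl | hn
    · simp [hs0]
    · have := hfin n hn
      have := Fintype.ofFinite {I : Ideal (𝓞 K) // absNorm I = n}
      convert hasSum_fintype (fun _ : {I : Ideal (𝓞 K) // absNorm I = n} => (n : ℂ) ^ (-s))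
      rw [LSeries.term_of_ne_zero hn, ← idealCount_eq_zetaMul K hn, idealCount, Finset.sum_const,
        Finset.card_univ, Nat.card_eq_fintype_card, nsmul_eq_mul, Complex.cpow_neg, div_eq_mul_inv]
  have hnfib (n : ℕ) : HasSum (fun _ : {I : Ideal (𝓞 K) // absNorm I = n} => ‖(n : ℂ) ^ (-s)‖)
      ‖LSeries.term chiThree.zetaMul s n‖ := by
    rcases eq_or_ne n 0 with rfl | hn
    · simp [hs0]
    · have := hfin n hn
      have := Fintype.ofFinite {I : Ideal (𝓞 K) // absNorm I = n}
      convert hasSum_fintype (fun _ : {I : Ideal (𝓞 K) // absNorm I = n} => ‖(n : ℂ) ^ (-s)‖)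
      rw [LSeries.term_of_ne_zero hn, ← idealCount_eq_zetaMul K hn, idealCount, Finset.sum_const,
        Finset.card_univ, Nat.card_eq_fintype_card, nsmul_eq_mul, Complex.cpow_neg, div_eq_mul_inv,
        norm_mul, Complex.norm_natCast]
  have hsum : Summable (fun x => g (e x)) := by
    refine Summable.of_norm ?_
    simp only [hge]
    refine (summable_sigma_of_nonneg fun _ => norm_nonneg _).2 ⟨fun n => (hnfib n).summable, ?_⟩
    simp only [(hnfib _).tsum_eq]
    exact (chiThree.LSeriesSummable_zetaMul hs).norm
  rw [← e.tsum_eq g, hsum.tsum_sigma' fun n => by simpa only [hge] using (hfib n).summable]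
  refine tsum_congr fun n => ?_
  simp only [hge]
  exact (hfib n).tsum_eq

variable {K} in
/-- The analytic continuation of the Dedekind zeta series of the third cyclotomic field. -/
theorem eq_riemannZeta_mul_LFunction [IsCyclotomicExtension {3} ℚ K] {Z : ℂ → ℂ}
    (hZdiff : ∀ s : ℂ, s ≠ 1 → DifferentiableAt ℂ Z s)
    (hZeq : ∀ s : ℂ, 1 < s.re → Z s = dedekindZetaSeries K s) {s : ℂ} (hs : s ≠ 1) :
    Z s = riemannZeta s * chiThree.LFunction s := by
  have hopen : IsOpen ({1}ᶜ : Set ℂ) := isOpen_compl_singleton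
  have hf : AnalyticOnNhd ℂ Z {1}ᶜ := DifferentiableOn.analyticOnNhd
    (fun z hz => (hZdiff z hz).differentiableWithinAt) hopen
  have hg : AnalyticOnNhd ℂ (fun z => riemannZeta z * chiThree.LFunction z) {1}ᶜ :=
    DifferentiableOn.analyticOnNhd (fun z hz => ((differentiableAt_riemannZeta hz).mul
      (DirichletCharacter.differentiable_LFunction chiThree_ne_one z)).differentiableWithinAt) hopen
  have hconn : IsPreconnected ({1}ᶜ : Set ℂ) :=
    (isConnected_compl_singleton_of_one_lt_rank (by simp [Complex.rank_real_complex]) 1).isPreconnected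
  refine hf.eqOn_of_preconnected_of_eventuallyEq hg hconn (z₀ := 2) (by simp) ?_ hs
  have : {z : ℂ | 1 < z.re} ∈ nhds (2 : ℂ) :=
    (isOpen_lt continuous_const Complex.continuous_re).mem_nhds (by simp)
  filter_upwards [this] with z hz
  rw [hZeq z hz, dedekindZetaSeries_eq_mul K hz]

end DedekindZetaThree

theorem C3_series_average_bound (K : Type*) [Field K] [NumberField K]
    [IsCyclotomicExtension {3} ℚ K]
    (Z₃ : ℂ → ℂ) (hZdiff : ∀ s : ℂ, s ≠ 1 → DifferentiableAt ℂ Z₃ s)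
    (hZeq : ∀ s : ℂ, 1 < s.re → Z₃ s = dedekindZetaSeries K s)
    (H : ℂ → ℂ) (hH : DifferentiableOn ℂ H {s : ℂ | (1:ℝ)/4 ≤ s.re})
    (M : ℝ) (hHbd : ∀ s : ℂ, (1:ℝ)/4 ≤ s.re → ‖H s‖ ≤ M)
    (σ : ℝ) (hσ : (1:ℝ)/4 ≤ σ) :
    ∃ C : ℝ, ∀ T : ℝ, 2 ≤ T →
      (∫ t in (0:ℝ)..T,
          ‖Z₃ (2 * (σ + t * I)) * (riemannZeta (4 * (σ + t * I)))⁻¹ *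
            ((Z₃ (4 * (σ + t * I)))⁻¹) ^ 2 * H (σ + t * I)‖)
        ≤ C * (T * Real.log T) := by
  have hline (t : ℝ) : ‖H (σ + t * I)‖ ≤ M := hHbd _ (by simpa using hσ)
  refine exists_integral_le_of_le_verticalIntegrand hσ ((norm_nonneg _).trans (hline 0))
    fun t ht => ?_
  have hne {k : ℝ} (hk : 0 < k) : (k : ℂ) * (σ + t * I) ≠ 1 := fun h => by
    have h2 := congrArg Complex.im h
    have h3 : 0 < k * t := by positivity
    simp at h2
    rcases h2 with h2 | h2 <;> simp [h2] at h3
  have h2 := eq_riemannZeta_mul_LFunction hZdiff hZeq (hne two_pos)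
  have h4 := eq_riemannZeta_mul_LFunction hZdiff hZeq (hne four_pos)
  push_cast at h2 h4
  rw [h2, h4, verticalIntegrand, lThree,
    show ((2 * σ : ℝ) : ℂ) + (2 * t : ℝ) * I = 2 * (σ + t * I) by push_cast; ring,
    show ((4 * σ : ℝ) : ℂ) + (2 * (2 * t) : ℝ) * I = 4 * (σ + t * I) by push_cast; ring]
  calc _ = ‖H (σ + t * I)‖ * (‖riemannZeta (2 * (σ + t * I))‖ * ‖chiThree.LFunction (2 * (σ + t * I))‖ *
        (‖(riemannZeta (4 * (σ + t * I)))⁻¹‖ ^ 3 *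
          ‖(chiThree.LFunction (4 * (σ + t * I)))⁻¹‖ ^ 2)) := by
        simp only [norm_mul, norm_pow, mul_inv]
        ring
    _ ≤ _ := by
        gcongr
        exact hline t
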